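/- arXiv:2409.16527 — 2 statements merged into one kernel-verified Lean document; each statement's English description precedes it below -/
import Mathlib

section
/- Let θ ∈ (0,1) and let ξ, ξ̃ be independent identically distributed random variables with P[ξ = k] = (1 − θ)θ^k for k = 0,1,2,…. Then for every bounded function f : ℝ → ℝ, E[ξ f(ξ)] = (θ/(1 − θ)) · E[f(ξ + ξ̃ + 1)]. -/
open Real MeasureTheory ProbabilityTheory

theorem integral_comp_nat_eq_tsum {Ω : Type*} [MeasurableSpace Ω] {μ : Measure Ω}
    [IsFiniteMeasure μ] {X : Ω → ℕ} (hX : Measurable X) {p : ℕ → ℝ}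
    (hp : ∀ n, μ.real {ω | X ω = n} = p n) {g : ℕ → ℝ}
    (hg : Summable fun n => p n * g n) :
    ∫ ω, g (X ω) ∂μ = ∑' n, p n * g n := by
  have hreal : ∀ n, (μ.map X).real {n} = p n := fun n => by
    rw [map_measureReal_apply hX (measurableSet_singleton n), ← hp n]
    rfl
  have hint : Integrable g (μ.map X) := by
    refine ⟨(measurable_of_countable g).aestronglyMeasurable, ?_⟩
    rw [hasFiniteIntegral_iff_enorm, lintegral_countable']
    have h : ∀ n, ‖g n‖ₑ * (μ.map X) {n} = ENNReal.ofReal |p n * g n| := fun n => by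
      have hn : 0 ≤ p n := hp n ▸ measureReal_nonneg
      rw [abs_mul, abs_of_nonneg hn, mul_comm, ENNReal.ofReal_mul hn, ← hreal n,
        ofReal_measureReal, Real.enorm_eq_ofReal_abs]
    simp_rw [h]
    exact hg.abs.tsum_ofReal_lt_top
  rw [← integral_map hX.aemeasurable hint.aestronglyMeasurable, integral_countable hint]
  simp [hreal]

theorem measureReal_add_eq_of_geometric {Ω : Type*} [MeasurableSpace Ω] {μ : Measure Ω}
    [IsFiniteMeasure μ] {X Y : Ω → ℕ} (hX : Measurable X) (hY : Measurable Y)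
    (hXY : IndepFun X Y μ) {θ : ℝ}
    (hpX : ∀ n : ℕ, μ.real {ω | X ω = n} = (1 - θ) * θ ^ n)
    (hpY : ∀ n : ℕ, μ.real {ω | Y ω = n} = (1 - θ) * θ ^ n) (n : ℕ) :
    μ.real {ω | X ω + Y ω = n} = (n + 1) * (1 - θ) ^ 2 * θ ^ n := by
  have hset : {ω | X ω + Y ω = n}
      = ⋃ ij ∈ Finset.HasAntidiagonal.antidiagonal n, X ⁻¹' {ij.1} ∩ Y ⁻¹' {ij.2} := by
    ext ω
    simp
  rw [hset, measureReal_biUnion_finset]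
  · have h : ∀ ij ∈ Finset.HasAntidiagonal.antidiagonal n,
        μ.real (X ⁻¹' {ij.1} ∩ Y ⁻¹' {ij.2}) = (1 - θ) ^ 2 * θ ^ n := by
      rintro ⟨i, j⟩ hij
      rw [Finset.HasAntidiagonal.mem_antidiagonal] at hij
      have hmul : μ.real (X ⁻¹' {i} ∩ Y ⁻¹' {j})
          = μ.real {ω | X ω = i} * μ.real {ω | Y ω = j} := by
        simp only [Measure.real, ← ENNReal.toReal_mul]
        exact congrArg _ (hXY.measure_inter_preimage_eq_mul _ _
          (measurableSet_singleton i) (measurableSet_singleton j))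
      rw [hmul, hpX, hpY, ← hij]
      ring
    rw [Finset.sum_congr rfl h, Finset.sum_const, Finset.Nat.card_antidiagonal, nsmul_eq_mul]
    push_cast
    ring
  · rintro ⟨i, j⟩ - ⟨i', j'⟩ - hne
    refine Set.disjoint_left.mpr fun ω h h' => hne ?_
    simp only [Set.mem_inter_iff, Set.mem_preimage, Set.mem_singleton_iff] at h h'
    rw [← h.1, ← h.2, ← h'.1, ← h'.2]
  · exact fun ij _ => (hX (measurableSet_singleton _)).inter (hY (measurableSet_singleton _))

/-- Bias identity for geometric random variables: if `ξ, ξ̃` are i.i.d. geometric with parameter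
`θ ∈ (0,1)` (i.e. `P[ξ = k] = (1−θ)θ^k` for `k ≥ 0`), then for every bounded `f : ℝ → ℝ`,
`E[ξ f(ξ)] = (θ/(1−θ)) E[f(ξ + ξ̃ + 1)]`. -/
theorem geometric_bias_identity
    (θ : ℝ) (hθ0 : 0 < θ) (hθ1 : θ < 1)
    (Ω : Type*) [MeasurableSpace Ω] (μ : Measure Ω) [IsProbabilityMeasure μ]
    (ξ ξ' : Ω → ℕ) (hξ : Measurable ξ) (hξ' : Measurable ξ')
    (hindep : IndepFun ξ ξ' μ)
    (hlaw : ∀ k : ℕ, μ {ω | ξ ω = k} = ENNReal.ofReal ((1 - θ) * θ ^ k))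
    (hlaw' : ∀ k : ℕ, μ {ω | ξ' ω = k} = ENNReal.ofReal ((1 - θ) * θ ^ k))
    (f : ℝ → ℝ) (hf_bdd : ∃ M : ℝ, ∀ x : ℝ, |f x| ≤ M) :
    ∫ ω, (ξ ω : ℝ) * f (ξ ω) ∂μ
      = θ / (1 - θ) * ∫ ω, f ((ξ ω : ℝ) + (ξ' ω : ℝ) + 1) ∂μ := by
  obtain ⟨M, hM⟩ := hf_bdd
  have hreal : ∀ {X : Ω → ℕ},
      (∀ k : ℕ, μ {ω | X ω = k} = ENNReal.ofReal ((1 - θ) * θ ^ k)) →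
      ∀ k : ℕ, μ.real {ω | X ω = k} = (1 - θ) * θ ^ k := fun h k => by
    rw [Measure.real, h k, ENNReal.toReal_ofReal]
    exact mul_nonneg (by linarith) (by positivity)
  have hsum : Summable fun k : ℕ => (1 - θ) * θ ^ k * ((k : ℝ) * f k) := by
    have hgeom : Summable fun k : ℕ => (k : ℝ) ^ 1 * θ ^ k :=
      summable_pow_mul_geometric_of_norm_lt_one 1 (by rwa [Real.norm_of_nonneg hθ0.le])
    refine .of_norm_bounded (hgeom.mul_left ((1 - θ) * M)) fun k => ?_
    have h1 : 0 ≤ 1 - θ := by linarith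
    rw [Real.norm_eq_abs, abs_mul, abs_mul, abs_mul, abs_of_nonneg h1,
      abs_of_nonneg (pow_nonneg hθ0.le k), Nat.abs_cast]
    calc (1 - θ) * θ ^ k * (k * |f k|) ≤ (1 - θ) * θ ^ k * (k * M) := by
          gcongr
          exact hM k
      _ = (1 - θ) * M * ((k : ℝ) ^ 1 * θ ^ k) := by ring
  have hne : 1 - θ ≠ 0 := by linarith
  have hshift : ∀ n : ℕ, (1 - θ) * θ ^ (n + 1) * (((n + 1 : ℕ) : ℝ) * f ((n + 1 : ℕ) : ℝ))
      = θ / (1 - θ) * ((n + 1) * (1 - θ) ^ 2 * θ ^ n * f ((n : ℝ) + 1)) := fun n => by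
    push_cast
    field_simp
    ring
  have hsum' : Summable fun n : ℕ => ((n : ℝ) + 1) * (1 - θ) ^ 2 * θ ^ n * f ((n : ℝ) + 1) := by
    have h := (summable_nat_add_iff 1).mpr hsum
    simp_rw [hshift] at h
    exact (summable_mul_left_iff (div_ne_zero hθ0.ne' hne)).mp h
  have hlhs := integral_comp_nat_eq_tsum (g := fun k => (k : ℝ) * f k) hξ (hreal hlaw) hsum
  have hrhs := integral_comp_nat_eq_tsum (X := fun ω => ξ ω + ξ' ω)
    (g := fun n => f ((n : ℝ) + 1)) (hξ.add hξ')
    (measureReal_add_eq_of_geometric hξ hξ' hindep (hreal hlaw) (hreal hlaw')) hsum'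
  simp only [Nat.cast_add] at hrhs
  rw [hlhs, hrhs, hsum.tsum_eq_zero_add, ← tsum_mul_left]
  simp_rw [hshift]
  simp
end

section
/- (de Bruijn, 1951) For every ε ∈ (0, 3/5) there exists a constant C_ε > 0 such that for all integers n ≥ 3 and m ≥ 2 with Υ(n,m) ≤ (log n)^{3/5 − ε}, one has |Ψ(n,m) − n·ρ(Υ(n,m))| ≤ C_ε · n·ρ(Υ(n,m)) · log(Υ(n,m) + 1)/log(m). -/
open Real
open scoped Classical

/-- `Psi n m` is the number of `m`-smooth integers in `{1,…,n}`. -/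
noncomputable def Psi (n m : ℕ) : ℕ :=
  ((Finset.Icc 1 n).filter (fun k => ∀ p : ℕ, p.Prime → p ∣ k → p ≤ m)).card

/-- `Upsilon n m = log n / log m`. -/
noncomputable def Upsilon (n m : ℕ) : ℝ := Real.log n / Real.log m

namespace SmoothApprox

/-! ### Growth of the zeta function -/

/-- The difference between a term of the zeta series and the corresponding integral. -/
noncomputable def zetaTerm (n : ℕ) (s : ℂ) : ℂ :=
  ((n : ℂ) + 1) ^ (-s) - (((n : ℂ) + 2) ^ (1 - s) - ((n : ℂ) + 1) ^ (1 - s)) / (1 - s)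

lemma zetaTerm_eq_integral (n : ℕ) {s : ℂ} (hs : s ≠ 1) :
    zetaTerm n s = ∫ x in ((n : ℝ) + 1)..((n : ℝ) + 2),
      (((n : ℂ) + 1) ^ (-s) - (x : ℂ) ^ (-s)) := by
  have h0 : (0 : ℝ) ∉ Set.uIcc ((n : ℝ) + 1) ((n : ℝ) + 2) := by
    rw [Set.uIcc_of_le (by linarith)]
    intro h
    have := h.1
    have : (0 : ℝ) ≤ n := n.cast_nonneg
    linarith
  have hs' : -s ≠ -1 := fun h => hs (neg_inj.mp h)
  rw [intervalIntegral.integral_sub (by simp) (intervalIntegral.intervalIntegrable_cpow (Or.inr h0)),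
    integral_cpow (Or.inr ⟨hs', h0⟩), zetaTerm]
  have e : -s + 1 = 1 - s := by ring
  simp only [e, intervalIntegral.integral_const]
  push_cast
  simp
  ring

lemma norm_zetaTerm_le (n : ℕ) {s : ℂ} (hs : s ≠ 1) (hre : 0 < s.re) {θ : ℝ} (h0 : 0 ≤ θ)
    (h1 : θ ≤ 1) : ‖zetaTerm n s‖ ≤ 2 * ‖s‖ ^ θ * ((n : ℝ) + 1) ^ (-(s.re + θ)) := by
  have hn : (0 : ℝ) < n + 1 := by positivity
  have hpos : ∀ x : ℝ, (n : ℝ) + 1 ≤ x → ‖(x : ℂ) ^ (-s)‖ ≤ ((n : ℝ) + 1) ^ (-s.re) := by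
    intro x hx
    rw [Complex.norm_cpow_eq_rpow_re_of_pos (by linarith)]
    exact Real.rpow_le_rpow_of_nonpos hn hx (by simp; linarith)
  have hkey : ∀ x ∈ Set.uIoc ((n : ℝ) + 1) ((n : ℝ) + 2),
      ‖((n : ℂ) + 1) ^ (-s) - (x : ℂ) ^ (-s)‖ ≤
        2 * ‖s‖ ^ θ * ((n : ℝ) + 1) ^ (-(s.re + θ)) := by
    intro x hx
    rw [Set.uIoc_of_le (by linarith)] at hx
    have hx1 : (n : ℝ) + 1 ≤ x := hx.1.le
    have ha : ‖((n : ℂ) + 1) ^ (-s) - (x : ℂ) ^ (-s)‖ ≤ 2 * ((n : ℝ) + 1) ^ (-s.re) := by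
      refine (norm_sub_le _ _).trans ?_
      have := hpos ((n : ℝ) + 1) le_rfl
      push_cast at this
      linarith [hpos x hx1]
    have hb : ‖((n : ℂ) + 1) ^ (-s) - (x : ℂ) ^ (-s)‖ ≤ ‖s‖ * ((n : ℝ) + 1) ^ (-s.re - 1) := by
      have hd : ∀ y ∈ Set.Icc ((n : ℝ) + 1) x,
          HasDerivWithinAt (fun y : ℝ => (y : ℂ) ^ (-s)) (-s * (y : ℂ) ^ (-s - 1))
            (Set.Icc ((n : ℝ) + 1) x) y := by
        intro y hy
        have hy0 : (0 : ℝ) < y := by linarith [hy.1]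
        have := ((hasDerivAt_id (y : ℂ)).cpow_const (c := -s)
          (Complex.ofReal_mem_slitPlane.mpr hy0)).comp_ofReal
        simpa using this.hasDerivWithinAt
      have hbd : ∀ y ∈ Set.Ico ((n : ℝ) + 1) x,
          ‖-s * (y : ℂ) ^ (-s - 1)‖ ≤ ‖s‖ * ((n : ℝ) + 1) ^ (-s.re - 1) := by
        intro y hy
        have hy0 : (0 : ℝ) < y := by linarith [hy.1]
        rw [norm_mul, norm_neg, Complex.norm_cpow_eq_rpow_re_of_pos hy0]
        gcongr
        simp only [Complex.sub_re, Complex.neg_re, Complex.one_re]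
        exact Real.rpow_le_rpow_of_nonpos hn hy.1 (by linarith)
      have := norm_image_sub_le_of_norm_deriv_le_segment' hd hbd x (Set.right_mem_Icc.mpr hx1)
      rw [norm_sub_rev]
      push_cast at this
      refine this.trans ?_
      have h3 : x - (n + 1) ≤ 1 := by linarith [hx.2]
      have : 0 ≤ ‖s‖ * ((n : ℝ) + 1) ^ (-s.re - 1) := by positivity
      nlinarith
    set N := ‖((n : ℂ) + 1) ^ (-s) - (x : ℂ) ^ (-s)‖ with hN
    have hN0 : 0 ≤ N := norm_nonneg _
    have e : N = N ^ (1 - θ) * N ^ θ := by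
      rw [← Real.rpow_add_of_nonneg hN0 (by linarith) h0]; simp
    have hs0 : 0 ≤ ‖s‖ := norm_nonneg _
    calc N = N ^ (1 - θ) * N ^ θ := e
      _ ≤ (2 * ((n : ℝ) + 1) ^ (-s.re)) ^ (1 - θ) *
          (‖s‖ * ((n : ℝ) + 1) ^ (-s.re - 1)) ^ θ := by
        gcongr
      _ = 2 ^ (1 - θ) * ‖s‖ ^ θ * ((n : ℝ) + 1) ^ (-(s.re + θ)) := by
        rw [Real.mul_rpow (by norm_num) (by positivity), Real.mul_rpow hs0 (by positivity),
          ← Real.rpow_mul hn.le, ← Real.rpow_mul hn.le]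
        have : ((n : ℝ) + 1) ^ (-(s.re + θ)) =
            ((n : ℝ) + 1) ^ (-s.re * (1 - θ)) * ((n : ℝ) + 1) ^ ((-s.re - 1) * θ) := by
          rw [← Real.rpow_add hn]; congr 1; ring
        rw [this]; ring
      _ ≤ 2 * ‖s‖ ^ θ * ((n : ℝ) + 1) ^ (-(s.re + θ)) := by
        gcongr
        calc (2 : ℝ) ^ (1 - θ) ≤ 2 ^ (1 : ℝ) :=
              Real.rpow_le_rpow_of_exponent_le (by norm_num) (by linarith)
          _ = 2 := by simp
  rw [zetaTerm_eq_integral n hs]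
  refine (intervalIntegral.norm_integral_le_of_norm_le_const hkey).trans ?_
  rw [show (n : ℝ) + 2 - (n + 1) = 1 by ring]
  simp

lemma summable_nat_add_one_rpow {p : ℝ} (hp : 1 < p) :
    Summable (fun n : ℕ => ((n : ℝ) + 1) ^ (-p)) := by
  have := (summable_nat_add_iff 1).mpr (Real.summable_nat_rpow.mpr (by linarith : -p < -1))
  simpa using this

lemma zeta_eq_tsum_zetaTerm {s : ℂ} (hs : 1 < s.re) :
    riemannZeta s = ∑' n, zetaTerm n s + 1 / (s - 1) := by
  have hs1 : s ≠ 1 := by rintro rfl; simp at hs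
  have hsum : Summable (fun n => zetaTerm n s) := by
    refine Summable.of_norm_bounded (g := fun n : ℕ => 2 * ‖s‖ ^ (0 : ℝ) * ((n : ℝ) + 1) ^ (-(s.re + 0)))
      ?_ (fun n => norm_zetaTerm_le n hs1 (by linarith) le_rfl zero_le_one)
    exact (summable_nat_add_one_rpow (by simpa using hs)).mul_left _
  have hz : Summable (fun n : ℕ => ((n : ℂ) + 1) ^ (-s)) := by
    refine Summable.of_norm ?_
    refine (summable_nat_add_one_rpow hs).congr fun n => ?_
    have := Complex.norm_cpow_eq_rpow_re_of_pos (show (0 : ℝ) < n + 1 by positivity) (-s)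
    push_cast at this
    rw [this]; simp
  have hzeta : riemannZeta s = ∑' n : ℕ, ((n : ℂ) + 1) ^ (-s) := by
    rw [zeta_eq_tsum_one_div_nat_add_one_cpow hs]
    exact tsum_congr fun n => by rw [Complex.cpow_neg, one_div]
  set g : ℕ → ℂ := fun n => ((n : ℂ) + 1) ^ (1 - s) / (1 - s) with hg
  have hdiff : ∀ n : ℕ, ((n : ℂ) + 1) ^ (-s) - zetaTerm n s = g (n + 1) - g n := by
    intro n
    simp only [zetaTerm, hg]
    push_cast
    rw [show (n : ℂ) + 1 + 1 = n + 2 by ring]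
    ring
  have hS := (hz.sub hsum)
  have hlim := hS.hasSum.tendsto_sum_nat
  have hg0 : Filter.Tendsto g Filter.atTop (nhds 0) := by
    rw [tendsto_zero_iff_norm_tendsto_zero]
    have h1 : ∀ n, ‖g n‖ = ((n + 1 : ℕ) : ℝ) ^ (-(s.re - 1)) / ‖1 - s‖ := by
      intro n
      have := Complex.norm_cpow_eq_rpow_re_of_pos (show (0 : ℝ) < n + 1 by positivity) (1 - s)
      push_cast at this
      simp only [hg, norm_div, this]
      push_cast
      simp
    simp only [h1]
    have h2 : Filter.Tendsto (fun n : ℕ => ((n + 1 : ℕ) : ℝ) ^ (-(s.re - 1))) Filter.atTop (nhds 0) :=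
      (tendsto_rpow_neg_atTop (by linarith)).comp
        (tendsto_natCast_atTop_atTop.comp (Filter.tendsto_add_atTop_nat 1))
    simpa using h2.div_const ‖1 - s‖
  have hlim2 : Filter.Tendsto (fun N : ℕ => ∑ n ∈ Finset.range N, (((n : ℂ) + 1) ^ (-s) - zetaTerm n s))
      Filter.atTop (nhds (0 - g 0)) := by
    simp only [hdiff, Finset.sum_range_sub]
    exact hg0.sub_const _
  have := tendsto_nhds_unique hlim hlim2
  rw [hz.tsum_sub hsum, ← hzeta] at this
  have hg00 : g 0 = 1 / (1 - s) := by simp [hg]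
  rw [sub_eq_iff_eq_add] at this
  rw [this, hg00]
  have h1 : (1 - s) ≠ 0 := sub_ne_zero.mpr hs1.symm
  have h2 : (s - 1) ≠ 0 := sub_ne_zero.mpr hs1
  have h3 : 1 / (1 - s) = -(1 / (s - 1)) := by
    rw [show 1 - s = -(s - 1) by ring, one_div, inv_neg, one_div]
  rw [h3]; ring

lemma differentiableOn_zetaTerm (n : ℕ) : DifferentiableOn ℂ (zetaTerm n) {s | s ≠ 1} := by
  intro s hs
  have h1 : (1 : ℂ) - s ≠ 0 := sub_ne_zero.mpr (Ne.symm hs)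
  have hn1 : (n : ℂ) + 1 ≠ 0 := Nat.cast_add_one_ne_zero n
  have hn2 : (n : ℂ) + 2 ≠ 0 := by exact_mod_cast (show n + 2 ≠ 0 by omega)
  have d1 : DifferentiableAt ℂ (fun s : ℂ => ((n : ℂ) + 1) ^ (-s)) s :=
    (differentiableAt_id.neg).const_cpow (Or.inl hn1)
  have d2 : DifferentiableAt ℂ (fun s : ℂ => ((n : ℂ) + 1) ^ (1 - s)) s :=
    ((differentiableAt_const 1).sub differentiableAt_id).const_cpow (Or.inl hn1)
  have d3 : DifferentiableAt ℂ (fun s : ℂ => ((n : ℂ) + 2) ^ (1 - s)) s :=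
    ((differentiableAt_const 1).sub differentiableAt_id).const_cpow (Or.inl hn2)
  have d4 : DifferentiableAt ℂ (fun s : ℂ => 1 - s) s :=
    (differentiableAt_const 1).sub differentiableAt_id
  exact (d1.sub ((d3.sub d2).div d4 h1)).differentiableWithinAt

/-- The series representation of zeta persists on convex subregions of the half plane `0 < re s`
which avoid the pole. -/
lemma zeta_eq_tsum_zetaTerm_of_im {η : ℝ} (hη : 0 < η) (hη' : η < 1 / 2) {b : ℝ}
    (hb : b = 1 ∨ b = -1) {s : ℂ} (hre : 1 - η < s.re) (him : 0 < b * s.im) :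
    riemannZeta s = ∑' n, zetaTerm n s + 1 / (s - 1) := by
  set B := ‖s‖ + 3 with hB
  set U : Set ℂ := ({z | 1 - η < z.re} ∩ {z | 0 < b * z.im}) ∩ Metric.ball 0 B with hU
  have hUo : IsOpen U := by
    refine IsOpen.inter (IsOpen.inter ?_ ?_) Metric.isOpen_ball
    · exact isOpen_lt continuous_const Complex.continuous_re
    · exact isOpen_lt continuous_const (continuous_const.mul Complex.continuous_im)
  have hUc : Convex ℝ U := by
    refine Convex.inter (Convex.inter ?_ ?_) (convex_ball 0 B)
    · exact convex_halfSpace_re_gt _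
    · rcases hb with rfl | rfl
      · simpa using convex_halfSpace_im_gt 0
      · simpa using convex_halfSpace_im_lt 0
  have hU1 : ∀ z ∈ U, z ≠ 1 := by
    rintro z ⟨⟨_, hz⟩, _⟩ rfl
    simp at hz
  have hsU : s ∈ U := ⟨⟨hre, him⟩, by simp [hB]⟩
  have hd : DifferentiableOn ℂ (fun z => ∑' n, zetaTerm n z) U := by
    refine Complex.differentiableOn_tsum_of_summable_norm
      (u := fun n : ℕ => 2 * B ^ (2 * η) * ((n : ℝ) + 1) ^ (-(1 + η))) ?_
      (fun n => (differentiableOn_zetaTerm n).mono hU1) hUo ?_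
    · exact (summable_nat_add_one_rpow (by linarith)).mul_left _
    · rintro n z hz
      have hz1 : 1 - η < z.re := hz.1.1
      have hzB : ‖z‖ ≤ B := (mem_ball_zero_iff.mp hz.2).le
      refine (norm_zetaTerm_le n (hU1 z hz) (by linarith) (θ := 2 * η) (by linarith)
        (by linarith)).trans ?_
      have : (1 : ℝ) ≤ n + 1 := by simp
      gcongr 2 * ?_ * ?_
      · exact Real.rpow_le_rpow (norm_nonneg _) hzB (by linarith)
      · exact Real.rpow_le_rpow_of_exponent_le this (by linarith)
  have hd2 : DifferentiableOn ℂ (fun z => ∑' n, zetaTerm n z + 1 / (z - 1)) U := by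
    refine hd.add ?_
    intro z hz
    have : z - 1 ≠ 0 := sub_ne_zero.mpr (hU1 z hz)
    exact ((differentiableAt_const (1 : ℂ)).div (differentiableAt_id.sub_const 1)
      this).differentiableWithinAt
  have hd1 : DifferentiableOn ℂ riemannZeta U := fun z hz =>
    (differentiableAt_riemannZeta (hU1 z hz)).differentiableWithinAt
  have hb0 : b * b = 1 := by rcases hb with rfl | rfl <;> norm_num
  set z₀ : ℂ := 2 + (b * (min 1 (1:ℝ) / 2) : ℝ) * Complex.I with hz0
  have hz0U : z₀ ∈ U := by
    refine ⟨⟨?_, ?_⟩, ?_⟩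
    · simp [hz0]; linarith
    · simp [hz0]; nlinarith
    · simp only [Metric.mem_ball, dist_zero_right]
      have : ‖z₀‖ ≤ 2 + 1 / 2 := by
        refine (norm_add_le _ _).trans ?_
        have : |b| = 1 := by rcases hb with rfl | rfl <;> simp
        simp [this]
      linarith [norm_nonneg s]
  have hev : riemannZeta =ᶠ[nhds z₀] (fun z => ∑' n, zetaTerm n z + 1 / (z - 1)) := by
    have : {z : ℂ | 1 < z.re} ∈ nhds z₀ := by
      refine (isOpen_lt continuous_const Complex.continuous_re).mem_nhds ?_
      simp [hz0]
    filter_upwards [this] with z hz using zeta_eq_tsum_zetaTerm hz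
  exact (hd1.analyticOnNhd hUo).eqOn_of_preconnected_of_eventuallyEq (hd2.analyticOnNhd hUo)
    hUc.isPreconnected hz0U hev hsU

/-- Near the line `re s = 1`, zeta grows at most like an arbitrarily small power. -/
lemma exists_norm_zeta_le {η : ℝ} (hη : 0 < η) (hη' : η < 1 / 2) :
    ∃ C : ℝ, 0 < C ∧ ∀ s : ℂ, 1 - η < s.re → s.re ≤ 4 → 1 / 2 ≤ |s.im| →
      ‖riemannZeta s‖ ≤ C * |s.im| ^ (2 * η) := by
  set K := ∑' n : ℕ, ((n : ℝ) + 1) ^ (-(1 + η)) with hK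
  have hKs : Summable (fun n : ℕ => ((n : ℝ) + 1) ^ (-(1 + η))) :=
    summable_nat_add_one_rpow (by linarith)
  have hK0 : 0 ≤ K := tsum_nonneg fun n => by positivity
  refine ⟨2 * 9 ^ (2 * η) * K + 4, by positivity, fun s hre hre4 him => ?_⟩
  have hs1 : s ≠ 1 := by rintro rfl; norm_num at him
  have him0 : 0 < |s.im| := by linarith
  have heq : riemannZeta s = ∑' n, zetaTerm n s + 1 / (s - 1) := by
    rcases le_or_gt 0 s.im with h | h
    · exact zeta_eq_tsum_zetaTerm_of_im hη hη' (Or.inl rfl) hre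
        (by rw [abs_of_nonneg h] at him0; linarith)
    · exact zeta_eq_tsum_zetaTerm_of_im hη hη' (Or.inr rfl) hre (by linarith)
  have hns : ‖s‖ ≤ 9 * |s.im| := by
    refine (Complex.norm_le_abs_re_add_abs_im s).trans ?_
    rw [abs_of_pos (by linarith : 0 < s.re)]
    linarith
  have h1 : ‖∑' n, zetaTerm n s‖ ≤ 2 * (9 * |s.im|) ^ (2 * η) * K := by
    refine tsum_of_norm_bounded (hKs.hasSum.mul_left _) fun n => ?_
    refine (norm_zetaTerm_le n hs1 (by linarith) (θ := 2 * η) (by linarith)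
        (by linarith)).trans ?_
    have : (1 : ℝ) ≤ n + 1 := by simp
    gcongr 2 * ?_ * ?_
    · exact Real.rpow_le_rpow (norm_nonneg _) hns (by linarith)
    · exact Real.rpow_le_rpow_of_exponent_le this (by linarith)
  have h2 : ‖1 / (s - 1)‖ ≤ 2 := by
    rw [norm_div, norm_one]
    have : |s.im| ≤ ‖s - 1‖ := by simpa using Complex.abs_im_le_norm (s - 1)
    rw [div_le_iff₀ (by linarith)]
    linarith
  have h3 : (1 : ℝ) / 2 ≤ |s.im| ^ (2 * η) := by
    calc (1 : ℝ) / 2 = (1 / 2) ^ (1 : ℝ) := by simp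
      _ ≤ (1 / 2) ^ (2 * η) :=
        Real.rpow_le_rpow_of_exponent_ge (by norm_num) (by norm_num) (by linarith)
      _ ≤ _ := Real.rpow_le_rpow (by norm_num) him (by linarith)
  rw [heq]
  refine (norm_add_le _ _).trans ?_
  rw [Real.mul_rpow (by norm_num) him0.le] at h1
  nlinarith

end SmoothApprox

namespace SmoothApprox

/-! ### Bounds for the logarithmic derivative of zeta on `1 < re s` -/

/-- Growth slower than every positive power of `|im s|` in the strip `1 < re s ≤ 2`. -/
def SubPoly (f : ℂ → ℂ) : Prop :=
  ∀ η : ℝ, 0 < η → ∃ C : ℝ, 0 < C ∧ ∀ s : ℂ, 1 < s.re → s.re ≤ 2 → 1 ≤ |s.im| →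
    ‖f s‖ ≤ C * |s.im| ^ η

lemma SubPoly.mul {f g : ℂ → ℂ} (hf : SubPoly f) (hg : SubPoly g) :
    SubPoly (fun s => f s * g s) := by
  intro η hη
  obtain ⟨C, hC, h1⟩ := hf (η / 2) (by linarith)
  obtain ⟨D, hD, h2⟩ := hg (η / 2) (by linarith)
  refine ⟨C * D, by positivity, fun s a b c => ?_⟩
  have e : |s.im| ^ η = |s.im| ^ (η / 2) * |s.im| ^ (η / 2) := by
    rw [← Real.rpow_add (by linarith)]; congr 1; ring
  rw [norm_mul, e]
  calc ‖f s‖ * ‖g s‖ ≤ (C * |s.im| ^ (η / 2)) * (D * |s.im| ^ (η / 2)) :=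
        mul_le_mul (h1 s a b c) (h2 s a b c) (norm_nonneg _) (by positivity)
    _ = _ := by ring

lemma SubPoly.sub {f g : ℂ → ℂ} (hf : SubPoly f) (hg : SubPoly g) :
    SubPoly (fun s => f s - g s) := by
  intro η hη
  obtain ⟨C, hC, h1⟩ := hf η hη
  obtain ⟨D, hD, h2⟩ := hg η hη
  refine ⟨C + D, by positivity, fun s a b c => ?_⟩
  refine (norm_sub_le _ _).trans ?_
  linarith [h1 s a b c, h2 s a b c]

lemma SubPoly.neg {f : ℂ → ℂ} (hf : SubPoly f) : SubPoly (fun s => -f s) := by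
  intro η hη
  obtain ⟨C, hC, h1⟩ := hf η hη
  exact ⟨C, hC, fun s a b c => by simpa using h1 s a b c⟩

lemma SubPoly.const_mul {f : ℂ → ℂ} (hf : SubPoly f) (c : ℂ) : SubPoly (fun s => c * f s) := by
  intro η hη
  obtain ⟨C, hC, h1⟩ := hf η hη
  refine ⟨(‖c‖ + 1) * C, by positivity, fun s a b d => ?_⟩
  rw [norm_mul, mul_assoc]
  gcongr
  · linarith
  · exact h1 s a b d

lemma SubPoly.sum {ι : Type*} (S : Finset ι) {f : ι → ℂ → ℂ} (hf : ∀ i ∈ S, SubPoly (f i)) :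
    SubPoly (fun s => ∑ i ∈ S, f i s) := by
  induction S using Finset.induction_on with
  | empty => exact fun η hη => ⟨1, one_pos, fun s a b c => by simp; positivity⟩
  | insert i S hi ih =>
    simp only [Finset.sum_insert hi]
    have h1 := (hf i (by simp)).sub
      (ih fun j hj => hf j (Finset.mem_insert_of_mem hj)).neg
    simpa using h1

lemma SubPoly.congr {f g : ℂ → ℂ} (hf : SubPoly f) (h : ∀ s : ℂ, 1 < s.re → f s = g s) :
    SubPoly g := by
  intro η hη
  obtain ⟨C, hC, h1⟩ := hf η hη
  exact ⟨C, hC, fun s a b d => by rw [← h s a]; exact h1 s a b d⟩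

lemma subPoly_iteratedDeriv_zeta (k : ℕ) : SubPoly (iteratedDeriv k riemannZeta) := by
  intro η hη
  set r : ℝ := min (η / 4) (1 / 8) with hr
  have hr0 : 0 < r := by positivity
  have hr1 : r ≤ 1 / 8 := min_le_right _ _
  have hr2 : 4 * r ≤ η := by linarith [min_le_left (η / 4) (1 / 8 : ℝ)]
  obtain ⟨C, hC, hz⟩ := exists_norm_zeta_le (η := 2 * r) (by linarith) (by linarith)
  refine ⟨k.factorial * (C * 2 ^ η) / r ^ k, by positivity, fun s h1 h2 h3 => ?_⟩
  have hball : ∀ z ∈ Metric.closedBall s r, |z.im - s.im| ≤ r ∧ |z.re - s.re| ≤ r := by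
    intro z hz
    rw [mem_closedBall_iff_norm] at hz
    exact ⟨(by simpa using Complex.abs_im_le_norm (z - s) : |z.im - s.im| ≤ ‖z - s‖).trans hz,
      (by simpa using Complex.abs_re_le_norm (z - s) : |z.re - s.re| ≤ ‖z - s‖).trans hz⟩
  have himz : ∀ z ∈ Metric.closedBall s r, 1 / 2 ≤ |z.im| ∧ |z.im| ≤ 2 * |s.im| := by
    intro z hz
    have h4 := (hball z hz).1
    have h5 := abs_sub_abs_le_abs_sub z.im s.im
    have h6 := abs_sub_abs_le_abs_sub s.im z.im
    rw [abs_sub_comm] at h6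
    constructor <;> linarith
  have hd : DifferentiableOn ℂ riemannZeta (Metric.closedBall s r) := by
    intro z hz
    refine (differentiableAt_riemannZeta ?_).differentiableWithinAt
    rintro rfl
    have := (himz 1 hz).1
    norm_num at this
  have hs0 : 0 < |s.im| := by linarith
  have := Complex.norm_iteratedDeriv_le_of_forall_mem_sphere_norm_le (C := C * 2 ^ η * |s.im| ^ η)
    k hr0 (hd.diffContOnCl_ball subset_rfl) ?_
  · refine this.trans (le_of_eq ?_)
    ring
  · intro z hzs
    have hzb := Metric.sphere_subset_closedBall hzs
    have hre := abs_le.mp (hball z hzb).2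
    have him := himz z hzb
    refine (hz z (by linarith) (by linarith) him.1).trans ?_
    rw [mul_assoc, ← Real.mul_rpow (by norm_num) hs0.le]
    gcongr
    calc |z.im| ^ (2 * (2 * r)) ≤ (2 * |s.im|) ^ (2 * (2 * r)) := by
          apply Real.rpow_le_rpow (abs_nonneg _) him.2 (by linarith)
      _ ≤ (2 * |s.im|) ^ η := Real.rpow_le_rpow_of_exponent_le (by linarith) (by linarith)

lemma subPoly_zeta : SubPoly riemannZeta := by simpa using subPoly_iteratedDeriv_zeta 0

lemma subPoly_deriv_zeta : SubPoly (deriv riemannZeta) := by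
  simpa [iteratedDeriv_one] using subPoly_iteratedDeriv_zeta 1

lemma exists_norm_zeta_real_le : ∃ C : ℝ, 1 ≤ C ∧ ∀ x : ℝ, 0 < x → x ≤ 1 →
    ‖riemannZeta (1 + x)‖ ≤ C / x := by
  set K := ∑' n : ℕ, ((n : ℝ) + 1) ^ (-(2 : ℝ)) with hK
  have hK0 : 0 ≤ K := tsum_nonneg fun n => by positivity
  refine ⟨4 * K + 1, by linarith, fun x h0 h1 => ?_⟩
  have hs1 : (1 + x : ℂ) ≠ 1 := by simp [h0.ne']
  have hnorm : ‖(1 + x : ℂ)‖ = 1 + x := by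
    have := Complex.norm_of_nonneg (r := 1 + x) (by linarith)
    push_cast at this
    exact this
  rw [zeta_eq_tsum_zetaTerm (by simpa using h0)]
  have h2 : ‖∑' n, zetaTerm n (1 + x)‖ ≤ 4 * K := by
    refine tsum_of_norm_bounded (((summable_nat_add_one_rpow (by norm_num)).hasSum).mul_left _)
      fun n => ?_
    refine (norm_zetaTerm_le n hs1 (by simp; linarith) (θ := 1) zero_le_one le_rfl).trans ?_
    rw [hnorm, Real.rpow_one]
    have : (1 : ℝ) ≤ n + 1 := by simp
    have h3 : ((n : ℝ) + 1) ^ (-((1 + x : ℂ).re + 1)) ≤ ((n : ℝ) + 1) ^ (-(2 : ℝ)) :=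
      Real.rpow_le_rpow_of_exponent_le this (by simp; linarith)
    gcongr
    linarith
  have h3 : ‖1 / ((1 + x : ℂ) - 1)‖ = 1 / x := by
    simp [abs_of_pos h0]
  refine (norm_add_le _ _).trans ?_
  rw [h3, add_div]
  gcongr
  refine h2.trans ?_
  rw [le_div_iff₀ h0]
  nlinarith

lemma one_le_norm_zeta_product {x : ℝ} (hx : 0 < x) (y : ℝ) :
    1 ≤ ‖riemannZeta (1 + x)‖ ^ 3 * ‖riemannZeta (1 + x + Complex.I * y)‖ ^ 4 *
      ‖riemannZeta (1 + x + 2 * Complex.I * y)‖ := by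
  have := DirichletCharacter.norm_LFunction_product_ge_one (N := 1) (χ := 1) hx y
  simp only [DirichletCharacter.LFunction_modOne_eq, DirichletCharacter.LFunctionTrivChar] at this
  simpa using this

lemma subPoly_inv_zeta : SubPoly (fun s => (riemannZeta s)⁻¹) := by
  intro η hη
  set δ := η / 4 with hδ
  have hδ0 : 0 < δ := by positivity
  obtain ⟨A, hA, hζ⟩ := subPoly_zeta δ hδ0
  obtain ⟨B, hB, hζ'⟩ := subPoly_deriv_zeta δ hδ0
  obtain ⟨E, hE, hreal⟩ := exists_norm_zeta_real_le
  set c : ℝ := 1 / (E ^ 3 * (A * 2 ^ δ)) with hc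
  have hc0 : 0 < c := by positivity
  set κ : ℝ := min (1 / 2) (c / (16 * B ^ 4)) with hκ
  have hκ0 : 0 < κ := by positivity
  refine ⟨1 / (κ * B), by positivity, fun s h1 h2 h3 => ?_⟩
  set τ := |s.im| with hτ
  have hτ0 : 0 < τ := by linarith
  have hτδ : 1 ≤ τ ^ δ := Real.one_le_rpow h3 hδ0.le
  set x₀ := κ / (τ ^ δ) ^ 5 with hx0
  have hx00 : 0 < x₀ := by positivity
  have hx01 : x₀ ≤ 1 / 2 :=
    (div_le_self hκ0.le (one_le_pow₀ hτδ)).trans (min_le_left _ _)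
  have hlow : ∀ x : ℝ, 0 < x → x ≤ 1 →
      c * x ^ 3 ≤ ‖riemannZeta (1 + x + Complex.I * s.im)‖ ^ 4 * τ ^ δ := by
    intro x hx hx1
    have hp := one_le_norm_zeta_product hx s.im
    have ha := hreal x hx hx1
    have hb := hζ (1 + x + 2 * Complex.I * s.im) (by simpa using hx) (by simp; linarith)
      (by simp [abs_mul]; linarith)
    have e : |(1 + x + 2 * Complex.I * s.im : ℂ).im| = 2 * τ := by simp [abs_mul, hτ]
    rw [e, Real.mul_rpow (by norm_num) hτ0.le] at hb
    set Q := ‖riemannZeta (1 + x + Complex.I * s.im)‖ with hQ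
    have h5 : 1 ≤ (E / x) ^ 3 * Q ^ 4 * (A * (2 ^ δ * τ ^ δ)) := by
      refine hp.trans ?_
      gcongr
    have h6 : (E / x) ^ 3 * Q ^ 4 * (A * (2 ^ δ * τ ^ δ)) = Q ^ 4 * τ ^ δ / (c * x ^ 3) := by
      rw [hc]; field_simp
    rw [h6, le_div_iff₀ (by positivity)] at h5
    linarith
  have hlow2 : ∀ x : ℝ, x₀ ≤ x → x ≤ 1 →
      2 * (x₀ * B * τ ^ δ) ≤ ‖riemannZeta (1 + x + Complex.I * s.im)‖ := by
    intro x hx hx1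
    have h4 := hlow x (by linarith) hx1
    refine le_of_pow_le_pow_left₀ (n := 4) (by norm_num) (norm_nonneg _) ?_
    have h5 : c * x₀ ^ 3 ≤ c * x ^ 3 := by gcongr
    have h6 : (2 * (x₀ * B * τ ^ δ)) ^ 4 * τ ^ δ ≤ c * x₀ ^ 3 := by
      have h7 : (2 * (x₀ * B * τ ^ δ)) ^ 4 * τ ^ δ =
          x₀ ^ 3 * (16 * B ^ 4 * (x₀ * (τ ^ δ) ^ 5)) := by ring
      have h8 : x₀ * (τ ^ δ) ^ 5 = κ := by rw [hx0]; field_simp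
      rw [h7, h8, mul_comm c]
      gcongr
      have : κ ≤ c / (16 * B ^ 4) := min_le_right _ _
      rw [le_div_iff₀ (by positivity)] at this
      linarith
    exact le_of_mul_le_mul_right (h6.trans (h5.trans h4)) (by positivity)
  have hss : s = 1 + ((s.re - 1 : ℝ) : ℂ) + Complex.I * s.im := by
    apply Complex.ext <;> simp
  have hfin : x₀ * B * τ ^ δ ≤ ‖riemannZeta s‖ := by
    rcases le_or_gt x₀ (s.re - 1) with h | h
    · have h4 := hlow2 (s.re - 1) h (by linarith)
      rw [← hss] at h4
      have : 0 < x₀ * B * τ ^ δ := by positivity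
      linarith
    · have h4 := hlow2 x₀ le_rfl (by linarith)
      set s' : ℂ := 1 + x₀ + Complex.I * s.im with hs'
      set S : Set ℂ := {z | 1 < z.re ∧ z.re ≤ 2 ∧ z.im = s.im} with hS
      have hSc : Convex ℝ S := by
        intro z hz w hw a b ha hb hab
        refine ⟨?_, ?_, ?_⟩
        · have := convex_halfSpace_re_gt (1 : ℝ) hz.1 hw.1 ha hb hab
          exact this
        · have := convex_halfSpace_re_le (2 : ℝ) hz.2.1 hw.2.1 ha hb hab
          exact this
        · simp only [Complex.add_im, Complex.real_smul, Complex.im_ofReal_mul, hz.2.2, hw.2.2]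
          rw [← add_mul, hab, one_mul]
      have hsS : s ∈ S := ⟨h1, h2, rfl⟩
      have hs'S : s' ∈ S := ⟨by simp [hs', hx00], by simp [hs']; linarith, by simp [hs']⟩
      have hmv := hSc.norm_image_sub_le_of_norm_deriv_le (f := riemannZeta) (C := B * τ ^ δ)
        (fun z hz => differentiableAt_riemannZeta (by rintro rfl; simp [hS] at hz))
        (fun z hz => by
          have := hζ' z hz.1 hz.2.1 (by rw [hz.2.2]; exact h3)
          rwa [hz.2.2] at this) hsS hs'S
      have hdist : ‖s' - s‖ ≤ x₀ := by
        have : s' - s = ((x₀ - (s.re - 1) : ℝ) : ℂ) := by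
          apply Complex.ext <;> simp [hs']
          ring
        rw [this, Complex.norm_of_nonneg (by linarith)]
        linarith
      have h5 : ‖riemannZeta s' - riemannZeta s‖ ≤ B * τ ^ δ * x₀ :=
        hmv.trans (by gcongr)
      have h6 := norm_sub_norm_le (riemannZeta s') (riemannZeta s)
      linarith
  rw [norm_inv]
  have h7 : x₀ * B * τ ^ δ = κ * B / τ ^ η := by
    have : τ ^ η = (τ ^ δ) ^ 4 := by
      rw [← Real.rpow_natCast, ← Real.rpow_mul hτ0.le]; congr 1; simp [hδ]
    rw [this, hx0]; field_simp
  rw [h7] at hfin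
  refine (inv_anti₀ (by positivity) hfin).trans (le_of_eq ?_)
  field_simp

lemma analyticAt_zeta {s : ℂ} (hs : s ≠ 1) : AnalyticAt ℂ riemannZeta s :=
  (differentiableOn_riemannZeta).analyticAt (isOpen_compl_singleton.mem_nhds hs)

lemma ne_one_of_one_lt_re {s : ℂ} (hs : 1 < s.re) : s ≠ 1 := by
  rintro rfl; simp at hs

lemma halfPlane_mem_nhds {s : ℂ} (hs : 1 < s.re) : {z : ℂ | 1 < z.re} ∈ nhds s :=
  (isOpen_lt continuous_const Complex.continuous_re).mem_nhds hs

lemma analyticAt_logDeriv_zeta {s : ℂ} (hs : 1 < s.re) : AnalyticAt ℂ (logDeriv riemannZeta) s :=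
  (analyticAt_zeta (ne_one_of_one_lt_re hs)).deriv.div (analyticAt_zeta (ne_one_of_one_lt_re hs))
    (riemannZeta_ne_zero_of_one_le_re hs.le)

lemma subPoly_iteratedDeriv_logDeriv_zeta (k : ℕ) :
    SubPoly (iteratedDeriv k (logDeriv riemannZeta)) := by
  induction k using Nat.strong_induction_on with
  | _ k ih =>
  have h1 : SubPoly (fun s => (iteratedDeriv (k + 1) riemannZeta s -
      ∑ i ∈ Finset.range k, (k.choose i : ℂ) * (iteratedDeriv i (logDeriv riemannZeta) s *
        iteratedDeriv (k - i) riemannZeta s)) * (riemannZeta s)⁻¹) := by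
    refine SubPoly.mul (SubPoly.sub (subPoly_iteratedDeriv_zeta _) (SubPoly.sum _ ?_))
      subPoly_inv_zeta
    intro i hi
    exact ((ih i (Finset.mem_range.mp hi)).mul (subPoly_iteratedDeriv_zeta _)).const_mul _
  refine h1.congr fun s hs => ?_
  have hz := riemannZeta_ne_zero_of_one_le_re hs.le
  have hmul := iteratedDeriv_mul (n := k) (analyticAt_logDeriv_zeta hs).contDiffAt
    (analyticAt_zeta (ne_one_of_one_lt_re hs)).contDiffAt
  have heq : (logDeriv riemannZeta * riemannZeta) =ᶠ[nhds s] deriv riemannZeta := by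
    filter_upwards [halfPlane_mem_nhds hs] with z hz
    simp only [Pi.mul_apply, logDeriv_apply]
    exact div_mul_cancel₀ _ (riemannZeta_ne_zero_of_one_le_re (le_of_lt hz))
  rw [heq.iteratedDeriv_eq, ← iteratedDeriv_succ', Finset.sum_range_succ] at hmul
  rw [hmul]
  simp only [Nat.choose_self, Nat.cast_one, one_mul, Nat.sub_self, iteratedDeriv_zero, ← mul_assoc]
  rw [add_sub_cancel_left, mul_assoc, mul_inv_cancel₀ hz, mul_one]

/-- The entire function `(s - 1) ζ(s)`. -/
noncomputable def zetaPole : ℂ → ℂ := Function.update (fun s => (s - 1) * riemannZeta s) 1 1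

lemma differentiable_zetaPole : Differentiable ℂ zetaPole := by
  have hne : ∀ s : ℂ, s ≠ 1 → DifferentiableAt ℂ zetaPole s := by
    intro s hs
    have : DifferentiableAt ℂ (fun s => (s - 1) * riemannZeta s) s :=
      (differentiableAt_id.sub_const 1).mul (differentiableAt_riemannZeta hs)
    refine this.congr_of_eventuallyEq ?_
    filter_upwards [isOpen_compl_singleton.mem_nhds hs] with z hz
    exact Function.update_of_ne hz _ _
  intro s
  rcases eq_or_ne s 1 with rfl | hs
  · refine (Complex.analyticAt_of_differentiable_on_punctured_nhds_of_continuousAt ?_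
      ?_).differentiableAt
    · filter_upwards [self_mem_nhdsWithin] with t ht using hne t ht
    · exact continuousAt_update_same.mpr riemannZeta_residue_one
  · exact hne s hs

lemma zetaPole_ne_zero {s : ℂ} (hs : 1 ≤ s.re) : zetaPole s ≠ 0 := by
  rcases eq_or_ne s 1 with rfl | h
  · simp [zetaPole]
  · rw [zetaPole, Function.update_of_ne h]
    exact mul_ne_zero (sub_ne_zero.mpr h) (riemannZeta_ne_zero_of_one_le_re hs)

/-- The function `- ζ'/ζ - ζ`, written so as to be regular at `1`. -/
noncomputable def regularPart (s : ℂ) : ℂ :=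
  -(deriv zetaPole s / zetaPole s) - dslope zetaPole 1 s

lemma regularPart_eq {s : ℂ} (hs : 1 < s.re) :
    regularPart s = -logDeriv riemannZeta s - riemannZeta s := by
  have h1 := ne_one_of_one_lt_re hs
  have hs1 : s - 1 ≠ 0 := sub_ne_zero.mpr h1
  have hz := riemannZeta_ne_zero_of_one_le_re hs.le
  have hev : zetaPole =ᶠ[nhds s] fun s => (s - 1) * riemannZeta s := by
    filter_upwards [isOpen_compl_singleton.mem_nhds h1] with z hz
    exact Function.update_of_ne hz _ _
  have hd : deriv zetaPole s = riemannZeta s + (s - 1) * deriv riemannZeta s := by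
    rw [hev.deriv_eq]
    have := ((hasDerivAt_id s).sub_const 1).fun_mul (differentiableAt_riemannZeta h1).hasDerivAt
    simpa using this.deriv
  have hv : zetaPole s = (s - 1) * riemannZeta s := hev.self_of_nhds
  have hv1 : zetaPole 1 = 1 := by simp [zetaPole]
  rw [regularPart, dslope_of_ne _ h1, slope_def_field, hd, hv, hv1, logDeriv_apply]
  field_simp
  ring

lemma analyticOnNhd_regularPart : AnalyticOnNhd ℂ regularPart {s | zetaPole s ≠ 0} := by
  have hd : Differentiable ℂ (dslope zetaPole 1) := by
    have := (Complex.differentiableOn_dslope (f := zetaPole) (s := Set.univ) (c := 1)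
      Filter.univ_mem).mpr differentiable_zetaPole.differentiableOn
    exact differentiableOn_univ.mp this
  intro s hs
  exact (((differentiable_zetaPole.analyticAt s).deriv.div (differentiable_zetaPole.analyticAt s)
    hs).neg).sub (hd.analyticAt s)

/-- All derivatives of `- ζ'/ζ - ζ` grow at most like a square root in the strip `1 < re s ≤ 2`. -/
lemma exists_norm_iteratedDeriv_regularPart_le (k : ℕ) : ∃ C : ℝ, 0 < C ∧ ∀ s : ℂ, 1 < s.re →
    s.re ≤ 2 → ‖iteratedDeriv k regularPart s‖ ≤ C * (1 + |s.im|) ^ (1 / 2 : ℝ) := by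
  have hK : IsCompact (Set.Icc (1 : ℝ) 2 ×ℂ Set.Icc (-1 : ℝ) 1) :=
    isCompact_Icc.reProdIm isCompact_Icc
  have hcont : ContinuousOn (iteratedDeriv k regularPart)
      (Set.Icc (1 : ℝ) 2 ×ℂ Set.Icc (-1 : ℝ) 1) := by
    rw [iteratedDeriv_eq_iterate]
    refine (analyticOnNhd_regularPart.iterated_deriv k).continuousOn.mono ?_
    intro s hs
    exact zetaPole_ne_zero (Complex.mem_reProdIm.mp hs).1.1
  obtain ⟨M, hM⟩ := hK.exists_bound_of_continuousOn hcont
  have hsub : SubPoly (iteratedDeriv k regularPart) := by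
    refine ((subPoly_iteratedDeriv_logDeriv_zeta k).neg.sub
      (subPoly_iteratedDeriv_zeta k)).congr fun s hs => ?_
    have hev : regularPart =ᶠ[nhds s] (-logDeriv riemannZeta) - riemannZeta := by
      filter_upwards [halfPlane_mem_nhds hs] with z hz using regularPart_eq hz
    rw [hev.iteratedDeriv_eq, iteratedDeriv_sub (analyticAt_logDeriv_zeta hs).neg.contDiffAt
      (analyticAt_zeta (ne_one_of_one_lt_re hs)).contDiffAt, iteratedDeriv_neg]
  obtain ⟨C, hC, h⟩ := hsub (1 / 2) (by norm_num)
  refine ⟨C + |M|, by positivity, fun s h1 h2 => ?_⟩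
  have h3 : 1 ≤ (1 + |s.im|) ^ (1 / 2 : ℝ) :=
    Real.one_le_rpow (by linarith [abs_nonneg s.im]) (by norm_num)
  rcases le_or_gt 1 |s.im| with h4 | h4
  · refine (h s h1 h2 h4).trans ?_
    gcongr
    · linarith [abs_nonneg M]
    · linarith
  · have h5 := hM s (Complex.mem_reProdIm.mpr ⟨⟨h1.le, h2⟩, abs_le.mp h4.le⟩)
    nlinarith [le_abs_self M, abs_nonneg M]

end SmoothApprox

namespace SmoothApprox
open MeasureTheory FourierTransform

/-! ### A kernel and its Fourier transform -/

/-- The truncated kernel `v ↦ v₊ exp (-σ v)`. -/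
noncomputable def rampKernel (σ v : ℝ) : ℂ := ((max v 0 * Real.exp (-σ * v) : ℝ) : ℂ)

lemma continuous_rampKernel (σ : ℝ) : Continuous (rampKernel σ) := by
  unfold rampKernel; fun_prop

lemma integrableOn_rampKernel {σ : ℝ} (hσ : 0 < σ) :
    IntegrableOn (fun v : ℝ => v * Real.exp (-σ * v)) (Set.Ioi 0) := by
  have := integrableOn_rpow_mul_exp_neg_mul_rpow (p := 1) (s := 1) (by norm_num) one_pos hσ
  simpa using this

lemma rampKernel_of_nonpos {σ v : ℝ} (hv : v ≤ 0) : rampKernel σ v = 0 := by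
  simp [rampKernel, hv]

lemma integrable_rampKernel {σ : ℝ} (hσ : 0 < σ) : Integrable (rampKernel σ) := by
  rw [← integrableOn_univ, ← Set.Iic_union_Ioi (a := (0:ℝ)), integrableOn_union]
  constructor
  · refine (integrableOn_zero).congr_fun (fun v hv => ?_) measurableSet_Iic
    exact (rampKernel_of_nonpos hv).symm
  · have h : IntegrableOn (fun v : ℝ => ((v * Real.exp (-σ * v) : ℝ) : ℂ)) (Set.Ioi 0) :=
      (integrableOn_rampKernel hσ).ofReal
    refine h.congr_fun (fun v hv => ?_) measurableSet_Ioi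
    rw [rampKernel, max_eq_left (le_of_lt hv)]

lemma fourier_rampKernel {σ : ℝ} (hσ : 0 < σ) (ξ : ℝ) :
    𝓕 (rampKernel σ) ξ = 1 / ((σ : ℂ) + 2 * π * ξ * Complex.I) ^ 2 := by
  set z : ℂ := (σ : ℂ) + 2 * π * ξ * Complex.I with hz
  have hzre : z.re = σ := by simp [hz]
  have hz0 : z ≠ 0 := by intro h; rw [h] at hzre; simp at hzre; linarith
  rw [Real.fourier_real_eq_integral_exp_smul, ← setIntegral_univ, ← Set.Iic_union_Ioi (a := (0:ℝ))]
  have hI : Integrable (fun v : ℝ => Complex.exp (↑(-2 * π * v * ξ) * Complex.I) • rampKernel σ v) := by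
    refine (integrable_rampKernel hσ).norm.mono' ?_ (Filter.Eventually.of_forall fun v => ?_)
    · exact ((show Continuous (fun v : ℝ => Complex.exp (↑(-2 * π * v * ξ) * Complex.I)) by
        fun_prop).smul (continuous_rampKernel σ)).aestronglyMeasurable
    · rw [norm_smul, Complex.norm_exp_ofReal_mul_I, one_mul]
  rw [setIntegral_union (Set.Iic_disjoint_Ioi le_rfl) measurableSet_Ioi hI.integrableOn
    hI.integrableOn]
  have h0 : ∫ v in Set.Iic (0:ℝ), Complex.exp (↑(-2 * π * v * ξ) * Complex.I) • rampKernel σ v = 0 := by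
    rw [setIntegral_congr_fun (g := fun _ => 0) measurableSet_Iic]
    · simp
    · intro v hv
      simp [rampKernel_of_nonpos hv]
  rw [h0, zero_add]
  have heq : Set.EqOn (fun v : ℝ => Complex.exp (↑(-2 * π * v * ξ) * Complex.I) • rampKernel σ v)
      (fun v : ℝ => (v : ℂ) * Complex.exp (-z * v)) (Set.Ioi 0) := by
    intro v hv
    have hv' : max v 0 = v := max_eq_left (le_of_lt (Set.mem_Ioi.mp hv))
    simp only [rampKernel, hv', smul_eq_mul]
    rw [Complex.ofReal_mul v, Complex.ofReal_exp, mul_left_comm, ← Complex.exp_add]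
    congr 2
    simp [hz]; ring
  rw [setIntegral_congr_fun measurableSet_Ioi heq]
  have hd : ∀ v ∈ Set.Ici (0:ℝ), HasDerivAt
      (fun v : ℝ => -((v : ℂ) / z + 1 / z ^ 2) * Complex.exp (-z * v))
      ((v : ℂ) * Complex.exp (-z * v)) v := by
    intro v _
    have h1 : HasDerivAt (fun v : ℝ => (v : ℂ)) 1 v := Complex.ofRealCLM.hasDerivAt
    have h2 := (((h1.div_const z).add_const (1 / z ^ 2)).neg).mul ((h1.const_mul (-z)).cexp)
    convert! h2 using 1
    simp
    field_simp
    ring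
  have hlim : Filter.Tendsto (fun v : ℝ => -((v : ℂ) / z + 1 / z ^ 2) * Complex.exp (-z * v))
      Filter.atTop (nhds 0) := by
    have e1 : Filter.Tendsto (fun v : ℝ => v * Real.exp (-σ * v)) Filter.atTop (nhds 0) := by
      simpa using tendsto_rpow_mul_exp_neg_mul_atTop_nhds_zero 1 σ hσ
    have e0 : Filter.Tendsto (fun v : ℝ => Real.exp (-σ * v)) Filter.atTop (nhds 0) := by
      simpa using tendsto_rpow_mul_exp_neg_mul_atTop_nhds_zero 0 σ hσ
    have e2 := (e1.mul_const ‖z‖⁻¹).add (e0.mul_const ‖1 / z ^ 2‖)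
    simp only [zero_mul, add_zero] at e2
    refine squeeze_zero_norm' ?_ e2
    filter_upwards [Filter.eventually_ge_atTop 0] with v hv
    rw [norm_mul, norm_neg, Complex.norm_exp]
    have : (-z * (v : ℂ)).re = -σ * v := by simp [hzre]
    rw [this]
    have h3 : ‖(v : ℂ) / z + 1 / z ^ 2‖ ≤ v * ‖z‖⁻¹ + ‖1 / z ^ 2‖ := by
      refine (norm_add_le _ _).trans ?_
      rw [norm_div, Complex.norm_of_nonneg hv, div_eq_mul_inv]
    nlinarith [Real.exp_pos (-σ * v)]
  have hint : IntegrableOn (fun v : ℝ => (v : ℂ) * Complex.exp (-z * v)) (Set.Ioi 0) :=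
    (hI.integrableOn).congr_fun heq measurableSet_Ioi
  rw [integral_Ioi_of_hasDerivAt_of_tendsto' hd hint hlim]
  simp

lemma norm_sq_kernel (σ ξ : ℝ) :
    ‖((σ : ℂ) + 2 * π * ξ * Complex.I) ^ 2‖ = σ ^ 2 + (2 * π * ξ) ^ 2 := by
  rw [norm_pow, show (σ : ℂ) + 2 * π * ξ * Complex.I = (σ : ℂ) + ((2 * π * ξ : ℝ) : ℂ) * Complex.I by
    push_cast; ring, Complex.sq_norm, Complex.normSq_add_mul_I]

lemma kernel_bound {σ : ℝ} (hσ : 0 < σ) (hσ1 : σ ≤ 1) (ξ : ℝ) :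
    ‖1 / ((σ : ℂ) + 2 * π * ξ * Complex.I) ^ 2‖ ≤ (σ ^ 2)⁻¹ * (1 + (2 * π * ξ) ^ 2)⁻¹ := by
  rw [norm_div, norm_one, norm_sq_kernel, one_div, ← mul_inv]
  apply inv_anti₀ (by positivity)
  nlinarith [sq_nonneg (2 * π * ξ),
    mul_le_of_le_one_left (sq_nonneg (2 * π * ξ)) (pow_le_one₀ hσ.le hσ1 : σ ^ 2 ≤ 1)]

lemma integrable_inv_one_add_two_pi_sq : Integrable (fun ξ : ℝ => (1 + (2 * π * ξ) ^ 2)⁻¹) :=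
  integrable_inv_one_add_sq.comp_mul_left' (by positivity)

lemma continuous_kernel {σ : ℝ} (hσ : 0 < σ) :
    Continuous (fun ξ : ℝ => 1 / ((σ : ℂ) + 2 * π * ξ * Complex.I) ^ 2) := by
  refine continuous_const.div (by fun_prop) (fun ξ h => ?_)
  have h2 := norm_sq_kernel σ ξ
  rw [h, norm_zero] at h2
  nlinarith [sq_nonneg (2 * π * ξ), pow_pos hσ 2]

lemma integrable_kernel {σ : ℝ} (hσ : 0 < σ) (hσ1 : σ ≤ 1) :
    Integrable (fun ξ : ℝ => 1 / ((σ : ℂ) + 2 * π * ξ * Complex.I) ^ 2) :=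
  (integrable_inv_one_add_two_pi_sq.const_mul _).mono' (continuous_kernel hσ).aestronglyMeasurable
    (Filter.Eventually.of_forall fun ξ => kernel_bound hσ hσ1 ξ)

lemma rampKernel_eq_integral {σ : ℝ} (hσ : 0 < σ) (hσ1 : σ ≤ 1) (v : ℝ) :
    ∫ ξ : ℝ, Complex.exp (↑(2 * π * v * ξ) * Complex.I) *
      (1 / ((σ : ℂ) + 2 * π * ξ * Complex.I) ^ 2) = rampKernel σ v := by
  have hF : 𝓕 (rampKernel σ) = fun ξ : ℝ => 1 / ((σ : ℂ) + 2 * π * ξ * Complex.I) ^ 2 :=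
    funext (fourier_rampKernel hσ)
  have h := (continuous_rampKernel σ).fourierInv_fourier_eq (integrable_rampKernel hσ)
    (by rw [hF]; exact integrable_kernel hσ hσ1)
  have h2 := congrFun h v
  rw [Real.fourierInv_eq', hF] at h2
  rw [← h2]
  simp [mul_assoc]

end SmoothApprox

namespace SmoothApprox
open MeasureTheory ArithmeticFunction

/-! ### The prime number theorem with weights -/

/-- The coefficients `(Λ n - 1) (log n) ^ k`. -/
noncomputable def centeredLog (k n : ℕ) : ℝ := (vonMangoldt n - 1) * Real.log n ^ k

lemma iterate_logMul (f : ℕ → ℂ) (k n : ℕ) :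
    (LSeries.logMul^[k] f) n = Complex.log n ^ k * f n := by
  induction k with
  | zero => simp
  | succ k ih => rw [Function.iterate_succ', Function.comp_apply, LSeries.logMul, ih]; ring

lemma centeredLog_eq_iterate (k : ℕ) : (fun n => (centeredLog k n : ℂ)) =
    LSeries.logMul^[k] ((fun n => (vonMangoldt n : ℂ)) - 1) := by
  ext n
  rw [iterate_logMul, centeredLog, ← Complex.natCast_log]
  simp [mul_comm]

lemma abscissa_vonMangoldt_sub_one :
    LSeries.abscissaOfAbsConv ((fun n => (vonMangoldt n : ℂ)) - 1) ≤ 1 := by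
  refine LSeries.abscissaOfAbsConv_le_of_forall_lt_LSeriesSummable fun y hy => ?_
  have hy' : 1 < ((y : ℂ)).re := by simpa using hy
  exact (LSeriesSummable_vonMangoldt hy').sub (LSeriesSummable_one_iff.mpr hy')

lemma lseriesSummable_centeredLog (k : ℕ) {s : ℂ} (hs : 1 < s.re) :
    LSeriesSummable (fun n => (centeredLog k n : ℂ)) s := by
  apply LSeriesSummable_of_abscissaOfAbsConv_lt_re
  rw [centeredLog_eq_iterate, LSeries.absicssaOfAbsConv_logPowMul]
  exact abscissa_vonMangoldt_sub_one.trans_lt (by exact_mod_cast hs)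

lemma lseries_vonMangoldt_sub_one {s : ℂ} (hs : 1 < s.re) :
    LSeries ((fun n => (vonMangoldt n : ℂ)) - 1) s = regularPart s := by
  rw [LSeries_sub (LSeriesSummable_vonMangoldt hs) (LSeriesSummable_one_iff.mpr hs),
    LSeries_vonMangoldt_eq_deriv_riemannZeta_div hs, LSeries_one_eq_riemannZeta hs,
    regularPart_eq hs, logDeriv_apply, neg_div]

lemma exists_norm_lseries_centeredLog_le (k : ℕ) : ∃ C : ℝ, 0 < C ∧ ∀ s : ℂ, 1 < s.re →
    s.re ≤ 2 → ‖LSeries (fun n => (centeredLog k n : ℂ)) s‖ ≤ C * (1 + |s.im|) ^ (1 / 2 : ℝ) := by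
  obtain ⟨C, hC, h⟩ := exists_norm_iteratedDeriv_regularPart_le k
  refine ⟨C, hC, fun s h1 h2 => ?_⟩
  refine le_trans (le_of_eq ?_) (h s h1 h2)
  have hev : regularPart =ᶠ[nhds s] LSeries ((fun n => (vonMangoldt n : ℂ)) - 1) := by
    filter_upwards [halfPlane_mem_nhds h1] with z hz using (lseries_vonMangoldt_sub_one hz).symm
  rw [hev.iteratedDeriv_eq, LSeries_iteratedDeriv k
    (abscissa_vonMangoldt_sub_one.trans_lt (by exact_mod_cast h1)), centeredLog_eq_iterate]
  simp

lemma integrable_perron_majorant :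
    Integrable (fun ξ : ℝ => (1 + |2 * π * ξ|) ^ (1 / 2 : ℝ) * (1 + (2 * π * ξ) ^ 2)⁻¹) := by
  have h0 : Integrable (fun t : ℝ => (1 + |t|) ^ (1 / 2 : ℝ) * (1 + t ^ 2)⁻¹) := by
    have h1 : Integrable (fun t : ℝ => (1 + ‖t‖) ^ (-(3 / 2 : ℝ))) :=
      integrable_one_add_norm (by norm_num)
    refine (h1.const_mul 2).mono' ?_ (Filter.Eventually.of_forall fun t => ?_)
    · apply Continuous.aestronglyMeasurable
      refine Continuous.mul ?_ ?_
      · exact (by fun_prop : Continuous fun t : ℝ => 1 + |t|).rpow_const fun t => Or.inr (by norm_num)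
      · exact (by fun_prop : Continuous fun t : ℝ => 1 + t ^ 2).inv₀ fun t => by positivity
    · have h2 : 0 < 1 + |t| := by positivity
      rw [Real.norm_of_nonneg (by positivity), Real.norm_eq_abs,
        show (1 / 2 : ℝ) = -(3 / 2) + (2 : ℕ) by norm_num, Real.rpow_add h2, Real.rpow_natCast]
      have h3 : (1 + |t|) ^ 2 * (1 + t ^ 2)⁻¹ ≤ 2 := by
        rw [← div_eq_mul_inv, div_le_iff₀ (by positivity), ← sq_abs t]
        nlinarith [sq_nonneg (1 - |t|)]
      have h4 : 0 < (1 + |t|) ^ (-(3 / 2 : ℝ)) := by positivity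
      nlinarith
  exact h0.comp_mul_left' (by positivity : (2 * π : ℝ) ≠ 0)

lemma term_shift (g : ℕ → ℂ) (n : ℕ) (σ ξ l : ℝ) :
    LSeries.term g (1 + σ + ↑(2 * π * ξ) * Complex.I) n * Complex.exp (↑(2 * π * l * ξ) * Complex.I)
      = LSeries.term g (1 + σ) n * Complex.exp (↑(2 * π * (l - Real.log n) * ξ) * Complex.I) := by
  rcases eq_or_ne n 0 with rfl | hn
  · simp
  · have hn' : (n : ℂ) ≠ 0 := by exact_mod_cast hn
    rw [LSeries.term_of_ne_zero hn, LSeries.term_of_ne_zero hn, Complex.cpow_add _ _ hn',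
      Complex.cpow_def_of_ne_zero hn' (↑(2 * π * ξ) * Complex.I), ← Complex.natCast_log,
      show (↑(2 * π * (l - Real.log n) * ξ) * Complex.I : ℂ) = ↑(2 * π * l * ξ) * Complex.I -
        ↑(Real.log n) * (↑(2 * π * ξ) * Complex.I) by push_cast; ring, Complex.exp_sub]
    have : Complex.exp (↑(Real.log n) * (↑(2 * π * ξ) * Complex.I)) ≠ 0 := Complex.exp_ne_zero _
    have : (n : ℂ) ^ (1 + (σ : ℂ)) ≠ 0 := by
      rw [Complex.cpow_def_of_ne_zero hn']; exact Complex.exp_ne_zero _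
    field_simp

lemma exists_abs_smoothed_sum_le (k : ℕ) : ∃ K : ℝ, 0 < K ∧ ∀ x : ℝ, Real.exp 1 ≤ x →
    |∑ n ∈ Finset.Icc 1 ⌊x⌋₊, centeredLog k n / n * (Real.log x - Real.log n)|
      ≤ K * Real.log x ^ 2 := by
  obtain ⟨C, hC, hL⟩ := exists_norm_lseries_centeredLog_le k
  set J : ℝ := ∫ ξ : ℝ, (1 + |2 * π * ξ|) ^ (1 / 2 : ℝ) * (1 + (2 * π * ξ) ^ 2)⁻¹ with hJ
  have hJ0 : 0 ≤ J := integral_nonneg fun ξ => by positivity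
  refine ⟨Real.exp 1 * (C * (J + 1)), by positivity, fun x hx => ?_⟩
  set g : ℕ → ℂ := fun n => (centeredLog k n : ℂ) with hg
  have hx0 : 0 < x := (Real.exp_pos 1).trans_le hx
  set l := Real.log x with hl
  have hl1 : 1 ≤ l := by rw [hl, Real.le_log_iff_exp_le hx0]; exact hx
  set σ : ℝ := 1 / l with hσ
  have hσ0 : 0 < σ := by positivity
  have hσ1 : σ ≤ 1 := by rw [hσ, div_le_one (by linarith)]; exact hl1
  set K : ℝ → ℂ := fun ξ => 1 / ((σ : ℂ) + 2 * π * ξ * Complex.I) ^ 2 with hK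
  have hKint : Integrable K := integrable_kernel hσ0 hσ1
  set F : ℕ → ℝ → ℂ := fun n ξ => LSeries.term g (1 + σ) n *
    (Complex.exp (↑(2 * π * (l - Real.log n) * ξ) * Complex.I) * K ξ) with hF
  have hEint : ∀ n : ℕ, Integrable (fun ξ : ℝ =>
      Complex.exp (↑(2 * π * (l - Real.log n) * ξ) * Complex.I) * K ξ) := by
    intro n
    refine hKint.norm.mono' ?_ (Filter.Eventually.of_forall fun ξ => ?_)
    · exact ((by fun_prop : Continuous fun ξ : ℝ =>
        Complex.exp (↑(2 * π * (l - Real.log n) * ξ) * Complex.I)).mul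
        (continuous_kernel hσ0)).aestronglyMeasurable
    · rw [norm_mul, Complex.norm_exp_ofReal_mul_I, one_mul]
  have hFint : ∀ n, Integrable (F n) := fun n => (hEint n).const_mul _
  have hre : ((1 + σ : ℂ)).re = 1 + σ := by simp
  have hsum0 : Summable fun n => ‖LSeries.term g (1 + σ) n‖ :=
    (lseriesSummable_centeredLog k (s := 1 + σ) (by rw [hre]; linarith)).norm
  have hFsum : Summable fun n => ∫ ξ, ‖F n ξ‖ := by
    refine (hsum0.mul_right (∫ ξ, ‖K ξ‖)).congr fun n => ?_
    rw [← integral_const_mul]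
    congr 1; ext ξ
    simp only [hF, norm_mul, Complex.norm_exp_ofReal_mul_I, one_mul]
  have hS := hasSum_integral_of_summable_integral_norm hFint hFsum
  have htsum : ∀ ξ : ℝ, ∑' n, F n ξ = LSeries g (1 + σ + ↑(2 * π * ξ) * Complex.I) *
      (Complex.exp (↑(2 * π * l * ξ) * Complex.I) * K ξ) := by
    intro ξ
    rw [LSeries, ← tsum_mul_right]
    congr 1; ext n
    rw [← mul_assoc, term_shift, mul_assoc]
  have hFn : ∀ n, ∫ ξ, F n ξ = LSeries.term g (1 + σ) n * rampKernel σ (l - Real.log n) := by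
    intro n
    rw [integral_const_mul, rampKernel_eq_integral hσ0 hσ1]
  have hlhs : ∑' n, ∫ ξ, F n ξ = ((Real.exp (-1) *
      ∑ n ∈ Finset.Icc 1 ⌊x⌋₊, centeredLog k n / n * (l - Real.log n) : ℝ) : ℂ) := by
    rw [tsum_eq_sum (s := Finset.Icc 1 ⌊x⌋₊)]
    · rw [Finset.mul_sum, Complex.ofReal_sum]
      refine Finset.sum_congr rfl fun n hn => ?_
      obtain ⟨hn1, hn2⟩ := Finset.mem_Icc.mp hn
      have hnx : (n : ℝ) ≤ x := (Nat.le_floor_iff hx0.le).mp hn2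
      have hn0 : (0 : ℝ) < n := by exact_mod_cast hn1
      have hln : Real.log n ≤ l := Real.log_le_log hn0 hnx
      have h1 : ((n : ℂ)) ^ (1 + (σ : ℂ)) = ((n * Real.exp (Real.log n * σ) : ℝ) : ℂ) := by
        rw [show (n : ℂ) = ((n : ℝ) : ℂ) by simp, show (1 + (σ : ℂ)) = ((1 + σ : ℝ) : ℂ) by simp,
          ← Complex.ofReal_cpow hn0.le, Real.rpow_add hn0, Real.rpow_one,
          Real.rpow_def_of_pos hn0]
      rw [hFn, LSeries.term_of_ne_zero (by omega), h1, rampKernel,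
        max_eq_left (by linarith), hg]
      rw [← Complex.ofReal_div, ← Complex.ofReal_mul]
      congr 1
      have h2 : -σ * (l - Real.log n) = -1 + Real.log n * σ := by
        rw [hσ]; field_simp; ring
      rw [h2, Real.exp_add]
      have := Real.exp_pos (Real.log n * σ)
      field_simp
    · intro n hn
      rw [hFn]
      rcases Nat.eq_zero_or_pos n with rfl | hn1
      · simp
      · have h3 : x < n := by
          by_contra h
          exact hn (Finset.mem_Icc.mpr ⟨hn1, (Nat.le_floor_iff hx0.le).mpr (not_lt.mp h)⟩)
        rw [rampKernel_of_nonpos (sub_nonpos.mpr (Real.log_le_log hx0 h3.le)), mul_zero]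
  have hnorm : ‖∑' n, ∫ ξ, F n ξ‖ ≤ C * J * l ^ 2 := by
    rw [hS.tsum_eq]
    have hl2 : C * J * l ^ 2 = ∫ ξ : ℝ, (C * l ^ 2) *
        ((1 + |2 * π * ξ|) ^ (1 / 2 : ℝ) * (1 + (2 * π * ξ) ^ 2)⁻¹) := by
      rw [integral_const_mul]; ring
    rw [hl2]
    refine norm_integral_le_of_norm_le (integrable_perron_majorant.const_mul _)
      (Filter.Eventually.of_forall fun ξ => ?_)
    rw [htsum, norm_mul, norm_mul, Complex.norm_exp_ofReal_mul_I, one_mul]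
    have h1 := hL (1 + σ + ↑(2 * π * ξ) * Complex.I) (by simp; linarith) (by simp; linarith)
    have h2 : ‖K ξ‖ ≤ l ^ 2 * (1 + (2 * π * ξ) ^ 2)⁻¹ := by
      have := kernel_bound hσ0 hσ1 ξ
      rwa [show (σ ^ 2)⁻¹ = l ^ 2 by rw [hσ]; field_simp] at this
    have h3 : (1 + (σ : ℂ) + ↑(2 * π * ξ) * Complex.I).im = 2 * π * ξ := by simp
    rw [h3] at h1
    calc _ ≤ (C * (1 + |2 * π * ξ|) ^ (1 / 2 : ℝ)) * (l ^ 2 * (1 + (2 * π * ξ) ^ 2)⁻¹) := by gcongr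
      _ = _ := by ring
  rw [hlhs, Complex.norm_real, norm_mul, Real.norm_of_nonneg (Real.exp_pos _).le,
    Real.norm_eq_abs, Real.exp_neg, inv_mul_le_iff₀ (Real.exp_pos 1)] at hnorm
  refine hnorm.trans ?_
  have : C * J * l ^ 2 ≤ C * (J + 1) * l ^ 2 := by gcongr; linarith
  nlinarith [Real.exp_pos 1]

end SmoothApprox

namespace SmoothApprox
open ArithmeticFunction

/-! ### Mertens-type estimates with a logarithmic saving -/

lemma exists_bound_of_eventually (f g : ℕ → ℝ) (a N₀ : ℕ) (hg : ∀ N, a ≤ N → 0 < g N)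
    (h : ∃ C, ∀ N, N₀ ≤ N → f N ≤ C * g N) : ∃ C, 0 < C ∧ ∀ N, a ≤ N → f N ≤ C * g N := by
  obtain ⟨C, hC⟩ := h
  refine ⟨|C| + 1 + ∑ n ∈ Finset.range N₀, |f n| / |g n|, ?_, fun N hN => ?_⟩
  · have : 0 ≤ ∑ n ∈ Finset.range N₀, |f n| / |g n| := Finset.sum_nonneg fun _ _ => by positivity
    positivity
  · have hs : 0 ≤ ∑ n ∈ Finset.range N₀, |f n| / |g n| := Finset.sum_nonneg fun _ _ => by positivity
    have hgN := hg N hN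
    rcases le_or_gt N₀ N with h | h
    · refine (hC N h).trans (mul_le_mul_of_nonneg_right ?_ hgN.le)
      linarith [le_abs_self C]
    · have h1 : |f N| / |g N| ≤ ∑ n ∈ Finset.range N₀, |f n| / |g n| :=
        Finset.single_le_sum (f := fun n => |f n| / |g n|) (fun _ _ => by positivity)
          (Finset.mem_range.mpr h)
      rw [abs_of_pos hgN] at h1
      calc f N ≤ |f N| / g N * g N := by rw [div_mul_cancel₀ _ hgN.ne']; exact le_abs_self _
        _ ≤ _ := mul_le_mul_of_nonneg_right (by linarith [abs_nonneg C]) hgN.le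

lemma neg_pow_log_le_centeredLog (k n : ℕ) : -(Real.log n ^ k) ≤ centeredLog k n := by
  have h1 : 0 ≤ Real.log n := Real.log_natCast_nonneg n
  have h2 : 0 ≤ vonMangoldt n := vonMangoldt_nonneg
  have := mul_nonneg h2 (pow_nonneg h1 k)
  rw [centeredLog]; linarith

lemma card_Ioc_floor_le {x z : ℝ} (hx : 0 ≤ z) (hxz : z ≤ x) :
    ((Finset.Ioc ⌊z⌋₊ ⌊x⌋₊).card : ℝ) ≤ x - z + 1 := by
  rw [Nat.card_Ioc, Nat.cast_sub (Nat.floor_le_floor hxz)]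
  linarith [Nat.floor_le (hx.trans hxz), Nat.lt_floor_add_one z]

lemma sum_Icc_floor_split (f : ℕ → ℝ) {x z : ℝ} (hxz : z ≤ x) :
    ∑ n ∈ Finset.Icc 1 ⌊x⌋₊, f n = ∑ n ∈ Finset.Icc 1 ⌊z⌋₊, f n +
      ∑ n ∈ Finset.Ioc ⌊z⌋₊ ⌊x⌋₊, f n := by
  have h := Nat.floor_le_floor hxz
  have h1 : ∀ m : ℕ, Finset.Icc 1 m = Finset.Ioc 0 m := fun m => by ext; simp; omega
  rw [h1, h1, Finset.sum_Ioc_consecutive _ (Nat.zero_le _) h]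

/-- One-sided estimate for short weighted sums of `centeredLog`. -/
lemma neg_le_sum_weighted (k : ℕ) {z x δ W : ℝ} (hz : 1 ≤ z) (hδ : 0 < δ) (hδ1 : δ ≤ 1)
    (hx : x = z * Real.exp δ) (w : ℕ → ℝ)
    (hw0 : ∀ n : ℕ, z < n → n ≤ x → 0 ≤ w n) (hw1 : ∀ n : ℕ, z < n → n ≤ x → w n ≤ δ)
    (hW : Real.log x ≤ W) :
    -(δ * W ^ k * (2 * δ + 1 / z)) ≤ ∑ n ∈ Finset.Ioc ⌊z⌋₊ ⌊x⌋₊, centeredLog k n / n * w n := by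
  have hz0 : 0 < z := by linarith
  have hexp : Real.exp δ ≤ 1 + 2 * δ := by
    have := Real.abs_exp_sub_one_le (x := δ) (by rwa [abs_of_pos hδ])
    rw [abs_of_pos hδ] at this
    linarith [le_abs_self (Real.exp δ - 1)]
  have hzx : z ≤ x := by rw [hx]; nlinarith [Real.add_one_le_exp δ]
  have hx1 : 1 ≤ x := hz.trans hzx
  have hW0 : 0 ≤ W := (Real.log_nonneg hx1).trans hW
  have hterm : ∀ n ∈ Finset.Ioc ⌊z⌋₊ ⌊x⌋₊, -(W ^ k / z * δ) ≤ centeredLog k n / n * w n := by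
    intro n hn
    obtain ⟨h1, h2⟩ := Finset.mem_Ioc.mp hn
    have h1' : z < n := (Nat.floor_lt hz0.le).mp h1
    have h2' : (n : ℝ) ≤ x := (Nat.le_floor_iff (by linarith)).mp h2
    have hn0 : (0 : ℝ) < n := hz0.trans h1'
    have hlog : Real.log n ^ k ≤ W ^ k :=
      pow_le_pow_left₀ (Real.log_nonneg (by linarith)) ((Real.log_le_log hn0 h2').trans hW) k
    have h3 := neg_pow_log_le_centeredLog k n
    have h4 : -(W ^ k / z) ≤ centeredLog k n / n := by
      have e1 : W ^ k / n ≤ W ^ k / z := by gcongr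
      have e2 : -(W ^ k) / n ≤ centeredLog k n / n := by gcongr; linarith
      rw [neg_div] at e2; linarith
    have h5 : 0 ≤ W ^ k / z := by positivity
    have h6 := mul_le_mul_of_nonneg_right h4 (hw0 n h1' h2')
    have h7 := mul_le_mul_of_nonneg_left (hw1 n h1' h2') h5
    linarith
  have hsum := Finset.card_nsmul_le_sum _ _ _ hterm
  refine le_trans ?_ hsum
  rw [nsmul_eq_mul]
  have hcard := card_Ioc_floor_le hz0.le hzx
  have hcard2 : ((Finset.Ioc ⌊z⌋₊ ⌊x⌋₊).card : ℝ) ≤ z * (2 * δ + 1 / z) := by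
    have : z * (1 / z) = 1 := by field_simp
    nlinarith
  have h8 : 0 ≤ W ^ k / z * δ := by positivity
  have h9 := mul_le_mul_of_nonneg_right hcard2 h8
  have h10 : z * (2 * δ + 1 / z) * (W ^ k / z * δ) = δ * W ^ k * (2 * δ + 1 / z) := by field_simp
  linarith

lemma exists_abs_sum_centeredLog_le_aux (k : ℕ) : ∃ K : ℝ, 0 < K ∧ ∀ x δ : ℝ, Real.exp 2 ≤ x →
    0 < δ → δ ≤ 1 → |∑ n ∈ Finset.Icc 1 ⌊x⌋₊, centeredLog k n / n| ≤
      K * Real.log x ^ 2 / δ + (2 * Real.log x) ^ k * (2 * δ + 3 / x) := by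
  obtain ⟨K, hK, hT⟩ := exists_abs_smoothed_sum_le k
  refine ⟨5 * K, by positivity, fun x δ hx hδ hδ1 => ?_⟩
  have hx0 : 0 < x := (Real.exp_pos 2).trans_le hx
  have hl2 : 2 ≤ Real.log x := by rwa [Real.le_log_iff_exp_le hx0]
  have hxe : Real.exp 1 ≤ x := (Real.exp_le_exp.mpr (by norm_num)).trans hx
  have hx1 : 1 ≤ x := (Real.one_le_exp (by norm_num)).trans hx
  have hTx := abs_le.mp (hT x hxe)
  set l := Real.log x with hl
  rw [abs_le]
  constructor
  · set z := x * Real.exp (-δ) with hz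
    have hxz : x = z * Real.exp δ := by
      rw [hz, mul_assoc, ← Real.exp_add]; simp
    have hlz : Real.log z = l - δ := by
      rw [hz, Real.log_mul hx0.ne' (Real.exp_pos _).ne', Real.log_exp]; ring
    have hz0 : 0 < z := by positivity
    have hze : Real.exp 1 ≤ z := by
      rw [← Real.le_log_iff_exp_le hz0, hlz]; linarith
    have hzx : z ≤ x := by
      rw [hz]; exact mul_le_of_le_one_right hx0.le (by rw [Real.exp_le_one_iff]; linarith)
    have hTz := abs_le.mp (hT z hze)
    have hz1 : 1 ≤ z := (Real.one_le_exp (by norm_num)).trans hze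
    have hw := neg_le_sum_weighted k hz1 hδ hδ1 hxz (fun n => δ - l + Real.log n)
      (fun n h1 h2 => by
        have := Real.log_le_log hz0 h1.le
        linarith)
      (fun n h1 h2 => by
        have := Real.log_le_log (hz0.trans h1) h2
        linarith) (W := l) le_rfl
    have hid : δ * ∑ n ∈ Finset.Icc 1 ⌊x⌋₊, centeredLog k n / n =
        (∑ n ∈ Finset.Icc 1 ⌊x⌋₊, centeredLog k n / n * (l - Real.log n)) -
        (∑ n ∈ Finset.Icc 1 ⌊z⌋₊, centeredLog k n / n * (Real.log z - Real.log n)) +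
        ∑ n ∈ Finset.Ioc ⌊z⌋₊ ⌊x⌋₊, centeredLog k n / n * (δ - l + Real.log n) := by
      rw [sum_Icc_floor_split _ hzx, sum_Icc_floor_split (fun n => centeredLog k n / n * _) hzx,
        mul_add, Finset.mul_sum, Finset.mul_sum, add_sub_right_comm, ← Finset.sum_sub_distrib,
        add_assoc, ← Finset.sum_add_distrib, hlz]
      congr 1 <;> exact Finset.sum_congr rfl fun n _ => by ring
    have hlz2 : Real.log z ^ 2 ≤ l ^ 2 := by
      rw [hlz]; exact pow_le_pow_left₀ (by linarith) (by linarith) 2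
    have h1z : 1 / z ≤ 3 / x := by
      rw [div_le_div_iff₀ hz0 hx0, one_mul, hxz]
      have : Real.exp δ ≤ 3 := (Real.exp_le_exp.mpr hδ1).trans (by linarith [Real.exp_one_lt_d9])
      nlinarith
    have hpow : l ^ k ≤ (2 * l) ^ k := pow_le_pow_left₀ (by linarith) (by linarith) k
    have hlow : -(2 * K * l ^ 2 + δ * (2 * l) ^ k * (2 * δ + 3 / x)) ≤
        δ * ∑ n ∈ Finset.Icc 1 ⌊x⌋₊, centeredLog k n / n := by
      rw [hid]
      have : δ * l ^ k * (2 * δ + 1 / z) ≤ δ * (2 * l) ^ k * (2 * δ + 3 / x) := by gcongr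
      nlinarith [hTz.1, hTz.2, hTx.1]
    have h2 : δ * (5 * K * l ^ 2 / δ + (2 * l) ^ k * (2 * δ + 3 / x)) =
        5 * K * l ^ 2 + δ * (2 * l) ^ k * (2 * δ + 3 / x) := by field_simp
    have hKl : 0 ≤ K * l ^ 2 := by positivity
    refine le_of_mul_le_mul_left ?_ hδ
    rw [mul_neg, h2]
    linarith
  · set X := x * Real.exp δ with hX
    have hX0 : 0 < X := by positivity
    have hlX : Real.log X = l + δ := by
      rw [hX, Real.log_mul hx0.ne' (Real.exp_pos _).ne', Real.log_exp]
    have hxX : x ≤ X := le_mul_of_one_le_right hx0.le (Real.one_le_exp hδ.le)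
    have hTX := abs_le.mp (hT X (hxe.trans hxX))
    have hw := neg_le_sum_weighted k hx1 hδ hδ1 hX (fun n => l + δ - Real.log n)
      (fun n h1 h2 => by
        have := Real.log_le_log (hx0.trans h1) h2
        linarith)
      (fun n h1 h2 => by
        have := Real.log_le_log hx0 h1.le
        linarith) (W := 2 * l) (by linarith)
    have hid : δ * ∑ n ∈ Finset.Icc 1 ⌊x⌋₊, centeredLog k n / n =
        (∑ n ∈ Finset.Icc 1 ⌊X⌋₊, centeredLog k n / n * (Real.log X - Real.log n)) -
        (∑ n ∈ Finset.Icc 1 ⌊x⌋₊, centeredLog k n / n * (l - Real.log n)) -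
        ∑ n ∈ Finset.Ioc ⌊x⌋₊ ⌊X⌋₊, centeredLog k n / n * (l + δ - Real.log n) := by
      rw [sum_Icc_floor_split (fun n => centeredLog k n / n * _) hxX, Finset.mul_sum, hlX,
        add_sub_right_comm, ← Finset.sum_sub_distrib, add_sub_cancel_right]
      exact Finset.sum_congr rfl fun n _ => by ring
    have hlX2 : Real.log X ^ 2 ≤ 4 * l ^ 2 := by
      rw [hlX]; nlinarith
    have h1z : 1 / x ≤ 3 / x := by gcongr; norm_num
    have hup : δ * ∑ n ∈ Finset.Icc 1 ⌊x⌋₊, centeredLog k n / n ≤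
        5 * K * l ^ 2 + δ * (2 * l) ^ k * (2 * δ + 3 / x) := by
      rw [hid]
      have : δ * (2 * l) ^ k * (2 * δ + 1 / x) ≤ δ * (2 * l) ^ k * (2 * δ + 3 / x) := by gcongr
      nlinarith [hTX.1, hTX.2, hTx.1]
    have h2 : δ * (5 * K * l ^ 2 / δ + (2 * l) ^ k * (2 * δ + 3 / x)) =
        5 * K * l ^ 2 + δ * (2 * l) ^ k * (2 * δ + 3 / x) := by field_simp
    refine le_of_mul_le_mul_left ?_ hδ
    rw [h2]
    linarith

lemma log_natCast_pos {N : ℕ} (hN : 2 ≤ N) : 0 < Real.log N :=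
  Real.log_pos (by exact_mod_cast hN)

lemma exists_abs_sum_centeredLog_le (j : ℕ) : ∃ C : ℝ, 0 < C ∧ ∀ N : ℕ, 2 ≤ N →
    |∑ n ∈ Finset.Icc 1 N, centeredLog (2 * j + 2) n / n| ≤ C * Real.log N ^ (j + 2) := by
  obtain ⟨K, hK, h⟩ := exists_abs_sum_centeredLog_le_aux (2 * j + 2)
  refine exists_bound_of_eventually _ _ 2 ⌈Real.exp 2⌉₊
    (fun N hN => pow_pos (log_natCast_pos hN) _)
    ⟨K + 2 ^ (2 * j + 2) * (2 + 3 * (2 * j + 2).factorial), fun N hN => ?_⟩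
  have hN' : Real.exp 2 ≤ N := (Nat.ceil_le).mp hN
  have hN0 : (0 : ℝ) < N := (Real.exp_pos 2).trans_le hN'
  set l := Real.log N with hl
  have hl2 : 2 ≤ l := by rwa [hl, Real.le_log_iff_exp_le hN0]
  have hδ1 : (l ^ j)⁻¹ ≤ 1 := inv_le_one_of_one_le₀ (one_le_pow₀ (by linarith))
  have h1 := h N (l ^ j)⁻¹ hN' (by positivity) hδ1
  rw [Nat.floor_natCast] at h1
  refine h1.trans ?_
  have h2 : l ^ (2 * j + 2) / N ≤ (2 * j + 2).factorial := by
    have := Real.pow_div_factorial_le_exp (x := l) (by linarith) (2 * j + 2)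
    rw [hl, Real.exp_log hN0, ← hl, div_le_iff₀ (by positivity)] at this
    rw [div_le_iff₀ hN0]; linarith
  have h3 : (1 : ℝ) ≤ l ^ (j + 2) := one_le_pow₀ (by linarith)
  have h4 : K * l ^ 2 / (l ^ j)⁻¹ = K * l ^ (j + 2) := by
    rw [div_inv_eq_mul, pow_add]; ring
  have h5 : (2 * l) ^ (2 * j + 2) * (2 * (l ^ j)⁻¹ + 3 / N) =
      2 ^ (2 * j + 2) * (2 * l ^ (j + 2) + 3 * (l ^ (2 * j + 2) / N)) := by
    have : l ^ (2 * j + 2) = l ^ (j + 2) * l ^ j := by ring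
    rw [mul_pow, mul_assoc]
    congr 1
    rw [mul_add, this]
    have : l ^ j ≠ 0 := by positivity
    field_simp
  rw [← hl, h4, h5]
  have h6 : (0:ℝ) ≤ (2 * j + 2).factorial := by positivity
  have h7 : 3 * (l ^ (2 * j + 2) / N) ≤ 3 * (2 * j + 2).factorial * l ^ (j + 2) := by nlinarith
  have h8 : (0:ℝ) ≤ 2 ^ (2 * j + 2) := by positivity
  nlinarith [mul_le_mul_of_nonneg_left h7 h8]

lemma pow_sub_pow_ratio {p q : ℝ} (hq : 0 < q) (hqp : q ≤ p) {j : ℕ} (hj : 1 ≤ j) :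
    p ^ (2 * j + 2) - q ^ (2 * j + 2) ≤ 4 * p ^ (j + 2) * (p ^ j - q ^ j) := by
  have hp : 0 < p := hq.trans_le hqp
  set w := q / p with hw
  have hw0 : 0 < w := by positivity
  have hw1 : w ≤ 1 := (div_le_one hp).mpr hqp
  have hqw : q = w * p := by rw [hw]; field_simp
  have h1 : w ^ (4 * j) ≤ w ^ (2 * j + 2) := pow_le_pow_of_le_one hw0.le hw1 (by omega)
  have h2 : 1 - w ^ (4 * j) ≤ 4 * (1 - w ^ j) := by
    rw [mul_comm 4 j, pow_mul]
    have hz0 : 0 ≤ w ^ j := by positivity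
    have := one_add_mul_le_pow (a := w ^ j - 1) (by linarith) 4
    norm_num at this
    linarith
  have h3 : 0 < p ^ (2 * j + 2) := by positivity
  have h4 : p ^ (2 * j + 2) = p ^ (j + 2) * p ^ j := by ring
  rw [hqw, mul_pow, mul_pow]
  have h5 : p ^ (2 * j + 2) * (1 - w ^ (2 * j + 2)) ≤ p ^ (2 * j + 2) * (4 * (1 - w ^ j)) :=
    mul_le_mul_of_nonneg_left (by linarith) h3.le
  calc _ = p ^ (2 * j + 2) * (1 - w ^ (2 * j + 2)) := by ring
    _ ≤ _ := h5
    _ = _ := by rw [h4]; ring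

/-- Mertens-type form of the prime number theorem with a logarithmic saving. -/
theorem exists_mertens_sum_vonMangoldt (j : ℕ) (hj : 1 ≤ j) : ∃ c C : ℝ, 0 < C ∧ ∀ N : ℕ, 2 ≤ N →
    |∑ n ∈ Finset.Icc 1 N, (vonMangoldt n - 1) / n - c| ≤ C / Real.log N ^ j := by
  obtain ⟨C, hC, hB⟩ := exists_abs_sum_centeredLog_le j
  set k := 2 * j + 2 with hk
  set S : ℕ → ℝ := fun N => ∑ n ∈ Finset.Icc 1 N, (vonMangoldt n - 1) / n with hS
  set B : ℕ → ℝ := fun N => ∑ n ∈ Finset.Icc 1 N, centeredLog k n / n with hBdef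
  set p : ℕ → ℝ := fun N => (Real.log N)⁻¹ with hp
  set G : ℕ → ℝ := fun N => S N - B N * p N ^ k with hG
  set E : ℕ → ℝ := fun N => 4 * C * p N ^ j with hE
  have hpos : ∀ N, 2 ≤ N → 0 < p N := fun N hN => inv_pos.mpr (log_natCast_pos hN)
  have hanti : ∀ N, 2 ≤ N → p (N + 1) ≤ p N := fun N hN =>
    inv_anti₀ (log_natCast_pos hN) (Real.log_le_log (by positivity) (by push_cast; linarith))
  have hstep : ∀ N, 2 ≤ N → |G (N + 1) - G N| ≤ E N - E (N + 1) := by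
    intro N hN
    have hl := log_natCast_pos (show 2 ≤ N + 1 by omega)
    have h1 : G (N + 1) - G N = B N * (p N ^ k - p (N + 1) ^ k) := by
      simp only [hG, hS, hBdef]
      rw [Finset.sum_Icc_succ_top (by omega), Finset.sum_Icc_succ_top (by omega), centeredLog]
      have h0 : Real.log ↑(N + 1) ^ k * p (N + 1) ^ k = 1 := by
        rw [← mul_pow, mul_inv_cancel₀ hl.ne', one_pow]
      linear_combination (-(vonMangoldt (N + 1) - 1) / ((N + 1 : ℕ) : ℝ)) * h0
    have h2 : 0 ≤ p N ^ k - p (N + 1) ^ k :=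
      sub_nonneg.mpr (pow_le_pow_left₀ (hpos _ (by omega)).le (hanti N hN) k)
    rw [h1, abs_mul, abs_of_nonneg h2]
    have h3 := pow_sub_pow_ratio (hpos (N + 1) (by omega)) (hanti N hN) hj
    have h4 : Real.log N ^ (j + 2) * p N ^ (j + 2) = 1 := by
      rw [← mul_pow, hp]; simp [(log_natCast_pos hN).ne']
    calc |B N| * (p N ^ k - p (N + 1) ^ k)
        ≤ (C * Real.log N ^ (j + 2)) * (4 * p N ^ (j + 2) * (p N ^ j - p (N + 1) ^ j)) := by
          have := hB N hN
          have := log_natCast_pos hN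
          gcongr
      _ = 4 * C * (Real.log N ^ (j + 2) * p N ^ (j + 2)) * (p N ^ j - p (N + 1) ^ j) := by ring
      _ = _ := by rw [h4]; simp only [hE]; ring
  have hE0 : ∀ N, 2 ≤ N → 0 ≤ E N := fun N hN => by have := hpos N hN; positivity
  have hmono : ∀ N, 2 ≤ N → ∀ M, N ≤ M → G N - E N ≤ G M - E M ∧ G M + E M ≤ G N + E N := by
    intro N hN M hM
    induction M, hM using Nat.le_induction with
    | base => exact ⟨le_rfl, le_rfl⟩
    | succ M hM ih =>
      have := abs_le.mp (hstep M (hN.trans hM))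
      constructor <;> linarith [ih.1, ih.2]
  have hcross : ∀ N, 2 ≤ N → ∀ M, 2 ≤ M → G M - E M ≤ G N + E N := by
    intro N hN M hM
    rcases le_total N M with h | h
    · linarith [(hmono N hN M h).2, hE0 M hM]
    · linarith [(hmono M hM N h).1, hE0 N hN]
  set c := ⨆ M : ℕ, (G (M + 2) - E (M + 2)) with hc
  have hbdd : BddAbove (Set.range fun M : ℕ => G (M + 2) - E (M + 2)) :=
    ⟨G 2 + E 2, by rintro _ ⟨M, rfl⟩; exact hcross 2 le_rfl _ (by omega)⟩
  refine ⟨c, 5 * C, by positivity, fun N hN => ?_⟩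
  have hc1 : G N - E N ≤ c := by
    have := le_ciSup hbdd (N - 2)
    simpa [Nat.sub_add_cancel hN] using this
  have hc2 : c ≤ G N + E N := ciSup_le fun M => hcross N hN _ (by omega)
  have hBN : |B N * p N ^ k| ≤ C * p N ^ j := by
    rw [abs_mul, abs_of_pos (pow_pos (hpos N hN) k)]
    have h4 : Real.log N ^ (j + 2) * p N ^ (j + 2) = 1 := by
      rw [← mul_pow, hp]; simp [(log_natCast_pos hN).ne']
    calc |B N| * p N ^ k ≤ (C * Real.log N ^ (j + 2)) * p N ^ k := by
          have := hpos N hN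
          gcongr
          exact hB N hN
      _ = C * p N ^ j * (Real.log N ^ (j + 2) * p N ^ (j + 2)) := by rw [hk]; ring
      _ = _ := by rw [h4, mul_one]
  have h5 : 5 * C / Real.log N ^ j = E N + C * p N ^ j := by
    simp only [hE, hp, inv_pow]; ring
  rw [h5]
  have h6 := abs_le.mp hBN
  change |S N - c| ≤ _
  rw [abs_le]
  simp only [hG] at hc1 hc2
  constructor <;> linarith

end SmoothApprox

namespace SmoothApprox
open MeasureTheory intervalIntegral

/-! ### The Dickman function -/

/-- The Dickman function, extended by `1` to the negative reals. -/
structure IsDickman (ρ : ℝ → ℝ) : Prop where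
  cont : Continuous ρ
  eq_one : ∀ u ≤ 1, ρ u = 1
  delay : ∀ u, 1 < u → HasDerivAt ρ (-ρ (u - 1) / u) u

/-- The quantity `ρ (u - 1) / (u ρ u)`, which is `-ρ'/ρ` for `u > 1`. -/
noncomputable def dickmanRate (ρ : ℝ → ℝ) (u : ℝ) : ℝ := ρ (u - 1) / (u * ρ u)

namespace IsDickman
variable {ρ : ℝ → ℝ}

lemma hasDerivAt_mul (h : IsDickman ρ) {u : ℝ} (hu : 1 < u) :
    HasDerivAt (fun v => v * ρ v) (ρ u - ρ (u - 1)) u := by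
  convert! (hasDerivAt_id u).mul (h.delay u hu) using 1
  simp
  field_simp
  ring

lemma hasDerivAt_integral (h : IsDickman ρ) (u : ℝ) :
    HasDerivAt (fun v => ∫ t in (v - 1)..v, ρ t) (ρ u - ρ (u - 1)) u := by
  have h1 : ∀ a, HasDerivAt (fun v => ∫ t in (0:ℝ)..v, ρ t) (ρ a) a := fun a =>
    integral_hasDerivAt_right (h.cont.intervalIntegrable _ _)
      h.cont.aestronglyMeasurable.stronglyMeasurableAtFilter h.cont.continuousAt
  have h2 := (h1 u).sub ((h1 (u - 1)).comp u ((hasDerivAt_id u).sub_const 1))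
  simp only [mul_one] at h2
  refine h2.congr_of_eventuallyEq (Filter.Eventually.of_forall fun v => ?_)
  simp only [Pi.sub_apply, Function.comp, id]
  rw [integral_interval_sub_left (h.cont.intervalIntegrable _ _) (h.cont.intervalIntegrable _ _)]

lemma mul_eq_integral (h : IsDickman ρ) {u : ℝ} (hu : 1 ≤ u) :
    u * ρ u = ∫ t in (u - 1)..u, ρ t := by
  set f : ℝ → ℝ := fun v => v * ρ v - ∫ t in (v - 1)..v, ρ t with hf
  have hcI : Continuous fun v => ∫ t in (v - 1)..v, ρ t :=
    continuous_iff_continuousAt.mpr fun v => (h.hasDerivAt_integral v).continuousAt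
  have hfc : Continuous f := (continuous_id.mul h.cont).sub hcI
  have h1 : f 1 = 0 := by
    have : ∫ t in (0:ℝ)..1, ρ t = ∫ t in (0:ℝ)..1, (1:ℝ) := by
      apply integral_congr
      intro t ht
      rw [Set.uIcc_of_le zero_le_one] at ht
      exact h.eq_one t ht.2
    simp [hf, h.eq_one 1 le_rfl, this]
  have h2 : f u = f 1 := by
    refine constant_of_has_deriv_right_zero (a := 1) (b := u) hfc.continuousOn ?_ u ⟨hu, le_rfl⟩
    intro v hv
    rcases eq_or_lt_of_le hv.1 with rfl | hv1
    · have hd : HasDerivWithinAt f (0) (Set.Ici 1) 1 := by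
        apply hasDerivWithinAt_Ici_of_tendsto_deriv (s := Set.Ioi 1)
        · intro v hv
          exact ((h.hasDerivAt_mul hv).sub (h.hasDerivAt_integral v)).differentiableAt.differentiableWithinAt
        · exact hfc.continuousWithinAt
        · exact self_mem_nhdsWithin
        · refine (tendsto_const_nhds (x := (0:ℝ))).congr' ?_
          filter_upwards [self_mem_nhdsWithin] with v hv
          have h0 : HasDerivAt f ((ρ v - ρ (v - 1)) - (ρ v - ρ (v - 1))) v :=
            (h.hasDerivAt_mul hv).sub (h.hasDerivAt_integral v)
          rw [h0.deriv, sub_self]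
      exact hd
    · have := (h.hasDerivAt_mul hv1).sub (h.hasDerivAt_integral v)
      rw [sub_self] at this
      exact this.hasDerivWithinAt
  have : f u = 0 := h2.trans h1
  simp only [hf] at this
  linarith

lemma pos (h : IsDickman ρ) (u : ℝ) : 0 < ρ u := by
  by_contra hu
  set S : Set ℝ := {v | ρ v ≤ 0} with hS
  have hSc : IsClosed S := isClosed_le h.cont continuous_const
  have hlow : ∀ v ∈ S, 1 < v := by
    intro v hv
    by_contra h1
    have := h.eq_one v (not_lt.mp h1)
    simp only [hS, Set.mem_ofPred_eq] at hv
    linarith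
  have hbdd : BddBelow S := ⟨1, fun v hv => (hlow v hv).le⟩
  have hmem := hSc.csInf_mem ⟨u, not_lt.mp hu⟩ hbdd
  set a := sInf S with ha
  have ha1 := hlow a hmem
  have hI : 0 < ∫ t in (a - 1)..a, ρ t := by
    refine intervalIntegral_pos_of_pos_on (h.cont.intervalIntegrable _ _) (fun t ht => ?_) (by linarith)
    by_contra h2
    exact absurd (csInf_le hbdd (not_lt.mp h2 : t ∈ S)) (not_le.mpr ht.2)
  rw [← h.mul_eq_integral ha1.le] at hI
  have : ρ a ≤ 0 := hmem
  nlinarith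

lemma antitone (h : IsDickman ρ) : Antitone ρ := by
  have h1 : AntitoneOn ρ (Set.Ici 1) := by
    refine antitoneOn_of_deriv_nonpos (convex_Ici 1) h.cont.continuousOn ?_ ?_
    · rw [interior_Ici]
      exact fun v hv => (h.delay v hv).differentiableAt.differentiableWithinAt
    · rw [interior_Ici]
      intro v hv
      have hv' : 1 < v := hv
      rw [(h.delay v hv).deriv]
      have := h.pos (v - 1)
      rw [neg_div]
      have : 0 ≤ ρ (v - 1) / v := by positivity
      linarith
  have h2 : AntitoneOn ρ (Set.Iic 1) := fun a ha b hb _ => by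
    rw [h.eq_one a ha, h.eq_one b hb]
  exact h2.Iic_union_Ici h1

lemma le_one (h : IsDickman ρ) (u : ℝ) : ρ u ≤ 1 := by
  rcases le_total u 1 with hu | hu
  · exact (h.eq_one u hu).le
  · exact (h.antitone hu).trans (h.eq_one 1 le_rfl).le

lemma rate_pos (h : IsDickman ρ) {u : ℝ} (hu : 0 < u) : 0 < dickmanRate ρ u :=
  div_pos (h.pos _) (mul_pos hu (h.pos _))

lemma hasDerivAt_rate (h : IsDickman ρ) {u : ℝ} (hu : 1 < u) :
    HasDerivAt ρ (-(dickmanRate ρ u * ρ u)) u := by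
  convert h.delay u hu using 1
  have := (h.pos u).ne'
  rw [dickmanRate]
  field_simp

lemma continuousOn_rate (h : IsDickman ρ) : ContinuousOn (dickmanRate ρ) (Set.Ioi 0) := by
  refine ContinuousOn.div (h.cont.comp (by fun_prop)).continuousOn
    (continuous_id.mul h.cont).continuousOn fun v hv => ?_
  exact (mul_pos hv (h.pos v)).ne'

lemma rate_strictMonoOn_one_two (h : IsDickman ρ) : StrictMonoOn (dickmanRate ρ) (Set.Icc 1 2) := by
  have h1 : StrictAntiOn (fun v => v * ρ v) (Set.Icc 1 2) := by
    refine strictAntiOn_of_deriv_neg (convex_Icc 1 2) (continuous_id.mul h.cont).continuousOn ?_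
    rw [interior_Icc]
    intro v hv
    rw [(h.hasDerivAt_mul hv.1).deriv, h.eq_one (v - 1) (by linarith [hv.2])]
    have h2 : StrictAntiOn ρ (Set.Icc 1 v) := by
      refine strictAntiOn_of_deriv_neg (convex_Icc 1 v) h.cont.continuousOn ?_
      rw [interior_Icc]
      intro w hw
      rw [(h.hasDerivAt_rate hw.1).deriv]
      have := mul_pos (h.rate_pos (show 0 < w by linarith [hw.1])) (h.pos w)
      linarith
    have h3 := h2 (Set.left_mem_Icc.mpr hv.1.le) (Set.right_mem_Icc.mpr hv.1.le) hv.1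
    rw [h.eq_one 1 le_rfl] at h3
    linarith
  intro a ha b hb hab
  rw [dickmanRate, dickmanRate, h.eq_one (a - 1) (by linarith [ha.2]),
    h.eq_one (b - 1) (by linarith [hb.2])]
  exact one_div_lt_one_div_of_lt (mul_pos (by linarith [hb.1]) (h.pos b)) (h1 ha hb hab)

lemma rate_gt_of_strictMonoOn (h : IsDickman ρ) {u : ℝ} (hu : 2 ≤ u)
    (hm : StrictMonoOn (dickmanRate ρ) (Set.Icc 1 u)) :
    dickmanRate ρ (u - 1) + 1 / u < dickmanRate ρ u := by
  set c := dickmanRate ρ (u - 1) with hc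
  have hcont : ContinuousOn (fun t => dickmanRate ρ t * ρ t) (Set.uIcc (u - 1) u) := by
    refine (h.continuousOn_rate.mono fun t ht => ?_).mul h.cont.continuousOn
    rw [Set.uIcc_of_le (by linarith)] at ht
    exact Set.mem_Ioi.mpr (by linarith [ht.1])
  have hi1 : IntervalIntegrable (fun t => dickmanRate ρ t * ρ t) volume (u - 1) u :=
    hcont.intervalIntegrable
  have hi2 : IntervalIntegrable (fun t => c * ρ t) volume (u - 1) u :=
    (continuous_const.mul h.cont).intervalIntegrable _ _
  have hftc : ∫ t in (u - 1)..u, -(dickmanRate ρ t * ρ t) = ρ u - ρ (u - 1) := by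
    refine integral_eq_sub_of_hasDerivAt_of_le (by linarith) h.cont.continuousOn
      (fun t ht => h.hasDerivAt_rate (by linarith [ht.1])) hi1.neg
  have hpos : 0 < ∫ t in (u - 1)..u, (dickmanRate ρ t * ρ t - c * ρ t) := by
    refine intervalIntegral_pos_of_pos_on (hi1.sub hi2) (fun t ht => ?_) (by linarith)
    have := hm ⟨by linarith, by linarith⟩ ⟨by linarith [ht.1], ht.2.le⟩ ht.1
    rw [← sub_mul]
    exact mul_pos (sub_pos.mpr this) (h.pos t)
  rw [intervalIntegral.integral_sub hi1 hi2, intervalIntegral.integral_const_mul,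
    ← h.mul_eq_integral (by linarith)] at hpos
  rw [intervalIntegral.integral_neg] at hftc
  have h1 : c * (u * ρ u) + ρ u < ρ (u - 1) := by linarith
  have hu0 : 0 < u := by linarith
  have hden := mul_pos hu0 (h.pos u)
  rw [dickmanRate, lt_div_iff₀ hden]
  have : (c + 1 / u) * (u * ρ u) = c * (u * ρ u) + ρ u := by field_simp
  linarith

lemma hasDerivAt_dickmanRate (h : IsDickman ρ) {u : ℝ} (hu : 2 < u) :
    HasDerivAt (dickmanRate ρ)
      (dickmanRate ρ u * (dickmanRate ρ u - (dickmanRate ρ (u - 1) + 1 / u))) u := by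
  have h1 : HasDerivAt (fun v => ρ (v - 1)) (-(dickmanRate ρ (u - 1) * ρ (u - 1))) u := by
    have h0 := (h.hasDerivAt_rate (show 1 < u - 1 by linarith)).comp u
      ((hasDerivAt_id u).sub_const 1)
    rw [mul_one] at h0
    exact h0
  have hu0 : 0 < u := by linarith
  have hp := (h.pos u).ne'
  have hp1 := (h.pos (u - 1)).ne'
  have h2 := h1.div (h.hasDerivAt_mul (show 1 < u by linarith)) (mul_ne_zero hu0.ne' hp)
  convert! h2 using 1
  set c := dickmanRate ρ (u - 1)
  rw [dickmanRate]
  field_simp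
  ring

lemma rate_strictMonoOn (h : IsDickman ρ) : StrictMonoOn (dickmanRate ρ) (Set.Ici 1) := by
  have key : ∀ u, 2 ≤ u → (∀ v, 2 < v → v < u → dickmanRate ρ (v - 1) + 1 / v < dickmanRate ρ v) →
      StrictMonoOn (dickmanRate ρ) (Set.Icc 1 u) := by
    intro u hu hv
    have h2 : StrictMonoOn (dickmanRate ρ) (Set.Icc 2 u) := by
      refine strictMonoOn_of_deriv_pos (convex_Icc 2 u)
        (h.continuousOn_rate.mono fun t ht => Set.mem_Ioi.mpr (by linarith [ht.1])) ?_
      rw [interior_Icc]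
      intro v hv'
      rw [(h.hasDerivAt_dickmanRate hv'.1).deriv]
      exact mul_pos (h.rate_pos (by linarith [hv'.1])) (sub_pos.mpr (hv v hv'.1 hv'.2))
    have h3 := h.rate_strictMonoOn_one_two.union h2 (c := 2) ⟨⟨by norm_num, le_rfl⟩, fun v hv => hv.2⟩
      ⟨⟨le_rfl, hu⟩, fun v hv => hv.1⟩
    rwa [Set.Icc_union_Icc_eq_Icc (by norm_num) hu] at h3
  have hall : ∀ u, 2 ≤ u → dickmanRate ρ (u - 1) + 1 / u < dickmanRate ρ u := by
    by_contra hcon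
    push Not at hcon
    obtain ⟨u, hu, hu'⟩ := hcon
    set S : Set ℝ := Set.Ici 2 ∩ {v | dickmanRate ρ v - (dickmanRate ρ (v - 1) + 1 / v) ≤ 0} with hS
    have hc : ContinuousOn (fun v => dickmanRate ρ v - (dickmanRate ρ (v - 1) + 1 / v))
        (Set.Ici 2) := by
      refine (h.continuousOn_rate.mono fun t ht => ?_).sub (ContinuousOn.add
        (h.continuousOn_rate.comp (by fun_prop) fun t ht => ?_)
        (continuousOn_const.div continuousOn_id fun t ht => ?_))
      · exact Set.mem_Ioi.mpr (by linarith [Set.mem_Ici.mp ht])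
      · exact Set.mem_Ioi.mpr (by linarith [Set.mem_Ici.mp ht])
      · have := Set.mem_Ici.mp ht
        exact (show (0 : ℝ) < t by linarith).ne'
    have hScl : IsClosed S := hc.preimage_isClosed_of_isClosed isClosed_Ici isClosed_Iic
    have hbdd : BddBelow S := ⟨2, fun v hv => hv.1⟩
    have hmem := hScl.csInf_mem ⟨u, hu, by simp only [Set.mem_ofPred_eq]; linarith⟩ hbdd
    set a := sInf S with ha
    have ha2 : 2 ≤ a := hmem.1
    have hm := key a ha2 fun v hv hva => by
      by_contra hn
      have : v ∈ S := ⟨hv.le, by simp only [Set.mem_ofPred_eq]; linarith [not_lt.mp hn]⟩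
      exact absurd (csInf_le hbdd this) (not_le.mpr hva)
    have h1 := h.rate_gt_of_strictMonoOn ha2 hm
    have h2 : dickmanRate ρ a - (dickmanRate ρ (a - 1) + 1 / a) ≤ 0 := hmem.2
    linarith
  intro a ha b hb hab
  have ha' := Set.mem_Ici.mp ha
  refine key (max b 2) (le_max_right _ _) (fun v hv _ => hall v hv.le) ⟨ha, ?_⟩ ⟨hb, le_max_left _ _⟩ hab
  exact hab.le.trans (le_max_left _ _)

lemma rate_mono (h : IsDickman ρ) {a b : ℝ} (ha : 1 ≤ a) (hab : a ≤ b) :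
    dickmanRate ρ a ≤ dickmanRate ρ b :=
  h.rate_strictMonoOn.monotoneOn ha (Set.mem_Ici.mpr (ha.trans hab)) hab

lemma sub_le_mul_exp (h : IsDickman ρ) {u s : ℝ} (hu : 1 ≤ u) (hs : 0 ≤ s) :
    ρ (u - s) ≤ ρ u * Real.exp (s * dickmanRate ρ u) := by
  set c := dickmanRate ρ u with hc
  have hc0 : 0 < c := h.rate_pos (by linarith)
  have h1 : MonotoneOn (fun t => ρ t * Real.exp (t * c)) (Set.Icc 1 u) := by
    have hd : ∀ t, 1 < t → HasDerivAt (fun t => ρ t * Real.exp (t * c))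
        ((c - dickmanRate ρ t) * (ρ t * Real.exp (t * c))) t := by
      intro t ht
      convert! (h.hasDerivAt_rate ht).mul ((hasDerivAt_id t).mul_const c).exp using 1
      simp
      ring
    refine monotoneOn_of_deriv_nonneg (convex_Icc 1 u)
      (h.cont.mul (by fun_prop)).continuousOn ?_ ?_
    · rw [interior_Icc]
      exact fun t ht => (hd t ht.1).differentiableAt.differentiableWithinAt
    · rw [interior_Icc]
      intro t ht
      rw [(hd t ht.1).deriv]
      refine mul_nonneg (sub_nonneg.mpr (h.rate_mono ht.1.le ht.2.le)) ?_
      have := h.pos t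
      positivity
  have h2 : ρ (u - s) * Real.exp ((u - s) * c) ≤ ρ u * Real.exp (u * c) := by
    rcases le_total 1 (u - s) with h3 | h3
    · exact h1 ⟨h3, by linarith⟩ ⟨hu, le_rfl⟩ (by linarith)
    · refine le_trans ?_ (h1 ⟨le_rfl, hu⟩ ⟨hu, le_rfl⟩ hu)
      simp only [h.eq_one _ h3, h.eq_one 1 le_rfl, one_mul]
      exact Real.exp_le_exp.mpr (by nlinarith)
  have h3 : Real.exp (u * c) = Real.exp ((u - s) * c) * Real.exp (s * c) := by
    rw [← Real.exp_add]; ring_nf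
  rw [h3] at h2
  have := Real.exp_pos ((u - s) * c)
  refine le_of_mul_le_mul_right ?_ this
  linarith

lemma half_le (h : IsDickman ρ) {u : ℝ} (hu : 1 ≤ u) : ρ (u - 1 / 2) ≤ 2 * u * ρ u := by
  have h1 : ∫ t in (u - 1)..(u - 1/2), ρ (u - 1 / 2) ≤ ∫ t in (u - 1)..(u - 1/2), ρ t :=
    integral_mono_on (by linarith) (by simp) (h.cont.intervalIntegrable _ _)
      fun t ht => h.antitone ht.2
  have h2 : 0 ≤ ∫ t in (u - 1/2)..u, ρ t :=
    integral_nonneg (by linarith) fun t _ => (h.pos t).le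
  have h3 := h.mul_eq_integral hu
  rw [← integral_add_adjacent_intervals (b := u - 1/2) (h.cont.intervalIntegrable _ _)
    (h.cont.intervalIntegrable _ _)] at h3
  rw [intervalIntegral.integral_const, smul_eq_mul] at h1
  nlinarith

lemma rate_le (h : IsDickman ρ) {u : ℝ} (hu : 1 ≤ u) :
    dickmanRate ρ u ≤ 2 * Real.log (2 * u + 1) := by
  set c := dickmanRate ρ u with hc
  have hd : ∀ t, 1 < t → HasDerivAt (fun t => ρ t * Real.exp (t * c))
      ((c - dickmanRate ρ t) * (ρ t * Real.exp (t * c))) t := by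
    intro t ht
    convert! (h.hasDerivAt_rate ht).mul ((hasDerivAt_id t).mul_const c).exp using 1
    simp
    ring
  have h1 : AntitoneOn (fun t => ρ t * Real.exp (t * c)) (Set.Ici u) := by
    refine antitoneOn_of_deriv_nonpos (convex_Ici u)
      (h.cont.mul (by fun_prop)).continuousOn ?_ ?_
    · rw [interior_Ici]
      exact fun t ht => (hd t (lt_of_le_of_lt hu ht)).differentiableAt.differentiableWithinAt
    · rw [interior_Ici]
      intro t ht
      rw [(hd t (lt_of_le_of_lt hu ht)).deriv]
      refine mul_nonpos_of_nonpos_of_nonneg (sub_nonpos.mpr (h.rate_mono hu (le_of_lt ht))) ?_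
      have := h.pos t
      positivity
  have h2 := h1 (Set.mem_Ici.mpr le_rfl) (Set.mem_Ici.mpr (by linarith : u ≤ u + 1/2)) (by linarith)
  have h3 := h.half_le (show 1 ≤ u + 1 / 2 by linarith)
  rw [add_sub_cancel_right] at h3
  have h4 : Real.exp ((u + 1/2) * c) = Real.exp (u * c) * Real.exp (c / 2) := by
    rw [← Real.exp_add]; ring_nf
  simp only [h4] at h2
  have h5 := Real.exp_pos (u * c)
  have h6 := h.pos (u + 1/2)
  have h7 : Real.exp (c / 2) ≤ 2 * u + 1 := by
    have : ρ (u + 1/2) * Real.exp (c/2) ≤ ρ u := by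
      refine le_of_mul_le_mul_right ?_ h5
      linarith
    refine le_of_mul_le_mul_left (a := ρ (u + 1/2)) ?_ h6
    linarith
  have h8 := (Real.le_log_iff_exp_le (by linarith)).mpr h7
  linarith

lemma rate_mul (h : IsDickman ρ) {u : ℝ} (hu : 0 < u) :
    ρ (u - 1) = u * dickmanRate ρ u * ρ u := by
  have := (h.pos u).ne'
  rw [dickmanRate]; field_simp

end IsDickman

lemma isDickman_comp_max {ρ : ℝ → ℝ} (hc : ContinuousOn ρ (Set.Ici (0 : ℝ)))
    (hi : ∀ u : ℝ, 0 ≤ u → u ≤ 1 → ρ u = 1)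
    (hd : ∀ u : ℝ, 1 < u → HasDerivAt ρ (-ρ (u - 1) / u) u) :
    IsDickman fun u => ρ (max u 0) where
  cont := hc.comp_continuous (by fun_prop) fun u => Set.mem_Ici.mpr (le_max_right _ _)
  eq_one u hu := hi _ (le_max_right _ _) (max_le hu zero_le_one)
  delay u hu := by
    rw [max_eq_left (by linarith : (0:ℝ) ≤ u - 1)]
    refine (hd u hu).congr_of_eventuallyEq ?_
    filter_upwards [lt_mem_nhds (show 0 < u by linarith)] with v hv
    rw [max_eq_left hv.le]

end SmoothApprox

namespace SmoothApprox
open ArithmeticFunction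

/-! ### Smooth numbers -/

/-- Every prime factor of `k` is at most `m`. -/
def IsSmooth (m k : ℕ) : Prop := ∀ p : ℕ, p.Prime → p ∣ k → p ≤ m

lemma IsSmooth.mul_iff {m a b : ℕ} : IsSmooth m (a * b) ↔ IsSmooth m a ∧ IsSmooth m b := by
  refine ⟨fun h => ⟨fun p hp hd => h p hp (hd.mul_right _), fun p hp hd => h p hp (hd.mul_left _)⟩,
    fun h p hp hd => ?_⟩
  rcases hp.dvd_mul.mp hd with h1 | h1
  · exact h.1 p hp h1
  · exact h.2 p hp h1

lemma isSmooth_of_le {m k : ℕ} (hk : 0 < k) (h : k ≤ m) : IsSmooth m k :=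
  fun _ _ hd => (Nat.le_of_dvd hk hd).trans h

lemma psi_eq_sum (n m : ℕ) :
    (Psi n m : ℝ) = ∑ k ∈ Finset.Ioc 0 n, if IsSmooth m k then 1 else 0 := by
  rw [Psi, Finset.sum_boole]
  rfl

lemma psi_le (n m : ℕ) : Psi n m ≤ n := by
  refine (Finset.card_filter_le _ _).trans ?_
  simp

lemma psi_eq_self {n m : ℕ} (h : n ≤ m) : Psi n m = n := by
  rw [Psi, Finset.filter_true_of_mem]
  · simp
  · intro k hk
    rw [Finset.mem_Icc] at hk
    exact isSmooth_of_le hk.1 (hk.2.trans h)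

lemma sum_log_smooth (N m : ℕ) :
    ∑ k ∈ Finset.Ioc 0 N, (if IsSmooth m k then Real.log k else 0) =
      ∑ d ∈ Finset.Ioc 0 N, (if IsSmooth m d then vonMangoldt d else 0) * (Psi (N / d) m : ℝ) := by
  set f : ArithmeticFunction ℝ :=
    ⟨fun d => if IsSmooth m d then vonMangoldt d else 0, by simp⟩ with hf
  set g : ArithmeticFunction ℝ :=
    ⟨fun d => if d = 0 then 0 else if IsSmooth m d then 1 else 0, by simp⟩ with hg
  have h := sum_Ioc_mul_eq_sum_sum f g N
  have h1 : ∀ n ∈ Finset.Ioc 0 N, (f * g) n = if IsSmooth m n then Real.log n else 0 := by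
    intro n hn
    have hd : ∑ x ∈ n.divisorsAntidiagonal, vonMangoldt x.1 = ∑ i ∈ n.divisors, vonMangoldt i :=
      Nat.sum_divisorsAntidiagonal fun i _ => vonMangoldt i
    rw [← vonMangoldt_sum, ArithmeticFunction.mul_apply, ← hd]
    split_ifs with hs
    · refine Finset.sum_congr rfl fun x hx => ?_
      obtain ⟨hx1, hx2⟩ := Nat.mem_divisorsAntidiagonal.mp hx
      have hx0 : x.2 ≠ 0 := fun h0 => hx2 (by rw [← hx1, h0, mul_zero])
      rw [← hx1, IsSmooth.mul_iff] at hs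
      simp [hf, hg, hs.1, hs.2, hx0]
    · refine Finset.sum_eq_zero fun x hx => ?_
      obtain ⟨hx1, hx2⟩ := Nat.mem_divisorsAntidiagonal.mp hx
      rw [← hx1, IsSmooth.mul_iff] at hs
      by_cases ha : IsSmooth m x.1
      · have hb : ¬ IsSmooth m x.2 := fun hb => hs ⟨ha, hb⟩
        simp [hg, hb]
      · simp [hf, ha]
  rw [Finset.sum_congr rfl h1] at h
  rw [h]
  refine Finset.sum_congr rfl fun d _ => ?_
  rw [psi_eq_sum]
  congr 1
  refine Finset.sum_congr rfl fun k hk => ?_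
  rw [Finset.mem_Ioc] at hk
  simp [hg, hk.1.ne']

lemma sum_mul_eq_sub (a w : ℕ → ℝ) {N : ℕ} (hN : 1 ≤ N) :
    ∑ d ∈ Finset.Icc 1 N, a d * w d = (∑ d ∈ Finset.Icc 1 N, a d) * w N -
      ∑ d ∈ Finset.Ico 1 N, (∑ e ∈ Finset.Icc 1 d, a e) * (w (d + 1) - w d) := by
  induction N, hN using Nat.le_induction with
  | base => simp
  | succ N hN ih =>
    rw [Finset.sum_Icc_succ_top (by omega), Finset.sum_Icc_succ_top (by omega), ih,
      Finset.sum_Ico_succ_top hN]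
    ring

lemma exists_sum_nonprime_bound : ∃ C : ℝ, 0 < C ∧ ∀ N : ℕ,
    ∑ d ∈ Finset.Icc 1 N, (if d.Prime then 0 else vonMangoldt d) * (d : ℝ) ^ (-(3 / 4) : ℝ) ≤ C := by
  obtain ⟨B, hB0, hB⟩ : ∃ B : ℝ, 0 < B ∧ ∀ N : ℕ,
      ∑ d ∈ Finset.Icc 1 N, (if d.Prime then 0 else vonMangoldt d) ≤ B * √N := by
    obtain ⟨B, hB⟩ := Chebyshev.psi_sub_theta_le_mul_sqrt
    refine ⟨max B 1, by positivity, fun N => ?_⟩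
    calc _ = Chebyshev.psi N - Chebyshev.theta N := by
          rw [Chebyshev.psi_sub_theta_eq_sum_not_prime, Nat.floor_natCast, Finset.sum_filter]
          refine Finset.sum_congr rfl fun d _ => ?_
          by_cases hd : d.Prime <;> simp [hd]
      _ ≤ B * √N := hB N
      _ ≤ max B 1 * √N := by gcongr; exact le_max_left _ _
  have hsum : Summable fun d : ℕ => (d : ℝ) ^ (-(5 / 4) : ℝ) :=
    Real.summable_nat_rpow.mpr (by norm_num)
  refine ⟨B * (1 + ∑' d : ℕ, (d : ℝ) ^ (-(5 / 4) : ℝ)), by positivity, fun N => ?_⟩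
  rcases Nat.eq_zero_or_pos N with rfl | hN
  · simp; positivity
  rw [sum_mul_eq_sub _ _ hN, mul_add, mul_one, sub_eq_add_neg, ← Finset.sum_neg_distrib]
  refine add_le_add ?_ ?_
  · have hN1 : (1 : ℝ) ≤ N := by exact_mod_cast hN
    calc _ ≤ B * √N * (N : ℝ) ^ (-(3 / 4) : ℝ) := by gcongr; exact hB N
      _ = B * (N : ℝ) ^ (-(1 / 4) : ℝ) := by
        rw [Real.sqrt_eq_rpow, mul_assoc, ← Real.rpow_add (by linarith)]; norm_num
      _ ≤ B * 1 := by
        gcongr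
        exact Real.rpow_le_one_of_one_le_of_nonpos hN1 (by norm_num)
      _ = B := mul_one B
  · calc _ ≤ ∑ d ∈ Finset.Ico 1 N, B * (d : ℝ) ^ (-(5 / 4) : ℝ) := by
          refine Finset.sum_le_sum fun d hd => ?_
          have hd1 : (1 : ℝ) ≤ d := by exact_mod_cast (Finset.mem_Ico.mp hd).1
          have hd0 : (0 : ℝ) < d := by linarith
          have hw : (d : ℝ) ^ (-(3 / 4) : ℝ) - ((d + 1 : ℕ) : ℝ) ^ (-(3 / 4) : ℝ)
              ≤ (d : ℝ) ^ (-(7 / 4) : ℝ) := by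
            have e1 : (d : ℝ) ^ (-(7 / 4) : ℝ) = (d : ℝ) ^ (-(3 / 4) : ℝ) * (d : ℝ)⁻¹ := by
              rw [← Real.rpow_neg_one (d : ℝ), ← Real.rpow_add hd0]; norm_num
            have e2 : ((d + 1 : ℕ) : ℝ) = d * (1 + (d : ℝ)⁻¹) := by
              push_cast; field_simp
            have e3 : (1 + (d : ℝ)⁻¹) ^ (-(1 : ℝ)) ≤ (1 + (d : ℝ)⁻¹) ^ (-(3 / 4) : ℝ) :=
              Real.rpow_le_rpow_of_exponent_le (by simp) (by norm_num)
            have e4 : 1 - (d : ℝ)⁻¹ ≤ (1 + (d : ℝ)⁻¹) ^ (-(1 : ℝ)) := by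
              rw [Real.rpow_neg_one, ← one_div (1 + (d : ℝ)⁻¹), le_div_iff₀ (by positivity)]
              nlinarith [sq_nonneg (d : ℝ)⁻¹]
            rw [e1, e2, Real.mul_rpow hd0.le (by positivity)]
            have := Real.rpow_pos_of_pos hd0 (-(3 / 4) : ℝ)
            nlinarith
          rw [← mul_neg, neg_sub]
          calc _ ≤ (B * √d) * (d : ℝ) ^ (-(7 / 4) : ℝ) := by
                refine mul_le_mul (hB d) hw (sub_nonneg.mpr ?_) (by positivity)
                exact Real.rpow_le_rpow_of_nonpos hd0 (by push_cast; linarith) (by norm_num)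
            _ = _ := by
              rw [Real.sqrt_eq_rpow, mul_assoc, ← Real.rpow_add hd0]; norm_num
      _ ≤ _ := by
        rw [← Finset.mul_sum]
        gcongr
        exact hsum.sum_le_tsum _ fun d _ => by positivity

end SmoothApprox

namespace SmoothApprox
open ArithmeticFunction

/-! ### Sums of a monotone function with regular coefficients -/

lemma abs_sum_mul_le_of_monotone {a g : ℕ → ℝ} {c B e : ℝ} {N₀ N : ℕ} (hg : Monotone g)
    (hg0 : ∀ d, 0 ≤ g d) (he : 0 ≤ e) (hc : |c| ≤ B)
    (hB : ∀ d, 1 ≤ d → |∑ k ∈ Finset.Icc 1 d, a k - c| ≤ B)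
    (hE : ∀ d, N₀ ≤ d → |∑ k ∈ Finset.Icc 1 d, a k - c| ≤ e) (hN₀ : 1 ≤ N₀) (hN : 1 ≤ N) :
    |∑ d ∈ Finset.Icc 1 N, a d * g d| ≤ 3 * B * g N₀ + 2 * e * g N := by
  have hB0 : 0 ≤ B := (abs_nonneg c).trans hc
  set R : ℕ → ℝ := fun d => ∑ k ∈ Finset.Icc 1 d, a k - c with hR
  have hRle : ∀ d, 1 ≤ d → |R d| ≤ (if d < N₀ then B else 0) + e := by
    intro d hd
    split_ifs with h
    · exact (hB d hd).trans (by linarith)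
    · rw [zero_add]; exact hE d (not_lt.mp h)
  have h1 : ∑ d ∈ Finset.Icc 1 N, a d * g d =
      R N * g N + c * g 1 - ∑ d ∈ Finset.Ico 1 N, R d * (g (d + 1) - g d) := by
    have h2 : ∑ d ∈ Finset.Ico 1 N, R d * (g (d + 1) - g d) =
        ∑ d ∈ Finset.Ico 1 N, (∑ e ∈ Finset.Icc 1 d, a e) * (g (d + 1) - g d)
          - c * (g N - g 1) := by
      rw [← Finset.sum_Ico_sub g hN, Finset.mul_sum, ← Finset.sum_sub_distrib]
      exact Finset.sum_congr rfl fun d _ => by simp only [hR]; ring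
    rw [sum_mul_eq_sub a g hN, h2]
    simp only [hR]
    ring
  have h3 : |∑ d ∈ Finset.Ico 1 N, R d * (g (d + 1) - g d)| ≤ B * g N₀ + e * g N := by
    calc _ ≤ ∑ d ∈ Finset.Ico 1 N, |R d * (g (d + 1) - g d)| := Finset.abs_sum_le_sum_abs _ _
      _ ≤ ∑ d ∈ Finset.Ico 1 N,
          ((if d < N₀ then B * (g (d + 1) - g d) else 0) + e * (g (d + 1) - g d)) := by
        refine Finset.sum_le_sum fun d hd => ?_
        have hm : 0 ≤ g (d + 1) - g d := sub_nonneg.mpr (hg (Nat.le_succ d))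
        rw [abs_mul, abs_of_nonneg hm]
        refine (mul_le_mul_of_nonneg_right (hRle d (Finset.mem_Ico.mp hd).1) hm).trans (le_of_eq ?_)
        split_ifs <;> ring
      _ = ∑ d ∈ (Finset.Ico 1 N).filter (· < N₀), B * (g (d + 1) - g d)
          + e * (g N - g 1) := by
        rw [Finset.sum_add_distrib, Finset.sum_filter, ← Finset.mul_sum, Finset.sum_Ico_sub g hN]
      _ ≤ ∑ d ∈ Finset.Ico 1 N₀, B * (g (d + 1) - g d) + e * (g N - g 1) := by
        refine add_le_add ?_ le_rfl
        refine Finset.sum_le_sum_of_subset_of_nonneg (fun d hd => ?_) fun d _ _ =>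
          mul_nonneg hB0 (sub_nonneg.mpr (hg (Nat.le_succ d)))
        rw [Finset.mem_filter, Finset.mem_Ico] at hd
        exact Finset.mem_Ico.mpr ⟨hd.1.1, hd.2⟩
      _ = B * (g N₀ - g 1) + e * (g N - g 1) := by
        rw [← Finset.mul_sum, Finset.sum_Ico_sub g hN₀]
      _ ≤ _ := by
        have := mul_nonneg hB0 (hg0 1)
        have := mul_nonneg he (hg0 1)
        linarith
  have h4 : |R N * g N| ≤ B * g N₀ + e * g N := by
    rw [abs_mul, abs_of_nonneg (hg0 N)]
    rcases lt_or_ge N N₀ with h | h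
    · have := mul_le_mul (hB N hN) (hg h.le) (hg0 N) hB0
      have := mul_nonneg he (hg0 N)
      linarith
    · have := mul_le_mul_of_nonneg_right (hE N h) (hg0 N)
      have := mul_nonneg hB0 (hg0 N₀)
      linarith
  have h5 : |c * g 1| ≤ B * g N₀ := by
    rw [abs_mul, abs_of_nonneg (hg0 1)]
    exact mul_le_mul hc (hg hN₀) (hg0 1) hB0
  rw [h1]
  have := abs_sub (R N * g N + c * g 1) (∑ d ∈ Finset.Ico 1 N, R d * (g (d + 1) - g d))
  have := abs_add_le (R N * g N) (c * g 1)
  linarith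

namespace IsDickman
variable {ρ : ℝ → ℝ}

lemma sub_log_div_le (h : IsDickman ρ) {u L z : ℝ} (hu : 1 ≤ u) (hL : 0 < L) (hz : 1 ≤ z)
    (hr : dickmanRate ρ u ≤ L / 4) :
    ρ (u - Real.log z / L) ≤ ρ u * z ^ (1 / 4 : ℝ) := by
  have hl := Real.log_nonneg hz
  refine (h.sub_le_mul_exp hu (div_nonneg hl hL.le)).trans ?_
  rw [Real.rpow_def_of_pos (by linarith)]
  refine mul_le_mul_of_nonneg_left (Real.exp_le_exp.mpr ?_) (h.pos u).le
  calc Real.log z / L * dickmanRate ρ u ≤ Real.log z / L * (L / 4) := by gcongr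
    _ = Real.log z * (1 / 4) := by field_simp

lemma monotone_sub_log_div (h : IsDickman ρ) {u L : ℝ} (hL : 0 < L) :
    Monotone fun d : ℕ => ρ (u - Real.log d / L) := by
  intro a b hab
  refine h.antitone (sub_le_sub_left (div_le_div_of_nonneg_right ?_ hL.le) u)
  rcases Nat.eq_zero_or_pos a with rfl | ha
  · simpa using Real.log_natCast_nonneg b
  · exact Real.log_le_log (by exact_mod_cast ha) (by exact_mod_cast hab)

lemma sub_log_succ_div_le (h : IsDickman ρ) {u L : ℝ} (hL : 0 < L)
    (hr : dickmanRate ρ u ≤ L) {d : ℕ} (hd : 1 ≤ d) :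
    ρ (u - Real.log (d + 1 : ℕ) / L) ≤ ρ (u - Real.log d / L) * (1 + 1 / d) := by
  have hd0 : (0 : ℝ) < d := by exact_mod_cast hd
  set v := u - Real.log d / L with hv
  have hvu : v ≤ u := by
    have := div_nonneg (Real.log_natCast_nonneg d) hL.le
    linarith
  have hlog : Real.log (d + 1 : ℕ) = Real.log d + Real.log (1 + 1 / d) := by
    rw [← Real.log_mul hd0.ne' (by positivity)]
    congr 1
    push_cast
    field_simp
  have hl0 : 0 ≤ Real.log (1 + 1 / d) := Real.log_nonneg (by simp)
  have hvd : u - Real.log (d + 1 : ℕ) / L = v - Real.log (1 + 1 / d) / L := by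
    rw [hlog, hv]; ring
  rw [hvd]
  rcases le_total 1 v with h1 | h1
  · refine (h.sub_le_mul_exp h1 (div_nonneg hl0 hL.le)).trans ?_
    refine mul_le_mul_of_nonneg_left ?_ (h.pos v).le
    rw [← Real.le_log_iff_exp_le (by positivity)]
    calc _ ≤ Real.log (1 + 1 / d) / L * L := by
          gcongr; exact (h.rate_mono h1 hvu).trans hr
      _ = _ := by field_simp
  · rw [h.eq_one v h1, h.eq_one]
    · simp
    · have := div_nonneg hl0 hL.le
      linarith

lemma abs_div_sub_integral_le (h : IsDickman ρ) {u L : ℝ} (hL : 0 < L)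
    (hr : dickmanRate ρ u ≤ L) {d : ℕ} (hd : 1 ≤ d) :
    |ρ (u - Real.log d / L) / d -
      L * ∫ s in (Real.log d / L)..(Real.log (d + 1 : ℕ) / L), ρ (u - s)| ≤
      ρ (u - Real.log d / L) / (d : ℝ) ^ 2 := by
  have hd0 : (0 : ℝ) < d := by exact_mod_cast hd
  have hlog : Real.log (d + 1 : ℕ) = Real.log d + Real.log (1 + 1 / d) := by
    rw [← Real.log_mul hd0.ne' (by positivity)]
    congr 1
    push_cast
    field_simp
  have hl0 : 0 ≤ Real.log (1 + 1 / d) := Real.log_nonneg (by simp)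
  have hle : Real.log d / L ≤ Real.log (d + 1 : ℕ) / L := by
    rw [hlog]; gcongr; linarith
  have hci : ∀ a b, IntervalIntegrable (fun s => ρ (u - s)) MeasureTheory.volume a b := fun a b =>
    (h.cont.comp (by fun_prop)).intervalIntegrable _ _
  set g0 := ρ (u - Real.log d / L) with hg0
  set g1 := ρ (u - Real.log (d + 1 : ℕ) / L) with hg1
  set I := ∫ s in (Real.log d / L)..(Real.log (d + 1 : ℕ) / L), ρ (u - s) with hI
  have hlow : g0 * Real.log (1 + 1 / d) ≤ L * I := by
    have := intervalIntegral.integral_mono_on (f := fun _ => g0) hle (by simp) (hci _ _)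
      fun s hs => h.antitone (by linarith [hs.1] : u - s ≤ u - Real.log d / L)
    rw [intervalIntegral.integral_const, smul_eq_mul, hlog] at this
    have h2 := mul_le_mul_of_nonneg_left this hL.le
    rw [hI, hlog]
    refine le_trans (le_of_eq ?_) h2
    field_simp
    ring
  have hhigh : L * I ≤ g1 * Real.log (1 + 1 / d) := by
    have := intervalIntegral.integral_mono_on (g := fun _ => g1) hle (hci _ _) (by simp)
      fun s hs => h.antitone (by linarith [hs.2] : u - Real.log (d + 1 : ℕ) / L ≤ u - s)
    rw [intervalIntegral.integral_const, smul_eq_mul] at this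
    have h2 := mul_le_mul_of_nonneg_left this hL.le
    refine h2.trans (le_of_eq ?_)
    rw [hlog]
    field_simp
    ring
  have hg : g1 ≤ g0 * (1 + 1 / d) := h.sub_log_succ_div_le hL hr hd
  have hg0p : 0 < g0 := h.pos _
  have hl1 : Real.log (1 + 1 / d) ≤ 1 / d := by
    have := Real.log_le_sub_one_of_pos (show (0 : ℝ) < 1 + 1 / d by positivity)
    linarith
  have hl2 : 1 / d - 1 / (d : ℝ) ^ 2 ≤ Real.log (1 + 1 / d) := by
    have h1 := Real.one_sub_inv_le_log_of_pos (show (0 : ℝ) < 1 + 1 / d by positivity)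
    refine le_trans ?_ h1
    have h2 : 1 - (1 + 1 / (d : ℝ))⁻¹ = 1 / (d + 1) := by
      field_simp; ring
    rw [h2, div_sub_div _ _ hd0.ne' (by positivity), div_le_div_iff₀ (by positivity) (by positivity)]
    nlinarith [pow_pos hd0 2, pow_pos hd0 3]
  rw [abs_le]
  constructor
  · have h1 : g1 * Real.log (1 + 1 / d) ≤ g0 * (1 + 1 / d) * (1 / d) :=
      mul_le_mul hg hl1 hl0 (by positivity)
    have h2 : g0 * (1 + 1 / (d : ℝ)) * (1 / d) = g0 / d + g0 / (d : ℝ) ^ 2 := by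
      field_simp
    linarith
  · have h1 := mul_le_mul_of_nonneg_left hl2 hg0p.le
    have h2 : g0 * (1 / d - 1 / (d : ℝ) ^ 2) = g0 / d - g0 / (d : ℝ) ^ 2 := by ring
    linarith

end IsDickman

lemma exists_sum_div_sub_integral_le : ∃ C : ℝ, 0 < C ∧ ∀ {ρ : ℝ → ℝ}, IsDickman ρ →
    ∀ {u L : ℝ}, 1 ≤ u → 0 < L → dickmanRate ρ u ≤ L / 4 → ∀ N : ℕ, 1 ≤ N →
    |∑ d ∈ Finset.Icc 1 N, ρ (u - Real.log d / L) / d -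
      L * ∫ s in (0 : ℝ)..(Real.log N / L), ρ (u - s)| ≤ C * ρ u := by
  have hsum : Summable fun d : ℕ => (d : ℝ) ^ (-(7 / 4) : ℝ) :=
    Real.summable_nat_rpow.mpr (by norm_num)
  refine ⟨1 + ∑' d : ℕ, (d : ℝ) ^ (-(7 / 4) : ℝ), ?_, ?_⟩
  · have : 0 ≤ ∑' d : ℕ, (d : ℝ) ^ (-(7 / 4) : ℝ) := tsum_nonneg fun d => by positivity
    linarith
  intro ρ h u L hu hL hr N hN
  have hci : ∀ a b, IntervalIntegrable (fun s => ρ (u - s)) MeasureTheory.volume a b := fun a b =>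
    (h.cont.comp (by fun_prop)).intervalIntegrable _ _
  have h1 : |∑ d ∈ Finset.Ico 1 N, ρ (u - Real.log d / L) / d -
      L * ∫ s in (0 : ℝ)..(Real.log N / L), ρ (u - s)| ≤
      ∑ d ∈ Finset.Ico 1 N, ρ (u - Real.log d / L) / (d : ℝ) ^ 2 := by
    induction N, hN using Nat.le_induction with
    | base => simp
    | succ N hN ih =>
      rw [Finset.sum_Ico_succ_top hN, Finset.sum_Ico_succ_top hN,
        ← intervalIntegral.integral_add_adjacent_intervals (hci 0 (Real.log N / L)) (hci _ _)]
      have := h.abs_div_sub_integral_le (u := u) hL (by linarith) hN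
      refine le_trans (le_of_eq ?_) ((abs_add_le _ _).trans (add_le_add ih this))
      congr 1
      ring
  have h2 : ∑ d ∈ Finset.Ico 1 N, ρ (u - Real.log d / L) / (d : ℝ) ^ 2 ≤
      (∑' d : ℕ, (d : ℝ) ^ (-(7 / 4) : ℝ)) * ρ u := by
    calc _ ≤ ∑ d ∈ Finset.Ico 1 N, (d : ℝ) ^ (-(7 / 4) : ℝ) * ρ u := by
          refine Finset.sum_le_sum fun d hd => ?_
          have hd1 : (1 : ℝ) ≤ d := by exact_mod_cast (Finset.mem_Ico.mp hd).1
          have hd0 : (0 : ℝ) < d := by linarith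
          rw [div_le_iff₀ (by positivity)]
          refine (h.sub_log_div_le hu hL hd1 hr).trans (le_of_eq ?_)
          rw [mul_comm ((d : ℝ) ^ _) (ρ u), mul_assoc, ← Real.rpow_natCast, ← Real.rpow_add hd0]
          norm_num
      _ ≤ _ := by
        rw [← Finset.sum_mul]
        have := (h.pos u).le
        gcongr
        exact hsum.sum_le_tsum _ fun d _ => by positivity
  have h3 : |ρ (u - Real.log N / L) / N| ≤ ρ u := by
    have hN1 : (1 : ℝ) ≤ N := by exact_mod_cast hN
    rw [abs_of_nonneg (div_nonneg (h.pos _).le (by linarith)), div_le_iff₀ (by linarith)]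
    refine (h.sub_log_div_le hu hL hN1 hr).trans ?_
    refine mul_le_mul_of_nonneg_left ?_ (h.pos u).le
    exact Real.rpow_le_self_of_one_le hN1 (by norm_num)
  rw [← Finset.sum_Ico_add_eq_sum_Icc hN]
  have := abs_add_le (∑ d ∈ Finset.Ico 1 N, ρ (u - Real.log d / L) / d -
      L * ∫ s in (0 : ℝ)..(Real.log N / L), ρ (u - s)) (ρ (u - Real.log N / L) / N)
  rw [add_comm (∑ d ∈ Finset.Ico 1 N, _), add_sub_assoc, add_comm (ρ _ / _)]
  linarith

end SmoothApprox

namespace SmoothApprox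
open ArithmeticFunction

/-! ### Sums of the Dickman function over prime powers -/

lemma exists_sum_vonMangoldt_sub_integral_le : ∃ C : ℝ, 0 < C ∧ ∀ {ρ : ℝ → ℝ}, IsDickman ρ →
    ∀ {u : ℝ} {m : ℕ}, 1 ≤ u → 16 ≤ Real.log m → u ≤ Real.log m * √(Real.log m) →
      dickmanRate ρ u ≤ √(Real.log m) → ∀ N : ℕ, 1 ≤ N → N ≤ m →
    |∑ d ∈ Finset.Icc 1 N, vonMangoldt d / d * ρ (u - Real.log d / Real.log m) -
      Real.log m * ∫ s in (0 : ℝ)..(Real.log N / Real.log m), ρ (u - s)| ≤ C * ρ u := by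
  obtain ⟨C₁, hC₁, hint⟩ := exists_sum_div_sub_integral_le
  obtain ⟨c, C₂, hC₂, hR⟩ := exists_mertens_sum_vonMangoldt 4 (by norm_num)
  set R : ℕ → ℝ := fun N => ∑ n ∈ Finset.Icc 1 N, (vonMangoldt n - 1) / n - c with hRdef
  obtain ⟨B, hB0, hcB, hB⟩ : ∃ B : ℝ, 0 < B ∧ |c| ≤ B ∧ ∀ d, 1 ≤ d → |R d| ≤ B := by
    have hl2 : 0 < Real.log 2 := Real.log_pos (by norm_num)
    refine ⟨C₂ / Real.log 2 ^ 4 + |R 1| + |c|, by positivity, ?_, fun d hd => ?_⟩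
    · have : 0 ≤ C₂ / Real.log 2 ^ 4 + |R 1| := by positivity
      linarith
    · rcases Nat.lt_or_ge d 2 with h | h
      · obtain rfl : d = 1 := by omega
        have : 0 ≤ C₂ / Real.log 2 ^ 4 := by positivity
        linarith [abs_nonneg c]
      · have h1 : C₂ / Real.log d ^ 4 ≤ C₂ / Real.log 2 ^ 4 := by
          gcongr
          exact_mod_cast h
        linarith [hR d h, abs_nonneg c, abs_nonneg (R 1)]
  refine ⟨3 * B * Real.exp 1 + 32 * C₂ + C₁, by positivity, ?_⟩
  intro ρ h u m hu hL hum hr N hN hNm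
  set L := Real.log m with hLdef
  set q := √L with hq
  have hq4 : 4 ≤ q := by
    rw [hq]; exact Real.le_sqrt_of_sq_le (by linarith)
  have hqq : q * q = L := Real.mul_self_sqrt (by linarith)
  have hL0 : 0 < L := by linarith
  set g : ℕ → ℝ := fun d => ρ (u - Real.log d / L) with hg
  set N₀ := ⌊Real.exp q⌋₊ with hN₀
  have hexp : Real.exp (q / 2) ≤ Real.exp q - 1 := by
    have h1 : Real.exp q = Real.exp (q / 2) * Real.exp (q / 2) := by
      rw [← Real.exp_add]; ring_nf
    have h2 := Real.add_one_le_exp (q / 2)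
    nlinarith
  have hN₀low : Real.exp (q / 2) ≤ N₀ := by
    have := Nat.lt_floor_add_one (Real.exp q)
    linarith
  have hN₀pos : (0 : ℝ) < N₀ := (Real.exp_pos _).trans_le hN₀low
  have hlogN₀ : q / 2 ≤ Real.log N₀ := (Real.le_log_iff_exp_le hN₀pos).mpr hN₀low
  have hlogN₀' : Real.log N₀ ≤ q := by
    rw [← Real.log_exp q]
    exact Real.log_le_log hN₀pos (Nat.floor_le (Real.exp_pos q).le)
  have hN₀2 : 2 ≤ N₀ := by
    have h2 := Real.add_one_le_exp (q / 2)
    have : (2 : ℝ) ≤ N₀ := by linarith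
    exact_mod_cast this
  have hE : ∀ d, N₀ ≤ d → |R d| ≤ C₂ / (q / 2) ^ 4 := by
    intro d hd
    refine (hR d (hN₀2.trans hd)).trans ?_
    have : q / 2 ≤ Real.log d :=
      hlogN₀.trans (Real.log_le_log hN₀pos (by exact_mod_cast hd))
    gcongr
  have key := abs_sum_mul_le_of_monotone (h.monotone_sub_log_div (u := u) hL0)
    (fun d => (h.pos _).le) (by positivity) hcB hB hE (by omega) hN
  have hgN₀ : g N₀ ≤ Real.exp 1 * ρ u := by
    have hl0 := Real.log_natCast_nonneg N₀
    refine (h.sub_le_mul_exp hu (div_nonneg hl0 hL0.le)).trans ?_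
    rw [mul_comm]
    refine mul_le_mul_of_nonneg_right (Real.exp_le_exp.mpr ?_) (h.pos u).le
    calc Real.log N₀ / L * dickmanRate ρ u ≤ q / L * q := by
          gcongr
          exact (h.rate_pos (by linarith)).le
      _ = 1 := by rw [div_mul_eq_mul_div, hqq, div_self hL0.ne']
  have hgN : g N ≤ L * L * ρ u := by
    have h1 : g N ≤ ρ (u - 1) := by
      refine h.antitone ?_
      have : Real.log N / L ≤ 1 := by
        rw [div_le_one hL0]
        exact Real.log_le_log (by exact_mod_cast hN) (by exact_mod_cast hNm)
      linarith
    rw [h.rate_mul (by linarith)] at h1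
    refine h1.trans (mul_le_mul_of_nonneg_right ?_ (h.pos u).le)
    calc u * dickmanRate ρ u ≤ (L * q) * q := by
          gcongr
          exact (h.rate_pos (by linarith)).le
      _ = L * L := by rw [mul_assoc, hqq]
  have hmain : |∑ d ∈ Finset.Icc 1 N, (vonMangoldt d - 1) / d * g d| ≤
      (3 * B * Real.exp 1 + 32 * C₂) * ρ u := by
    refine key.trans ?_
    have h1 : C₂ / (q / 2) ^ 4 = 16 * C₂ / (L * L) := by
      rw [← hqq]; field_simp; norm_num
    rw [h1]
    have h2 : 2 * (16 * C₂ / (L * L)) * g N ≤ 2 * (16 * C₂ / (L * L)) * (L * L * ρ u) := by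
      gcongr
    have h3 : 2 * (16 * C₂ / (L * L)) * (L * L * ρ u) = 32 * C₂ * ρ u := by
      field_simp; ring
    have h4 : 3 * B * g N₀ ≤ 3 * B * (Real.exp 1 * ρ u) := by gcongr
    calc _ ≤ 3 * B * (Real.exp 1 * ρ u) + 32 * C₂ * ρ u := by
          rw [← h3]; exact add_le_add h4 h2
      _ = _ := by ring
  have hi := hint h hu hL0 (hr.trans (by nlinarith)) N hN
  have hsplit : ∑ d ∈ Finset.Icc 1 N, vonMangoldt d / d * g d =
      ∑ d ∈ Finset.Icc 1 N, (vonMangoldt d - 1) / d * g d + ∑ d ∈ Finset.Icc 1 N, g d / d := by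
    rw [← Finset.sum_add_distrib]
    exact Finset.sum_congr rfl fun d _ => by ring
  rw [hsplit, add_sub_assoc, add_mul]
  exact (abs_add_le _ _).trans (add_le_add hmain hi)

/-- The full and the half sum over primes powers in the recursion for smooth counts. -/
lemma exists_sum_vonMangoldt_bounds : ∃ C : ℝ, 0 < C ∧ ∀ {ρ : ℝ → ℝ}, IsDickman ρ →
    ∀ {u : ℝ} {m : ℕ}, 1 ≤ u → 16 ≤ Real.log m → u ≤ Real.log m * √(Real.log m) →
      dickmanRate ρ u ≤ √(Real.log m) →
    |∑ d ∈ Finset.Icc 1 m, vonMangoldt d / d * ρ (u - Real.log d / Real.log m) -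
      u * Real.log m * ρ u| ≤ C * ρ u ∧
    ∑ d ∈ Finset.Icc 1 m.sqrt, vonMangoldt d / d * ρ (u - Real.log d / Real.log m) ≤
      u * Real.log m * ρ u / 2 + C * ρ u := by
  obtain ⟨C, hC, H⟩ := exists_sum_vonMangoldt_sub_integral_le
  refine ⟨C, hC, fun {ρ} h {u m} hu hL hum hr => ?_⟩
  have hm0 : 0 < m := by
    rcases Nat.eq_zero_or_pos m with rfl | h0
    · norm_num at hL
    · exact h0
  have hmR : (0 : ℝ) < m := by exact_mod_cast hm0
  set L := Real.log m with hLdef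
  have hL0 : 0 < L := by linarith
  have hci : ∀ a b, IntervalIntegrable (fun s => ρ (u - s)) MeasureTheory.volume a b := fun a b =>
    (h.cont.comp (by fun_prop)).intervalIntegrable _ _
  have hfull : ∫ s in (0 : ℝ)..1, ρ (u - s) = u * ρ u := by
    rw [intervalIntegral.integral_comp_sub_left (fun t => ρ t), sub_zero, ← h.mul_eq_integral hu]
  constructor
  · have := H h hu hL hum hr m hm0 le_rfl
    rw [← hLdef, div_self hL0.ne', hfull] at this
    rwa [show u * L * ρ u = L * (u * ρ u) by ring]
  · have hs0 : 0 < m.sqrt := Nat.sqrt_pos.mpr hm0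
    have h1 := (abs_le.mp (H h hu hL hum hr m.sqrt hs0 (Nat.sqrt_le_self m))).2
    rw [← hLdef] at h1
    have hle : Real.log m.sqrt / L ≤ 1 / 2 := by
      rw [div_le_iff₀ hL0]
      have h2 : Real.log ((m.sqrt : ℝ) ^ 2) ≤ L :=
        Real.log_le_log (by positivity) (by exact_mod_cast Nat.sqrt_le' m)
      rw [Real.log_pow] at h2
      push_cast at h2
      linarith
    have h0 : 0 ≤ Real.log m.sqrt / L := div_nonneg (Real.log_natCast_nonneg _) hL0.le
    have h3 : ∫ s in (0 : ℝ)..(Real.log m.sqrt / L), ρ (u - s) ≤ ∫ s in (0 : ℝ)..(1 / 2), ρ (u - s) := by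
      rw [← intervalIntegral.integral_add_adjacent_intervals (hci 0 (Real.log m.sqrt / L)) (hci _ (1 / 2))]
      have := intervalIntegral.integral_nonneg (f := fun s => ρ (u - s))
        (μ := MeasureTheory.volume) hle fun s _ => (h.pos (u - s)).le
      linarith
    have h4 : ∫ s in (0 : ℝ)..(1 / 2), ρ (u - s) ≤ ∫ s in (1 / 2 : ℝ)..1, ρ (u - s) := by
      have e : ∫ s in (1 / 2 : ℝ)..1, ρ (u - s) = ∫ s in (0 : ℝ)..(1 / 2), ρ (u - (s + 1 / 2)) := by
        rw [intervalIntegral.integral_comp_add_right (fun s => ρ (u - s))]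
        norm_num
      rw [e]
      refine intervalIntegral.integral_mono_on (by norm_num) (hci _ _)
        ((h.cont.comp (by fun_prop)).intervalIntegrable _ _) fun s _ => h.antitone (by linarith)
    have h5 := intervalIntegral.integral_add_adjacent_intervals (hci 0 (1 / 2)) (hci _ 1)
    rw [hfull] at h5
    have h6 : ∫ s in (0 : ℝ)..(Real.log m.sqrt / L), ρ (u - s) ≤ u * ρ u / 2 := by linarith
    have h7 := mul_le_mul_of_nonneg_left h6 hL0.le
    linarith

end SmoothApprox

namespace SmoothApprox
open ArithmeticFunction

/-! ### The main term -/

/-- The expected main term `x ρ(log x / L)`. -/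
noncomputable def dickmanMain (ρ : ℝ → ℝ) (L x : ℝ) : ℝ := x * ρ (Real.log x / L)

section Main
variable {ρ : ℝ → ℝ} {L x : ℝ}

lemma dickmanMain_pos (h : IsDickman ρ) (hx : 0 < x) : 0 < dickmanMain ρ L x :=
  mul_pos hx (h.pos _)

lemma dickmanMain_div (hx : 0 < x) {z : ℝ} (hz : 0 < z) :
    dickmanMain ρ L (x / z) = x / z * ρ (Real.log x / L - Real.log z / L) := by
  rw [dickmanMain, Real.log_div hx.ne' hz.ne', sub_div]

lemma dickmanMain_div_le (h : IsDickman ρ) (hL : 0 < L) (hx : 0 < x) (hu : 1 ≤ Real.log x / L)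
    (hr : dickmanRate ρ (Real.log x / L) ≤ L / 4) {z : ℝ} (hz : 1 ≤ z) :
    dickmanMain ρ L (x / z) ≤ dickmanMain ρ L x * z ^ (-(3 / 4) : ℝ) := by
  have hz0 : 0 < z := by linarith
  rw [dickmanMain_div hx hz0]
  calc _ ≤ x / z * (ρ (Real.log x / L) * z ^ (1 / 4 : ℝ)) := by
        gcongr
        exact h.sub_log_div_le hu hL hz hr
    _ = x * ρ (Real.log x / L) * (z ^ (-1 : ℝ) * z ^ (1 / 4 : ℝ)) := by
        rw [Real.rpow_neg_one]; ring
    _ = _ := by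
        rw [← Real.rpow_add hz0, dickmanMain]; norm_num

lemma dickmanMain_ge_exp (h : IsDickman ρ) (hL : 0 < L) {w : ℝ} (hw : 1 ≤ Real.log w / L)
    (hw0 : 0 < w) (hr : dickmanRate ρ (Real.log w / L) ≤ L / 4) :
    Real.exp (L + 3 / 4 * (Real.log w - L)) ≤ dickmanMain ρ L w := by
  set v := Real.log w / L with hv
  have hlw : Real.log w = v * L := by rw [hv]; field_simp
  have h1 := h.sub_le_mul_exp hw (show 0 ≤ v - 1 by linarith)
  rw [sub_sub_cancel, h.eq_one 1 le_rfl] at h1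
  have h2 : Real.exp ((v - 1) * dickmanRate ρ v) ≤ Real.exp ((v - 1) * (L / 4)) := by
    apply Real.exp_le_exp.mpr
    gcongr
  have h3 : 1 ≤ ρ v * Real.exp ((v - 1) * (L / 4)) :=
    h1.trans (mul_le_mul_of_nonneg_left h2 (h.pos v).le)
  have h4 : Real.exp (L + 3 / 4 * (Real.log w - L)) * Real.exp ((v - 1) * (L / 4)) = w := by
    rw [← Real.exp_add, hlw]
    conv_rhs => rw [← Real.exp_log hw0, hlw]
    congr 1; ring
  have h5 := mul_le_mul_of_nonneg_left h3 (Real.exp_pos (L + 3 / 4 * (Real.log w - L))).le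
  rw [mul_one] at h5
  refine h5.trans (le_of_eq ?_)
  rw [dickmanMain, ← hv]
  linear_combination ρ v * h4

lemma one_le_dickmanMain (h : IsDickman ρ) (hL : 0 < L)
    (hr : dickmanRate ρ (Real.log x / L) ≤ L / 4) {z : ℝ} (hz : 1 ≤ z) (hzx : z ≤ x) :
    1 ≤ dickmanMain ρ L z := by
  rcases le_total (Real.log z / L) 1 with h1 | h1
  · rwa [dickmanMain, h.eq_one _ h1, mul_one]
  · have h2 : dickmanRate ρ (Real.log z / L) ≤ L / 4 := by
      refine (h.rate_mono h1 ?_).trans hr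
      gcongr
    refine le_trans ?_ (dickmanMain_ge_exp h hL h1 (by linarith) h2)
    rw [one_le_div hL] at h1
    exact Real.one_le_exp (by linarith)

end Main

lemma log_le_sum_two_pow {z : ℝ} (hz : 1 ≤ z) (J : ℕ) (hJ : z ≤ 2 ^ J) :
    Real.log z ≤ ∑ j ∈ Finset.range J, if (2 : ℝ) ^ j ≤ z then (1 : ℝ) else 0 := by
  induction J with
  | zero =>
    obtain rfl : z = 1 := le_antisymm (by simpa using hJ) hz
    simp
  | succ J ih =>
    rcases le_total z (2 ^ J) with h | h
    · rw [Finset.sum_range_succ]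
      have : (0 : ℝ) ≤ if (2 : ℝ) ^ J ≤ z then (1 : ℝ) else 0 := by split_ifs <;> norm_num
      linarith [ih h]
    · have h1 : ∀ j ∈ Finset.range (J + 1), (if (2 : ℝ) ^ j ≤ z then (1 : ℝ) else 0) = 1 := by
        intro j hj
        rw [if_pos]
        exact (pow_le_pow_right₀ (by norm_num) (by rw [Finset.mem_range] at hj; omega)).trans h
      rw [Finset.sum_congr rfl h1]
      simp only [Finset.sum_const, Finset.card_range, nsmul_eq_mul, mul_one]
      have h2 := Real.log_le_log (by linarith) hJ
      rw [Real.log_pow] at h2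
      have h3 : Real.log 2 ≤ 1 := by linarith [Real.log_two_lt_d9]
      have h4 : ((J + 1 : ℕ) : ℝ) * Real.log 2 ≤ ((J + 1 : ℕ) : ℝ) * 1 := by gcongr
      linarith

lemma sum_log_div_smooth_le {x : ℝ} (hx : 1 ≤ x) (m : ℕ) {J : ℕ} (hJ : x ≤ 2 ^ J) :
    ∑ k ∈ Finset.Ioc 0 ⌊x⌋₊, (if IsSmooth m k then Real.log (x / k) else 0) ≤
      ∑ j ∈ Finset.range J, (Psi ⌊x / 2 ^ j⌋₊ m : ℝ) := by
  have h1 : ∀ k ∈ Finset.Ioc 0 ⌊x⌋₊, (if IsSmooth m k then Real.log (x / k) else 0) ≤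
      ∑ j ∈ Finset.range J, if IsSmooth m k ∧ (2 : ℝ) ^ j ≤ x / k then (1 : ℝ) else 0 := by
    intro k hk
    rw [Finset.mem_Ioc] at hk
    have hk1 : (1 : ℝ) ≤ k := by exact_mod_cast hk.1
    have hkx : (k : ℝ) ≤ x := (Nat.le_floor_iff (by linarith)).mp hk.2
    by_cases hs : IsSmooth m k
    · simp only [hs, if_true, true_and]
      refine log_le_sum_two_pow ((one_le_div (by linarith)).mpr hkx) J ?_
      exact (div_le_self (by linarith) hk1).trans hJ
    · simp [hs]
  refine (Finset.sum_le_sum h1).trans ?_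
  rw [Finset.sum_comm]
  refine Finset.sum_le_sum fun j _ => ?_
  rw [psi_eq_sum, Finset.sum_boole, Finset.sum_boole]
  refine Nat.cast_le.mpr (Finset.card_le_card fun k hk => ?_)
  simp only [Finset.mem_filter, Finset.mem_Ioc] at hk ⊢
  have hk0 : (0 : ℝ) < k := by exact_mod_cast hk.1.1
  refine ⟨⟨hk.1.1, Nat.le_floor ?_⟩, hk.2.1⟩
  rw [le_div_iff₀ (by positivity), mul_comm]
  exact (le_div_iff₀ hk0).mp hk.2.2

end SmoothApprox

namespace SmoothApprox
open ArithmeticFunction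

/-! ### The recursion for smooth counts -/

/-- The number of `m`-smooth integers up to the real number `x`. -/
noncomputable def smoothCount (m : ℕ) (x : ℝ) : ℝ := (Psi ⌊x⌋₊ m : ℝ)

lemma smoothCount_nonneg (m : ℕ) (x : ℝ) : 0 ≤ smoothCount m x := Nat.cast_nonneg _

lemma smoothCount_of_lt_one (m : ℕ) {x : ℝ} (hx : x < 1) : smoothCount m x = 0 := by
  rw [smoothCount, Nat.floor_eq_zero.mpr hx]; simp [Psi]

lemma smoothCount_le (m : ℕ) {x : ℝ} (hx : 0 ≤ x) : smoothCount m x ≤ x :=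
  (Nat.cast_le.mpr (psi_le _ _)).trans (Nat.floor_le hx)

lemma smoothCount_mul_log {m : ℕ} {x : ℝ} (hx : 1 ≤ x) (hmx : (m : ℝ) ≤ x) :
    smoothCount m x * Real.log x =
      ∑ k ∈ Finset.Ioc 0 ⌊x⌋₊, (if IsSmooth m k then Real.log (x / k) else 0) +
      ∑ d ∈ Finset.Icc 1 m, vonMangoldt d * smoothCount m (x / d) +
      ∑ d ∈ Finset.Ioc m ⌊x⌋₊, (if IsSmooth m d then vonMangoldt d else 0) *
        smoothCount m (x / d) := by
  have hmN : m ≤ ⌊x⌋₊ := Nat.le_floor hmx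
  have h1 : smoothCount m x * Real.log x =
      ∑ k ∈ Finset.Ioc 0 ⌊x⌋₊, (if IsSmooth m k then Real.log (x / k) else 0) +
      ∑ k ∈ Finset.Ioc 0 ⌊x⌋₊, (if IsSmooth m k then Real.log k else 0) := by
    rw [smoothCount, psi_eq_sum, Finset.sum_mul, ← Finset.sum_add_distrib]
    refine Finset.sum_congr rfl fun k hk => ?_
    have hk0 : (k : ℝ) ≠ 0 := by
      have := (Finset.mem_Ioc.mp hk).1
      exact_mod_cast this.ne'
    split_ifs
    · rw [Real.log_div (by linarith) hk0]; ring
    · ring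
  rw [h1, sum_log_smooth]
  have hI : Finset.Ioc 0 m = Finset.Icc 1 m := by
    ext d
    simp only [Finset.mem_Ioc, Finset.mem_Icc]
    omega
  have h2 : ∀ d : ℕ, (Psi (⌊x⌋₊ / d) m : ℝ) = smoothCount m (x / d) := fun d => by
    rw [smoothCount, Nat.floor_div_natCast]
  simp only [h2]
  rw [← Finset.sum_Ioc_consecutive (fun d => (if IsSmooth m d then vonMangoldt d else 0) *
    smoothCount m (x / d)) (Nat.zero_le m) hmN, hI, add_assoc]
  refine congrArg₂ _ rfl (congrArg₂ _ (Finset.sum_congr rfl fun d hd => ?_) rfl)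
  rw [Finset.mem_Icc] at hd
  rw [if_pos (isSmooth_of_le hd.1 hd.2)]

section Bounds
variable {ρ : ℝ → ℝ} {L M x : ℝ} {m : ℕ}

lemma exists_sum_log_div_smooth_le : ∃ C : ℝ, 0 < C ∧ ∀ {ρ : ℝ → ℝ} {L M x : ℝ} {m : ℕ},
    IsDickman ρ → 0 < L → 1 ≤ x → 1 ≤ Real.log x / L →
    dickmanRate ρ (Real.log x / L) ≤ L / 4 → 0 ≤ M →
    (∀ z, 1 ≤ z → z ≤ x → smoothCount m z ≤ M * dickmanMain ρ L z) →
    ∑ k ∈ Finset.Ioc 0 ⌊x⌋₊, (if IsSmooth m k then Real.log (x / k) else 0) ≤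
      C * M * dickmanMain ρ L x := by
  set q : ℝ := 2 ^ (-(3 / 4) : ℝ) with hq
  have hq0 : 0 < q := by positivity
  have hq1 : q < 1 := Real.rpow_lt_one_of_one_lt_of_neg (by norm_num) (by norm_num)
  have hs := summable_geometric_of_lt_one hq0.le hq1
  refine ⟨∑' j : ℕ, q ^ j, hs.tsum_pos (fun j => by positivity) 0 (by simp), ?_⟩
  intro ρ L M x m h hL hx hu hr hM hS
  have hx0 : 0 < x := by linarith
  obtain ⟨J, hJ⟩ := pow_unbounded_of_one_lt x (show (1 : ℝ) < 2 by norm_num)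
  refine (sum_log_div_smooth_le hx m hJ.le).trans ?_
  have hF := (dickmanMain_pos (L := L) h hx0).le
  calc _ ≤ ∑ j ∈ Finset.range J, q ^ j * (M * dickmanMain ρ L x) := by
        refine Finset.sum_le_sum fun j _ => ?_
        rcases lt_or_ge (x / 2 ^ j) 1 with h1 | h1
        · have := smoothCount_of_lt_one m h1
          rw [smoothCount] at this
          rw [this]; positivity
        · have h2 : (1 : ℝ) ≤ 2 ^ j := one_le_pow₀ (by norm_num)
          refine (hS _ h1 (div_le_self hx0.le h2)).trans ?_
          have h3 := dickmanMain_div_le h hL hx0 hu hr h2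
          have h4 : ((2 : ℝ) ^ j) ^ (-(3 / 4) : ℝ) = q ^ j := by
            rw [hq, ← Real.rpow_natCast, ← Real.rpow_natCast, ← Real.rpow_mul (by norm_num),
              ← Real.rpow_mul (by norm_num), mul_comm]
          rw [h4] at h3
          calc _ ≤ M * (dickmanMain ρ L x * q ^ j) := by gcongr
            _ = _ := by ring
    _ ≤ _ := by
        rw [← Finset.sum_mul, mul_assoc]
        gcongr
        exact hs.sum_le_tsum _ fun j _ => by positivity

lemma exists_sum_prime_powers_le : ∃ C : ℝ, 0 < C ∧ ∀ {ρ : ℝ → ℝ} {L M x : ℝ} {m : ℕ},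
    IsDickman ρ → 0 < L → 1 ≤ x → 1 ≤ Real.log x / L →
    dickmanRate ρ (Real.log x / L) ≤ L / 4 → 0 ≤ M →
    (∀ z, 1 ≤ z → z ≤ x → smoothCount m z ≤ M * dickmanMain ρ L z) →
    ∑ d ∈ Finset.Ioc m ⌊x⌋₊, (if IsSmooth m d then vonMangoldt d else 0) *
        smoothCount m (x / d) ≤ C * M * dickmanMain ρ L x := by
  obtain ⟨C, hC, H⟩ := exists_sum_nonprime_bound
  refine ⟨C, hC, ?_⟩
  intro ρ L M x m h hL hx hu hr hM hS
  have hx0 : 0 < x := by linarith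
  have hF := (dickmanMain_pos (L := L) h hx0).le
  calc _ ≤ ∑ d ∈ Finset.Ioc m ⌊x⌋₊, (if d.Prime then 0 else vonMangoldt d) *
          (d : ℝ) ^ (-(3 / 4) : ℝ) * (M * dickmanMain ρ L x) := by
        refine Finset.sum_le_sum fun d hd => ?_
        rw [Finset.mem_Ioc] at hd
        have hd0 : 0 < d := (Nat.zero_le m).trans_lt hd.1
        have hd1 : (1 : ℝ) ≤ d := by exact_mod_cast hd0
        have hdx : (d : ℝ) ≤ x := (Nat.le_floor_iff hx0.le).mp hd.2
        have hΛ : (if IsSmooth m d then vonMangoldt d else 0) ≤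
            (if d.Prime then 0 else vonMangoldt d) := by
          by_cases hp : d.Prime
          · have : ¬ IsSmooth m d := fun hs => absurd (hs d hp dvd_rfl) (not_le.mpr hd.1)
            simp [hp, this]
          · rw [if_neg hp]
            split_ifs
            · exact le_rfl
            · exact vonMangoldt_nonneg
        have hp0 : (0 : ℝ) ≤ if d.Prime then 0 else vonMangoldt d := by
          split_ifs
          · exact le_rfl
          · exact vonMangoldt_nonneg
        rw [mul_assoc]
        refine mul_le_mul hΛ ?_ (smoothCount_nonneg _ _) hp0
        refine (hS _ ((one_le_div (by linarith)).mpr hdx) (div_le_self hx0.le hd1)).trans ?_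
        have h3 := dickmanMain_div_le h hL hx0 hu hr hd1
        calc _ ≤ M * (dickmanMain ρ L x * (d : ℝ) ^ (-(3 / 4) : ℝ)) := by gcongr
          _ = _ := by ring
    _ ≤ ∑ d ∈ Finset.Icc 1 ⌊x⌋₊, (if d.Prime then 0 else vonMangoldt d) *
          (d : ℝ) ^ (-(3 / 4) : ℝ) * (M * dickmanMain ρ L x) := by
        refine Finset.sum_le_sum_of_subset_of_nonneg (fun d hd => ?_) fun d _ _ => ?_
        · rw [Finset.mem_Ioc] at hd
          exact Finset.mem_Icc.mpr ⟨by omega, hd.2⟩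
        · refine mul_nonneg (mul_nonneg ?_ (by positivity)) (by positivity)
          split_ifs
          · exact le_rfl
          · exact vonMangoldt_nonneg
    _ ≤ _ := by
        rw [← Finset.sum_mul, mul_assoc C]
        gcongr
        exact H _

end Bounds

lemma abs_sub_le_of_decomposition {U F S C₁ C₂ C₃ C₄ D₀ D₁ A A' E₁ E₂ T : ℝ} (hU : 0 < U)
    (hC₁ : 0 ≤ C₁) (hC₂ : 0 ≤ C₂) (hC₃ : 0 ≤ C₃) (hC₄ : 0 ≤ C₄) (hD₀ : 0 ≤ D₀) (hD : D₀ ≤ D₁)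
    (hF : 0 ≤ F) (hS : S * U = E₁ + T + E₂) (hE₁ : 0 ≤ E₁) (hE₂ : 0 ≤ E₂)
    (hE₁' : E₁ ≤ C₁ * (2 + D₁) * F) (hE₂' : E₂ ≤ C₂ * (2 + D₁) * F) (hA : |A - U * F| ≤ C₃ * F)
    (hA' : A' ≤ U * F / 2 + C₃ * F) (hT : |T - A| ≤ D₀ * A + (D₁ - D₀) * A' + C₄ * F) :
    |S - F| ≤ ((D₀ + D₁) / 2 + (2 * C₁ + 2 * C₂ + 2 * C₃ + C₄) * (1 + D₁) / U) * F := by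
  have hD₁ : 0 ≤ D₁ := hD₀.trans hD
  have hA3 := (abs_le.mp hA).2
  have b1 : D₀ * A ≤ D₀ * (U * F + C₃ * F) := mul_le_mul_of_nonneg_left (by linarith) hD₀
  have b2 : (D₁ - D₀) * A' ≤ (D₁ - D₀) * (U * F / 2 + C₃ * F) :=
    mul_le_mul_of_nonneg_left hA' (by linarith)
  have b3 : U * |S - F| ≤ E₁ + E₂ + |T - A| + |A - U * F| := by
    have e : U * (S - F) = (E₁ + E₂) + ((T - A) + (A - U * F)) := by linear_combination hS
    rw [← abs_of_pos hU, ← abs_mul, abs_of_pos hU, e]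
    refine (abs_add_le _ _).trans ?_
    rw [abs_of_nonneg (add_nonneg hE₁ hE₂), add_assoc (E₁ + E₂)]
    gcongr
    exact abs_add_le _ _
  have p1 : 0 ≤ C₁ * D₁ * F := by positivity
  have p2 : 0 ≤ C₂ * D₁ * F := by positivity
  have p3 : 0 ≤ C₃ * D₁ * F := by positivity
  have p4 : 0 ≤ C₄ * D₁ * F := by positivity
  have p5 : 0 ≤ C₃ * F := by positivity
  rw [← mul_le_mul_iff_right₀ hU]
  have e : U * (((D₀ + D₁) / 2 + (2 * C₁ + 2 * C₂ + 2 * C₃ + C₄) * (1 + D₁) / U) * F) =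
      (D₀ + D₁) / 2 * (U * F) + (2 * C₁ + 2 * C₂ + 2 * C₃ + C₄) * (1 + D₁) * F := by
    field_simp
  rw [e]
  ring_nf at *
  linarith

/-- The smooth count up to `x` in terms of the smooth counts up to smaller numbers. -/
lemma exists_recursion : ∃ C : ℝ, 0 < C ∧ ∀ {ρ : ℝ → ℝ} {m : ℕ} {x D₀ D₁ : ℝ}, IsDickman ρ →
    16 ≤ Real.log m → 1 ≤ x → 1 ≤ Real.log x / Real.log m →
    Real.log x / Real.log m ≤ Real.log m * √(Real.log m) →
    dickmanRate ρ (Real.log x / Real.log m) ≤ √(Real.log m) → 0 ≤ D₀ → D₀ ≤ D₁ →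
    (∀ z, 1 ≤ z → z ≤ x / √m → |smoothCount m z - dickmanMain ρ (Real.log m) z| ≤
      D₀ * dickmanMain ρ (Real.log m) z + 1) →
    (∀ z, 1 ≤ z → z ≤ x → |smoothCount m z - dickmanMain ρ (Real.log m) z| ≤
      D₁ * dickmanMain ρ (Real.log m) z + 1) →
    |smoothCount m x - dickmanMain ρ (Real.log m) x| ≤
      ((D₀ + D₁) / 2 + C * (1 + D₁) / Real.log x) * dickmanMain ρ (Real.log m) x := by
  obtain ⟨C₁, hC₁, H₁⟩ := exists_sum_log_div_smooth_le
  obtain ⟨C₂, hC₂, H₂⟩ := exists_sum_prime_powers_le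
  obtain ⟨C₃, hC₃, H₃⟩ := exists_sum_vonMangoldt_bounds
  set C₄ : ℝ := Real.log 4 + 4 with hC₄
  have hC₄0 : 0 < C₄ := by
    have := Real.log_nonneg (show (1 : ℝ) ≤ 4 by norm_num)
    linarith
  refine ⟨2 * C₁ + 2 * C₂ + 2 * C₃ + C₄, by positivity, ?_⟩
  intro ρ m x D₀ D₁ h hL hx hu hum hr hD₀ hD hP₀ hP₁
  have hm0 : 0 < m := by
    rcases Nat.eq_zero_or_pos m with rfl | h0
    · norm_num at hL
    · exact h0
  have hmR : (0 : ℝ) < m := by exact_mod_cast hm0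
  set L := Real.log m with hLdef
  have hL0 : 0 < L := by linarith
  have hx0 : 0 < x := by linarith
  have hD₁ : 0 ≤ D₁ := hD₀.trans hD
  set u := Real.log x / L with hudef
  have hlogx : Real.log x = u * L := by rw [hudef]; field_simp
  have hr4 : dickmanRate ρ u ≤ L / 4 := by
    refine hr.trans ?_
    have h4 : 4 ≤ √L := Real.le_sqrt_of_sq_le (by linarith)
    have := Real.mul_self_sqrt hL0.le
    nlinarith
  set F := dickmanMain ρ L with hFdef
  have hF1 : ∀ z, 1 ≤ z → z ≤ x → 1 ≤ F z := fun z => one_le_dickmanMain h hL0 hr4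
  have hFx := dickmanMain_pos (L := L) h hx0
  have hS : ∀ z, 1 ≤ z → z ≤ x → smoothCount m z ≤ (2 + D₁) * F z := fun z h1 h2 => by
    have := (abs_le.mp (hP₁ z h1 h2)).2
    linarith [hF1 z h1 h2]
  have hmx : (m : ℝ) ≤ x := by
    rw [← Real.log_le_log_iff hmR hx0, hlogx]
    nlinarith
  have hE₁ := H₁ h hL0 hx hu hr4 (by linarith) hS
  have hE₂ := H₂ h hL0 hx hu hr4 (by linarith) hS
  have hE₁0 : 0 ≤ ∑ k ∈ Finset.Ioc 0 ⌊x⌋₊, (if IsSmooth m k then Real.log (x / k) else 0) := by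
    refine Finset.sum_nonneg fun k hk => ?_
    rw [Finset.mem_Ioc] at hk
    have hk0 : (0 : ℝ) < k := by exact_mod_cast hk.1
    split_ifs
    · exact Real.log_nonneg ((one_le_div hk0).mpr ((Nat.le_floor_iff hx0.le).mp hk.2))
    · exact le_rfl
  have hE₂0 : 0 ≤ ∑ d ∈ Finset.Ioc m ⌊x⌋₊, (if IsSmooth m d then vonMangoldt d else 0) *
      smoothCount m (x / d) := by
    refine Finset.sum_nonneg fun d _ => mul_nonneg ?_ (smoothCount_nonneg _ _)
    split_ifs
    · exact vonMangoldt_nonneg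
    · exact le_rfl
  obtain ⟨hA, hA'⟩ := H₃ h hu hL hum hr
  have hsum : ∀ N, ∑ d ∈ Finset.Icc 1 N, vonMangoldt d * F (x / d) =
      x * ∑ d ∈ Finset.Icc 1 N, vonMangoldt d / d * ρ (u - Real.log d / L) := by
    intro N
    rw [Finset.mul_sum]
    refine Finset.sum_congr rfl fun d hd => ?_
    have hd0 : (0 : ℝ) < d := by
      have := (Finset.mem_Icc.mp hd).1
      exact_mod_cast this
    rw [hFdef, dickmanMain_div hx0 hd0]
    ring
  have hFx' : F x = x * ρ u := rfl
  set A := ∑ d ∈ Finset.Icc 1 m, vonMangoldt d * F (x / d) with hAdef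
  set A' := ∑ d ∈ Finset.Icc 1 m.sqrt, vonMangoldt d * F (x / d) with hAdef'
  have hA1 : |A - u * L * F x| ≤ C₃ * F x := by
    rw [hAdef, hsum, hFx', show u * L * (x * ρ u) = x * (u * L * ρ u) by ring, ← mul_sub, abs_mul,
      abs_of_pos hx0, show C₃ * (x * ρ u) = x * (C₃ * ρ u) by ring]
    gcongr
  have hA2 : A' ≤ u * L * F x / 2 + C₃ * F x := by
    rw [hAdef', hsum, hFx', show u * L * (x * ρ u) / 2 + C₃ * (x * ρ u) =
      x * (u * L * ρ u / 2 + C₃ * ρ u) by ring]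
    gcongr
  have hψ : ∑ d ∈ Finset.Icc 1 m, vonMangoldt d ≤ C₄ * F x := by
    have h1 : ∑ d ∈ Finset.Icc 1 m, vonMangoldt d = Chebyshev.psi m := by
      rw [Chebyshev.psi, Nat.floor_natCast]
      rfl
    rw [h1]
    refine (Chebyshev.psi_le_const_mul_self hmR.le).trans ?_
    gcongr
    refine le_trans ?_ (dickmanMain_ge_exp h hL0 hu hx0 hr4)
    conv_lhs => rw [← Real.exp_log hmR]
    apply Real.exp_le_exp.mpr
    rw [hlogx, ← hLdef]
    nlinarith
  have hmain : |∑ d ∈ Finset.Icc 1 m, vonMangoldt d * smoothCount m (x / d) - A| ≤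
      D₀ * A + (D₁ - D₀) * A' + ∑ d ∈ Finset.Icc 1 m, vonMangoldt d := by
    have h1 : ∀ d ∈ Finset.Icc 1 m, |vonMangoldt d * smoothCount m (x / d) -
        vonMangoldt d * F (x / d)| ≤ D₀ * (vonMangoldt d * F (x / d)) +
        (if d ∈ Finset.Icc 1 m.sqrt then (D₁ - D₀) * (vonMangoldt d * F (x / d)) else 0) +
        vonMangoldt d := by
      intro d hd
      rw [Finset.mem_Icc] at hd
      have hd1 : (1 : ℝ) ≤ d := by exact_mod_cast hd.1
      have hdm : (d : ℝ) ≤ m := by exact_mod_cast hd.2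
      have hz1 : 1 ≤ x / d := (one_le_div (by linarith)).mpr (by linarith)
      have hΛ : 0 ≤ vonMangoldt d := vonMangoldt_nonneg
      rw [← mul_sub, abs_mul, abs_of_nonneg hΛ]
      split_ifs with hs
      · have := mul_le_mul_of_nonneg_left (hP₁ _ hz1 (div_le_self hx0.le hd1)) hΛ
        refine this.trans (le_of_eq ?_)
        ring
      · have hlt : m.sqrt < d := by
          rw [Finset.mem_Icc] at hs
          push Not at hs
          exact hs hd.1
        have hsq : √(m : ℝ) ≤ d := by
          refine Real.sqrt_le_iff.mpr ⟨by linarith, ?_⟩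
          have := (Nat.sqrt_lt'.mp hlt).le
          exact_mod_cast this
        have := mul_le_mul_of_nonneg_left (hP₀ _ hz1 (by gcongr)) hΛ
        refine this.trans (le_of_eq ?_)
        ring
    rw [hAdef, ← Finset.sum_sub_distrib]
    refine (Finset.abs_sum_le_sum_abs _ _).trans ((Finset.sum_le_sum h1).trans (le_of_eq ?_))
    rw [Finset.sum_add_distrib, Finset.sum_add_distrib, ← Finset.mul_sum, Finset.sum_ite_mem,
      Finset.inter_eq_right.mpr (Finset.Icc_subset_Icc_right (Nat.sqrt_le_self m)),
      ← Finset.mul_sum]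
  have hid := smoothCount_mul_log (m := m) hx hmx
  rw [hlogx] at hid
  have hlx : 0 < u * L := by positivity
  rw [hlogx]
  exact abs_sub_le_of_decomposition hlx hC₁.le hC₂.le hC₃.le hC₄0.le hD₀ hD hFx.le hid hE₁0 hE₂0
    hE₁ hE₂ hA1 hA2 (hmain.trans (by linarith))

end SmoothApprox

namespace SmoothApprox

/-! ### Iteration of the recursion -/

/-- `Psi` is approximated by the Dickman main term, with relative error `D` and absolute error `1`,
on the numbers `z` with `log z / log m ≤ t`. -/
def IsApprox (ρ : ℝ → ℝ) (m : ℕ) (t D : ℝ) : Prop :=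
  ∀ z, 1 ≤ z → Real.log z / Real.log m ≤ t →
    |smoothCount m z - dickmanMain ρ (Real.log m) z| ≤ D * dickmanMain ρ (Real.log m) z + 1

lemma isApprox_one {ρ : ℝ → ℝ} {m : ℕ} (h : IsDickman ρ) (hm : 0 < Real.log m) :
    IsApprox ρ m 1 0 := by
  intro z hz hzt
  have hz0 : 0 < z := by linarith
  have hm0 : (0 : ℝ) < m := by
    rcases Nat.eq_zero_or_pos m with rfl | h0
    · simp at hm
    · exact_mod_cast h0
  have hzm : z ≤ m := by
    rw [div_le_one hm] at hzt
    exact (Real.log_le_log_iff hz0 hm0).mp hzt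
  have h1 : smoothCount m z = ⌊z⌋₊ := by
    rw [smoothCount, psi_eq_self (Nat.floor_le_of_le hzm)]
  have h2 : dickmanMain ρ (Real.log m) z = z := by
    rw [dickmanMain, h.eq_one _ hzt, mul_one]
  rw [h1, h2, zero_mul, zero_add, abs_le]
  have := Nat.lt_floor_add_one z
  have := Nat.floor_le hz0.le
  constructor <;> linarith

lemma sqrt_le_div_four {L : ℝ} (hL : 16 ≤ L) : √L ≤ L / 4 := by
  have h4 : 4 ≤ √L := Real.le_sqrt_of_sq_le (by linarith)
  have := Real.mul_self_sqrt (show 0 ≤ L by linarith)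
  nlinarith

lemma exists_isApprox_step : ∃ C : ℝ, 0 < C ∧ ∀ {ρ : ℝ → ℝ} {m : ℕ} {t D δ : ℝ}, IsDickman ρ →
    16 ≤ Real.log m → dickmanRate ρ (Real.log m * √(Real.log m)) ≤ √(Real.log m) → 1 ≤ t →
    0 ≤ D → D ≤ 1 → δ ≤ 1 → 8 * C / (t * Real.log m) ≤ δ →
    IsApprox ρ m (min t (Real.log m * √(Real.log m))) D →
    IsApprox ρ m (min (t + 1 / 2) (Real.log m * √(Real.log m))) (D + δ) := by
  obtain ⟨C, hC, H⟩ := exists_recursion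
  refine ⟨C, hC, ?_⟩
  intro ρ m t D δ h hL hr ht hD hD1 hδ1 hδ hP
  set L := Real.log m with hLdef
  have hL0 : 0 < L := by linarith
  have hm0 : (0 : ℝ) < m := by
    rcases Nat.eq_zero_or_pos m with rfl | h0
    · norm_num [hLdef] at hL
    · exact_mod_cast h0
  set T := L * √L with hT
  set η := C / (t * L) with hη
  have hη0 : 0 < η := by positivity
  have hδη : 8 * η ≤ δ := by rw [hη, ← mul_div_assoc]; exact hδ
  set B := Real.exp (L * (t + 1 / 2)) with hB
  have key : ∀ n : ℕ, IsApprox ρ m (min (t + 1 / 2) T) (D + δ + (3 / 4) ^ n * B) := by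
    intro n
    induction n with
    | zero =>
      intro z hz hzt
      have hz0 : 0 < z := by linarith
      have hF1 : 1 ≤ dickmanMain ρ L z := by
        refine one_le_dickmanMain (x := Real.exp (T * L)) h hL0 ?_ hz ?_
        · rw [Real.log_exp, mul_div_cancel_right₀ _ hL0.ne']
          exact hr.trans (sqrt_le_div_four hL)
        · rw [← Real.log_le_iff_le_exp hz0, ← div_le_iff₀ hL0]
          exact hzt.trans (min_le_right _ _)
      have hFz : dickmanMain ρ L z ≤ z := by
        rw [dickmanMain]
        exact mul_le_of_le_one_right hz0.le (h.le_one _)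
      have hSz := smoothCount_le m hz0.le
      have hS0 := smoothCount_nonneg m z
      have hzB : z ≤ B := by
        rw [hB, ← Real.log_le_iff_le_exp hz0, mul_comm, ← div_le_iff₀ hL0]
        exact hzt.trans (min_le_left _ _)
      have hB0 : 0 < B := Real.exp_pos _
      have h1 : B ≤ B * dickmanMain ρ L z := le_mul_of_one_le_right hB0.le hF1
      have h2 : 0 ≤ (D + δ) * dickmanMain ρ L z := by
        have : 0 ≤ δ := by linarith
        positivity
      rw [pow_zero, one_mul, add_mul, abs_le]
      constructor <;> linarith
    | succ n ih =>
      intro z hz hzt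
      have hz0 : 0 < z := by linarith
      have hF := (dickmanMain_pos (L := L) h hz0).le
      set q : ℝ := (3 / 4) ^ n * B with hq
      have hq0 : 0 ≤ q := by positivity
      have hq' : (3 / 4 : ℝ) ^ (n + 1) * B = 3 / 4 * q := by rw [hq]; ring
      rw [hq']
      rcases le_or_gt (Real.log z / L) t with hzt' | hzt'
      · refine (hP z hz (le_min hzt' (hzt.trans (min_le_right _ _)))).trans ?_
        gcongr
        linarith
      · have hzT := hzt.trans (min_le_right _ _)
        have h1 := H h hL hz (ht.trans hzt'.le) hzT ((h.rate_mono (ht.trans hzt'.le) hzT).trans hr) hD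
          (show D ≤ D + δ + q by linarith)
          (fun w hw hwz => hP w hw ?_) (fun w hw hwz => ih w hw ?_)
        · refine h1.trans ?_
          have h2 : C * (1 + (D + δ + q)) / Real.log z ≤ η * (1 + (D + δ + q)) := by
            have h3 : t * L ≤ Real.log z := by
              rw [lt_div_iff₀ hL0] at hzt'
              exact hzt'.le
            have h4 : 0 ≤ D + δ + q := by linarith
            rw [hη, div_mul_eq_mul_div]
            gcongr
          have h5 : (D + (D + δ + q)) / 2 + C * (1 + (D + δ + q)) / Real.log z ≤
              D + δ + 3 / 4 * q := by
            have h6 : η ≤ 1 / 8 := by linarith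
            have h7 : η * q ≤ 1 / 8 * q := by gcongr
            have h8 : η * (D + δ) ≤ η * 2 := by gcongr; linarith
            linarith
          have := mul_le_mul_of_nonneg_right h5 hF
          linarith
        · have h2 : Real.log w ≤ Real.log z - L / 2 := by
            rw [hLdef, ← Real.log_sqrt hm0.le, ← Real.log_div hz0.ne' (by positivity)]
            exact Real.log_le_log (by linarith) hwz
          have h3 : Real.log w / L ≤ Real.log z / L - 1 / 2 := by
            rw [div_le_iff₀ hL0, sub_mul, div_mul_cancel₀ _ hL0.ne']
            linarith
          have h4 := hzt.trans (min_le_left _ _)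
          exact le_min (by linarith) (by linarith)
        · refine le_trans ?_ hzt
          gcongr
  intro z hz hzt
  have hlim : Filter.Tendsto
      (fun n : ℕ => (D + δ + (3 / 4 : ℝ) ^ n * B) * dickmanMain ρ L z + 1) Filter.atTop
      (nhds ((D + δ + 0 * B) * dickmanMain ρ L z + 1)) :=
    ((((tendsto_pow_atTop_nhds_zero_of_lt_one (by norm_num) (by norm_num)).mul_const _).const_add
      _).mul_const _).add_const _
  rw [zero_mul, add_zero] at hlim
  exact ge_of_tendsto' hlim fun n => key n z hz hzt

lemma eventually_two_mul_log_le_sqrt :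
    ∀ᶠ L : ℝ in Filter.atTop, 2 * Real.log (2 * (L * √L) + 1) ≤ √L := by
  have h1 : ∀ᶠ v : ℝ in Filter.atTop, 2 * Real.log (2 * v ^ 3 + 1) ≤ v := by
    have h2 := Real.isLittleO_log_id_atTop.bound (show (0 : ℝ) < 1 / 12 by norm_num)
    filter_upwards [h2, Filter.eventually_ge_atTop (4 * Real.log 3), Filter.eventually_ge_atTop 1]
      with v hv hv3 hv1
    rw [Real.norm_eq_abs, Real.norm_eq_abs, id, abs_of_nonneg (Real.log_nonneg hv1),
      abs_of_pos (by linarith)] at hv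
    have h3 : 2 * v ^ 3 + 1 ≤ 3 * v ^ 3 := by
      have := one_le_pow₀ hv1 (n := 3)
      linarith
    have h4 := Real.log_le_log (by positivity) h3
    rw [Real.log_mul (by norm_num) (by positivity), Real.log_pow] at h4
    push_cast at h4
    linarith
  filter_upwards [Real.tendsto_sqrt_atTop.eventually h1, Filter.eventually_ge_atTop 0] with L hL hL0
  have : √L ^ 3 = L * √L := by rw [pow_succ, Real.sq_sqrt hL0]
  rwa [this] at hL

/-- The approximation of smooth counts by the Dickman main term. -/
lemma exists_abs_smoothCount_sub_le : ∃ C K : ℝ, 0 < C ∧ 0 < K ∧ ∀ {ρ : ℝ → ℝ} {m : ℕ} {x : ℝ},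
    IsDickman ρ → K ≤ Real.log m → 1 ≤ x → 1 ≤ Real.log x / Real.log m →
    Real.log x / Real.log m ≤ Real.log m * √(Real.log m) →
    |smoothCount m x - dickmanMain ρ (Real.log m) x| ≤
      C * (Real.log (Real.log x / Real.log m + 1) / Real.log m) *
        dickmanMain ρ (Real.log m) x := by
  obtain ⟨C, hC, H⟩ := exists_isApprox_step
  obtain ⟨C', hC', H'⟩ := exists_recursion
  obtain ⟨K, hK⟩ := Filter.eventually_atTop.mp eventually_two_mul_log_le_sqrt
  refine ⟨64 * C + 4 * C', max (max 16 K) ((16 * C) ^ 2), by positivity, by positivity, ?_⟩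
  intro ρ m x h hKL hx hu huT
  have hL : 16 ≤ Real.log m := (le_max_left _ _).trans ((le_max_left _ _).trans hKL)
  have hlog := hK _ ((le_max_right _ _).trans ((le_max_left _ _).trans hKL))
  have hCL := (le_max_right _ _).trans hKL
  set L := Real.log m with hLdef
  have hL0 : 0 < L := by linarith
  have hsq : 4 ≤ √L := Real.le_sqrt_of_sq_le (by linarith)
  have hT1 : 1 ≤ L * √L := by nlinarith
  have hr : dickmanRate ρ (L * √L) ≤ √L := (h.rate_le hT1).trans hlog
  set u := Real.log x / L with hudef
  have hlogx : Real.log x = u * L := by rw [hudef]; field_simp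
  have hCs : 16 * C ≤ √L := Real.le_sqrt_of_sq_le hCL
  have hDpos : ∀ j : ℕ, (0 : ℝ) ≤ 16 * C / L * (harmonic j : ℝ) := fun j => by
    have : (0 : ℚ) ≤ harmonic j := Finset.sum_nonneg fun i _ => by positivity
    have : (0 : ℝ) ≤ harmonic j := by exact_mod_cast this
    positivity
  have hind : ∀ j : ℕ, 16 * C / L * (harmonic j : ℝ) ≤ 1 →
      IsApprox ρ m (min (1 + j / 2) (L * √L)) (16 * C / L * (harmonic j : ℝ)) := by
    intro j
    induction j with
    | zero =>
      intro _ z hz hzt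
      have := isApprox_one h hL0 z hz (hzt.trans ((min_le_left _ _).trans (by simp)))
      simpa using this
    | succ j ih =>
      intro hj
      have e : 16 * C / L * (harmonic (j + 1) : ℝ) =
          16 * C / L * (harmonic j : ℝ) + 16 * C / L * (j + 1 : ℝ)⁻¹ := by
        rw [harmonic_succ]; push_cast; ring
      have hd : (0 : ℝ) ≤ 16 * C / L * (j + 1 : ℝ)⁻¹ := by positivity
      have hj0 := hDpos j
      have := H (t := 1 + j / 2) (δ := 16 * C / L * (j + 1 : ℝ)⁻¹) h hL hr
        (by have : (0 : ℝ) ≤ j := Nat.cast_nonneg j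
            linarith) hj0 (by linarith) (by linarith)
        (by
          have : (8 * C) / ((1 + (j : ℝ) / 2) * L) = 16 * C / L * (j + 2 : ℝ)⁻¹ := by
            field_simp
            ring
          rw [this]
          gcongr
          norm_num) (ih (by linarith))
      rw [e]
      convert! this using 2
      push_cast
      ring
  set j := ⌈2 * (u - 1)⌉₊ with hj
  have hj1 : u ≤ 1 + j / 2 := by
    have := Nat.le_ceil (2 * (u - 1))
    rw [← hj] at this
    linarith
  have hj2 : (j : ℝ) ≤ 2 * u := by
    have := Nat.ceil_lt_add_one (show 0 ≤ 2 * (u - 1) by linarith)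
    rw [← hj] at this
    linarith
  have hharm : (harmonic j : ℝ) ≤ 1 + Real.log (2 * u) := by
    refine (harmonic_le_one_add_log j).trans ?_
    rcases Nat.eq_zero_or_pos j with h0 | h0
    · rw [h0, Nat.cast_zero, Real.log_zero]
      have := Real.log_nonneg (show 1 ≤ 2 * u by linarith)
      linarith
    · have : (0 : ℝ) < j := by exact_mod_cast h0
      gcongr
  set D := 16 * C / L * (harmonic j : ℝ) with hDdef
  have hD : D ≤ 16 * C / L * (1 + Real.log (2 * u)) := by
    rw [hDdef]; gcongr
  have hD1 : D ≤ 1 := by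
    have h1 : Real.log (2 * u) ≤ Real.log (2 * (L * √L) + 1) :=
      Real.log_le_log (by linarith) (by linarith)
    have h2 : 1 + Real.log (2 * u) ≤ √L := by linarith
    calc D ≤ 16 * C / L * √L := hD.trans (by gcongr)
      _ ≤ √L / L * √L := by gcongr
      _ = 1 := by
        rw [div_mul_eq_mul_div, Real.mul_self_sqrt hL0.le, div_self hL0.ne']
  have hA := hind j hD1
  have hP : ∀ z, 1 ≤ z → z ≤ x → |smoothCount m z - dickmanMain ρ L z| ≤
      D * dickmanMain ρ L z + 1 := fun z hz hzx => by
    have : Real.log z / L ≤ u := by rw [hudef]; gcongr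
    exact hA z hz (le_min (this.trans hj1) (this.trans huT))
  have hm1 : 1 ≤ √(m : ℝ) := by
    rw [Real.one_le_sqrt]
    by_contra hc
    have : L ≤ 0 := Real.log_nonpos (Nat.cast_nonneg _) (not_le.mp hc).le
    linarith
  have hfin := H' h hL hx hu huT ((h.rate_mono hu huT).trans hr) (hDpos j) le_rfl
    (fun z hz hzx => hP z hz (hzx.trans (div_le_self (by linarith) hm1))) hP
  refine hfin.trans ?_
  have hF := (dickmanMain_pos (L := L) h (show 0 < x by linarith)).le
  gcongr
  have hlu : Real.log 2 ≤ Real.log (u + 1) := Real.log_le_log (by norm_num) (by linarith)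
  have hl2 := Real.log_two_gt_d9
  have hl2u : Real.log (2 * u) ≤ 2 * Real.log (u + 1) := by
    rw [Real.log_mul (by norm_num) (by linarith)]
    have : Real.log u ≤ Real.log (u + 1) := Real.log_le_log (by linarith) (by linarith)
    linarith
  rw [hlogx]
  have e1 : C' * (1 + D) / (u * L) ≤ C' * (4 * Real.log (u + 1)) / L := by
    have : L ≤ u * L := le_mul_of_one_le_left hL0.le hu
    have : 0 ≤ D := hDpos j
    have : 0 < Real.log (u + 1) := by linarith
    gcongr
    linarith
  have e2 : 16 * C / L * (1 + Real.log (2 * u)) ≤ 16 * C / L * (4 * Real.log (u + 1)) := by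
    gcongr
    linarith
  calc (D + D) / 2 + C' * (1 + D) / (u * L) ≤
      16 * C / L * (4 * Real.log (u + 1)) + C' * (4 * Real.log (u + 1)) / L := by linarith
    _ = _ := by ring

end SmoothApprox

namespace SmoothApprox

/-! ### Range of parameters and the main theorem -/

lemma le_mul_sqrt_of_le_rpow {u L ε : ℝ} (hε : 0 < ε) (hε' : ε < 3 / 5) (hu : 1 ≤ u) (hL : 1 ≤ L)
    (h : u ≤ (u * L) ^ ((3 : ℝ) / 5 - ε)) : u ≤ L * √L := by
  have hu0 : 0 < u := by linarith
  have hL0 : 0 < L := by linarith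
  have h1 : u ≤ (u * L) ^ ((3 : ℝ) / 5) := h.trans
    (Real.rpow_le_rpow_of_exponent_le (one_le_mul_of_one_le_of_one_le hu hL) (by linarith))
  have h2 : u ^ ((2 : ℝ) / 5) ≤ L ^ ((3 : ℝ) / 5) := by
    have e : u = u ^ ((2 : ℝ) / 5) * u ^ ((3 : ℝ) / 5) := by
      rw [← Real.rpow_add hu0]; norm_num
    rw [Real.mul_rpow hu0.le hL0.le, mul_comm] at h1
    nth_rewrite 1 [e] at h1
    exact le_of_mul_le_mul_right h1 (by positivity)
  have h3 := Real.rpow_le_rpow (by positivity) h2 (show (0 : ℝ) ≤ 5 / 2 by norm_num)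
  rw [← Real.rpow_mul hu0.le, ← Real.rpow_mul hL0.le] at h3
  norm_num at h3
  refine h3.trans (le_of_eq ?_)
  rw [Real.sqrt_eq_rpow, show (3 : ℝ) / 2 = 1 + 1 / 2 by norm_num, Real.rpow_add hL0, Real.rpow_one]

lemma exists_bound_of_log_lt (K : ℝ) {ε : ℝ} (hε : 0 < ε) : ∃ N : ℕ, ∀ n m : ℕ, 3 ≤ n → 2 ≤ m →
    Upsilon n m ≤ (Real.log n) ^ ((3 : ℝ) / 5 - ε) → Real.log m < K → n < N := by
  have hT : Filter.Tendsto (fun n : ℕ => (Real.log n) ^ ((2 : ℝ) / 5 + ε)) Filter.atTop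
      Filter.atTop :=
    (tendsto_rpow_atTop (by linarith)).comp
      (Real.tendsto_log_atTop.comp tendsto_natCast_atTop_atTop)
  obtain ⟨N, hN⟩ := Filter.eventually_atTop.mp (hT.eventually_ge_atTop K)
  refine ⟨N, fun n m hn hm hU hK => not_le.mp fun hNn => ?_⟩
  have h1 := hN n hNn
  have hl : 0 < Real.log n := Real.log_pos (by exact_mod_cast (by omega : 1 < n))
  have hL : 0 < Real.log m := Real.log_pos (by exact_mod_cast (by omega : 1 < m))
  rw [Upsilon, div_le_iff₀ hL] at hU
  have e : Real.log n = (Real.log n) ^ ((3 : ℝ) / 5 - ε) * (Real.log n) ^ ((2 : ℝ) / 5 + ε) := by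
    rw [← Real.rpow_add hl, show (3 : ℝ) / 5 - ε + (2 / 5 + ε) = 1 by ring, Real.rpow_one]
  nth_rewrite 1 [e] at hU
  have := le_of_mul_le_mul_left hU (by positivity)
  linarith

lemma exists_le_mul_of_lt (e b : ℕ → ℕ → ℝ) (N : ℕ) : ∃ B : ℝ, 0 ≤ B ∧ ∀ n < N, ∀ m < N,
    0 < b n m → e n m ≤ B * b n m := by
  refine ⟨∑ n ∈ Finset.range N, ∑ m ∈ Finset.range N, |e n m / b n m|,
    Finset.sum_nonneg fun n _ => Finset.sum_nonneg fun m _ => abs_nonneg _,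
    fun n hn m hm hb => ?_⟩
  rw [← div_le_iff₀ hb]
  refine (le_abs_self _).trans ?_
  refine (Finset.single_le_sum (f := fun m => |e n m / b n m|) (fun m _ => abs_nonneg _)
    (Finset.mem_range.mpr hm)).trans ?_
  exact Finset.single_le_sum (f := fun n => ∑ m ∈ Finset.range N, |e n m / b n m|)
    (fun n _ => Finset.sum_nonneg fun m _ => abs_nonneg _) (Finset.mem_range.mpr hn)

end SmoothApprox

open SmoothApprox

/-- (de Bruijn, 1951) For every `ε ∈ (0, 3/5)` there is a constant `C_ε > 0` such that for all
integers `n ≥ 3`, `m ≥ 2` with `Υ(n,m) ≤ (log n)^(3/5 − ε)`, one has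
`|Ψ(n,m) − n ρ(Υ(n,m))| ≤ C_ε n ρ(Υ(n,m)) log(Υ(n,m)+1)/log m`,
where `ρ` is the Dickman function. -/
theorem deBruijn_smooth_approx
    (ρ : ℝ → ℝ)
    (hρ_cont : ContinuousOn ρ (Set.Ici (0 : ℝ)))
    (hρ_init : ∀ u : ℝ, 0 ≤ u → u ≤ 1 → ρ u = 1)
    (hρ_delay : ∀ u : ℝ, 1 < u → HasDerivAt ρ (-ρ (u - 1) / u) u)
    (ε : ℝ) (hε : 0 < ε) (hε' : ε < 3 / 5) :
    ∃ C : ℝ, 0 < C ∧ ∀ n m : ℕ, 3 ≤ n → 2 ≤ m →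
      Upsilon n m ≤ (Real.log n) ^ ((3 : ℝ) / 5 - ε) →
      |(Psi n m : ℝ) - n * ρ (Upsilon n m)|
        ≤ C * (n * ρ (Upsilon n m) * Real.log (Upsilon n m + 1) / Real.log m) := by
  obtain ⟨C, K, hC, hK, H⟩ := exists_abs_smoothCount_sub_le
  obtain ⟨N, hN⟩ := exists_bound_of_log_lt (max K 1) hε
  have hD := isDickman_comp_max hρ_cont hρ_init hρ_delay
  set e : ℕ → ℕ → ℝ := fun n m => |(Psi n m : ℝ) - n * ρ (Upsilon n m)| with he
  set b : ℕ → ℕ → ℝ := fun n m =>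
    n * ρ (Upsilon n m) * Real.log (Upsilon n m + 1) / Real.log m with hb
  obtain ⟨B, hB0, hB⟩ := exists_le_mul_of_lt e b N
  refine ⟨C + B, by linarith, fun n m hn hm hU => ?_⟩
  change e n m ≤ (C + B) * b n m
  have hnR : (1 : ℝ) ≤ n := by exact_mod_cast (by omega : 1 ≤ n)
  have hl : 0 < Real.log n := Real.log_pos (by exact_mod_cast (by omega : 1 < n))
  have hL : 0 < Real.log m := Real.log_pos (by exact_mod_cast (by omega : 1 < m))
  have hu : 0 < Upsilon n m := div_pos hl hL
  have hρ : ρ (max (Upsilon n m) 0) = ρ (Upsilon n m) := by rw [max_eq_left hu.le]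
  have hpos : 0 < ρ (Upsilon n m) := hρ ▸ hD.pos (Upsilon n m)
  have hlu : 0 < Real.log (Upsilon n m + 1) := Real.log_pos (by linarith)
  have hb0 : 0 < b n m := by simp only [hb]; positivity
  rcases le_or_gt (Upsilon n m) 1 with hu1 | hu1
  · have hnm : n ≤ m := by
      rw [Upsilon, div_le_one hL] at hu1
      have := (Real.log_le_log_iff (by linarith) (by positivity)).mp hu1
      exact_mod_cast this
    have : e n m = 0 := by
      simp only [he]
      rw [hρ_init _ hu.le hu1, psi_eq_self hnm, mul_one, sub_self, abs_zero]
    rw [this]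
    positivity
  rcases lt_or_ge (Real.log m) (max K 1) with hmK | hmK
  · have hnN := hN n m hn hm hU hmK
    have hmn : m < n := by
      by_contra hc
      have : Upsilon n m ≤ 1 := by
        rw [Upsilon, div_le_one hL]
        exact Real.log_le_log (by linarith) (by exact_mod_cast not_lt.mp hc)
      linarith
    have h1 := hB n hnN m (hmn.trans hnN) hb0
    have h2 : 0 ≤ C * b n m := by positivity
    linarith
  · have hlog : Real.log n = Upsilon n m * Real.log m := by rw [Upsilon]; field_simp
    have h1 := H (x := n) hD ((le_max_left _ _).trans hmK) hnR hu1.le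
      (le_mul_sqrt_of_le_rpow hε hε' hu1.le ((le_max_right _ _).trans hmK) (hlog ▸ hU))
    have h2 : smoothCount m n = Psi n m := by rw [smoothCount, Nat.floor_natCast]
    have h3 : dickmanMain (fun u => ρ (max u 0)) (Real.log m) n = n * ρ (Upsilon n m) := by
      rw [← hρ]; rfl
    rw [h2, h3] at h1
    have h4 : e n m ≤ C * b n m := by
      refine h1.trans (le_of_eq ?_)
      simp only [hb, Upsilon]
      ring
    have h5 : 0 ≤ B * b n m := by positivity
    linarith
end
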